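/- For each positive integer k, the k-node bound state of Δu − u + |u|^{p−1}u = 0 is unique at the level of initial data: if u₁ and u₂ are solutions of the IVP with initial values α₁ > 0 and α₂ > 0 respectively, both u₁ and u₂ are decaying, and both have exactly k zeros in (0,∞), then α₁ = α₂. -/

import Mathlib

open Real Filter Set

/-- The nonlinearity `f(s) = -s + |s|^(p-1) s`. -/
noncomputable def f (p s : ℝ) : ℝ := -s + |s| ^ (p - 1) * s

/-- The derivative of the nonlinearity, `f'(s) = -1 + p |s|^(p-1)`. -/
noncomputable def fder (p s : ℝ) : ℝ := -1 + p * |s| ^ (p - 1)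

/-- The primitive `F(s) = -s^2/2 + |s|^(p+1)/(p+1)`. -/
noncomputable def F (p s : ℝ) : ℝ := -s ^ 2 / 2 + |s| ^ (p + 1) / (p + 1)

/-- `u : [0,∞) → ℝ` (modeled on `Set.Ici 0`) is a C² solution of the IVP
`u'' + ((n-1)/r) u' + f(u) = 0`, `u(0) = α`, `u'(0) = 0`; the data `u'`, `u''`
are its first and second derivatives on `[0,∞)`. -/
structure IsSolution (n : ℕ) (p α : ℝ) (u u' u'' : ℝ → ℝ) : Prop where
  init : u 0 = α
  initDeriv : u' 0 = 0
  hasDeriv1 : ∀ r ∈ Set.Ici (0:ℝ), HasDerivWithinAt u (u' r) (Set.Ici 0) r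
  hasDeriv2 : ∀ r ∈ Set.Ici (0:ℝ), HasDerivWithinAt u' (u'' r) (Set.Ici 0) r
  cont2 : ContinuousOn u'' (Set.Ici 0)
  ode : ∀ r : ℝ, 0 < r → u'' r + ((n : ℝ) - 1) / r * u' r + f p (u r) = 0

/-- The variation `v` associated with a solution `u`: the C² solution of the linearized
equation `v'' + ((n-1)/r) v' + f'(u) v = 0`, `v(0) = 1`, `v'(0) = 0`. -/
structure IsVariation (n : ℕ) (p : ℝ) (u v v' v'' : ℝ → ℝ) : Prop where
  init : v 0 = 1
  initDeriv : v' 0 = 0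
  hasDeriv1 : ∀ r ∈ Set.Ici (0:ℝ), HasDerivWithinAt v (v' r) (Set.Ici 0) r
  hasDeriv2 : ∀ r ∈ Set.Ici (0:ℝ), HasDerivWithinAt v' (v'' r) (Set.Ici 0) r
  cont2 : ContinuousOn v'' (Set.Ici 0)
  ode : ∀ r : ℝ, 0 < r → v'' r + ((n : ℝ) - 1) / r * v' r + fder p (u r) * v r = 0

/-- `u` is decaying: `u(r) → 0` and `u'(r) → 0` as `r → ∞`. -/
def Decaying (u u' : ℝ → ℝ) : Prop :=
  Filter.Tendsto u Filter.atTop (nhds 0) ∧ Filter.Tendsto u' Filter.atTop (nhds 0)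

/-- `u` changes sign on `(0,∞)`. -/
def ChangesSign (u : ℝ → ℝ) : Prop :=
  (∃ r : ℝ, 0 < r ∧ u r < 0) ∧ (∃ r : ℝ, 0 < r ∧ 0 < u r)

/-- `z 0 < z 1 < ⋯ < z (k-1)` are exactly the zeros of `u` in `(0,∞)`. -/
def ExactZeros (u : ℝ → ℝ) (k : ℕ) (z : Fin k → ℝ) : Prop :=
  StrictMono z ∧ (∀ i, 0 < z i ∧ u (z i) = 0) ∧
    ∀ r : ℝ, 0 < r → u r = 0 → ∃ i, r = z i

theorem monotoneOn_Icc_of_hasDerivAt {g g' : ℝ → ℝ} {a b : ℝ} (hc : ContinuousOn g (Icc a b))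
    (hd : ∀ x ∈ Ioo a b, HasDerivAt g (g' x) x) (h : ∀ x ∈ Ioo a b, 0 ≤ g' x) :
    MonotoneOn g (Icc a b) := by
  refine monotoneOn_of_hasDerivWithinAt_nonneg (convex_Icc a b) hc (f' := g') ?_ ?_
  · intro x hx; rw [interior_Icc] at hx ⊢; exact (hd x hx).hasDerivWithinAt
  · intro x hx; rw [interior_Icc] at hx; exact h x hx

theorem antitoneOn_Icc_of_hasDerivAt {g g' : ℝ → ℝ} {a b : ℝ} (hc : ContinuousOn g (Icc a b))
    (hd : ∀ x ∈ Ioo a b, HasDerivAt g (g' x) x) (h : ∀ x ∈ Ioo a b, g' x ≤ 0) :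
    AntitoneOn g (Icc a b) := by
  refine antitoneOn_of_hasDerivWithinAt_nonpos (convex_Icc a b) hc (f' := g') ?_ ?_
  · intro x hx; rw [interior_Icc] at hx ⊢; exact (hd x hx).hasDerivWithinAt
  · intro x hx; rw [interior_Icc] at hx; exact h x hx

theorem strictMonoOn_Icc_of_hasDerivAt {g g' : ℝ → ℝ} {a b : ℝ} (hc : ContinuousOn g (Icc a b))
    (hd : ∀ x ∈ Ioo a b, HasDerivAt g (g' x) x) (h : ∀ x ∈ Ioo a b, 0 < g' x) :
    StrictMonoOn g (Icc a b) := by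
  refine strictMonoOn_of_deriv_pos (convex_Icc a b) hc ?_
  intro x hx; rw [interior_Icc] at hx; rw [(hd x hx).deriv]; exact h x hx

theorem strictAntiOn_Icc_of_hasDerivAt {g g' : ℝ → ℝ} {a b : ℝ} (hc : ContinuousOn g (Icc a b))
    (hd : ∀ x ∈ Ioo a b, HasDerivAt g (g' x) x) (h : ∀ x ∈ Ioo a b, g' x < 0) :
    StrictAntiOn g (Icc a b) := by
  refine strictAntiOn_of_deriv_neg (convex_Icc a b) hc ?_
  intro x hx; rw [interior_Icc] at hx; rw [(hd x hx).deriv]; exact h x hx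

theorem hasDerivAt_abs_rpow_mul {p : ℝ} (hp : 1 < p) (s : ℝ) :
    HasDerivAt (fun s : ℝ => |s| ^ (p - 1) * s) (p * |s| ^ (p - 1)) s := by
  rcases eq_or_ne s 0 with rfl | hs
  · have h0 : (0:ℝ) ^ (p - 1) = 0 := Real.zero_rpow (by linarith)
    rw [abs_zero, h0, mul_zero, hasDerivAt_iff_tendsto_slope]
    have hcont : Continuous fun s : ℝ => |s| ^ (p - 1) :=
      continuous_abs.rpow_const fun _ => Or.inr (by linarith)
    have ht := (hcont.tendsto 0).mono_left (nhdsWithin_le_nhds (s := {0}ᶜ))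
    simp only [abs_zero, h0] at ht
    refine ht.congr' ?_
    filter_upwards [self_mem_nhdsWithin] with x hx
    have hx' : x ≠ 0 := hx
    simp [slope_def_field, hx']
  · have h1 := ((hasDerivAt_abs hs).rpow_const (p := p - 1) (Or.inl (abs_ne_zero.2 hs))).mul
      (hasDerivAt_id s)
    refine h1.congr_deriv ?_
    have h2 : (SignType.sign s : ℝ) * s = |s| := sign_mul_self s
    have h3 : |s| ^ (p - 1) = |s| ^ (p - 1 - 1) * |s| := by
      rw [← Real.rpow_add_one (abs_ne_zero.2 hs)]; congr 1; ring
    simp only [id, mul_one]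
    calc _ = (p - 1) * (|s| ^ (p - 1 - 1) * ((SignType.sign s : ℝ) * s)) + |s| ^ (p - 1) := by ring
      _ = _ := by rw [h2, ← h3]; ring

theorem abs_rpow_add_one_eq {p : ℝ} (hp : 1 < p) (s : ℝ) :
    |s| ^ (p + 1) = |s| ^ (p - 1) * s ^ 2 := by
  rcases eq_or_ne s 0 with rfl | hs
  · rw [abs_zero, Real.zero_rpow (by linarith)]; ring
  · rw [← sq_abs, ← Real.rpow_natCast, ← Real.rpow_add (abs_pos.2 hs)]; congr 1; push_cast; ring

theorem hasDerivAt_abs_rpow_mul_sq {p : ℝ} (hp : 1 < p) (s : ℝ) :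
    HasDerivAt (fun s : ℝ => |s| ^ (p - 1) * s ^ 2) ((p + 1) * (|s| ^ (p - 1) * s)) s := by
  have h := hasDerivAt_abs_rpow s (p := p + 1) (by linarith)
  have he : (fun s : ℝ => |s| ^ (p - 1) * s ^ 2) = fun s => |s| ^ (p + 1) :=
    funext fun s => (abs_rpow_add_one_eq hp s).symm
  rw [he]
  refine h.congr_deriv ?_
  rw [show p + 1 - 2 = p - 1 by ring]; ring

theorem continuous_abs_rpow_sub {p : ℝ} (hp : 1 < p) : Continuous fun s : ℝ => |s| ^ (p - 1) :=
  continuous_abs.rpow_const fun _ => Or.inr (by linarith)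

theorem hasDerivAt_f {p : ℝ} (hp : 1 < p) (s : ℝ) : HasDerivAt (f p) (fder p s) s :=
  (hasDerivAt_id s).neg.add (hasDerivAt_abs_rpow_mul hp s)

theorem continuous_fder {p : ℝ} (hp : 1 < p) : Continuous (fder p) :=
  continuous_const.add (continuous_const.mul (continuous_abs_rpow_sub hp))

theorem hasDerivAt_F {p : ℝ} (hp : 1 < p) (s : ℝ) : HasDerivAt (F p) (f p s) s := by
  have h := ((hasDerivAt_pow 2 s).neg.div_const 2).add
    ((hasDerivAt_abs_rpow_mul_sq hp s).div_const (p + 1))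
  have he : F p = ((-fun x : ℝ => x ^ 2) · / 2) + fun s => |s| ^ (p - 1) * s ^ 2 / (p + 1) := by
    funext s; simp [F, abs_rpow_add_one_eq hp]
  rw [he]
  refine h.congr_deriv ?_
  have : p + 1 ≠ 0 := by linarith
  unfold f; field_simp; ring

/-- `w` solves the radial equation `w'' + ((n-1)/r) w' + h(r) = 0`, `w'(0) = 0`. -/
structure RadialSol (n : ℝ) (h w w' : ℝ → ℝ) : Prop where
  cont : ContinuousOn w (Ici 0)
  cont' : ContinuousOn w' (Ici 0)
  deriv_zero : w' 0 = 0
  hasDeriv : ∀ r, 0 < r → HasDerivAt w (w' r) r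
  hasDeriv' : ∀ r, 0 < r → HasDerivAt w' (-((n - 1) / r * w' r) - h r) r

namespace RadialSol

variable {n : ℝ} {h w w' : ℝ → ℝ}

/-- Continuous dependence: a Gronwall estimate for `w ^ 2 + w' ^ 2`. -/
theorem energy_le (H : RadialSol n h w w') (hn : 1 ≤ n) {R L δ : ℝ} (hL : 0 ≤ L)
    (hh : ∀ r, 0 < r → r < R → |h r| ≤ L * |w r| + δ) {r : ℝ} (hr0 : 0 ≤ r) (hr : r ≤ R) :
    w r ^ 2 + w' r ^ 2 ≤ (w 0 ^ 2 + δ ^ 2) * exp ((L + 2) * r) := by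
  have hs : Icc 0 r ⊆ Ici (0:ℝ) := Icc_subset_Ici_self
  have hanti : AntitoneOn (fun t => (w t ^ 2 + w' t ^ 2 + δ ^ 2) * exp (-((L + 2) * t)))
      (Icc 0 r) := by
    refine antitoneOn_Icc_of_hasDerivAt (g' := fun t =>
      ((2 * w t * w' t + 2 * w' t * (-((n - 1) / t * w' t) - h t)) -
        (L + 2) * (w t ^ 2 + w' t ^ 2 + δ ^ 2)) * exp (-((L + 2) * t))) ?_ ?_ ?_
    · exact ((((H.cont.mono hs).pow 2).add ((H.cont'.mono hs).pow 2)).add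
        continuousOn_const).mul (by fun_prop)
    · intro t ht
      have h1 := ((H.hasDeriv t ht.1).pow 2).add ((H.hasDeriv' t ht.1).pow 2)
      have h2 := (((hasDerivAt_id t).const_mul (L + 2)).neg).exp
      refine ((h1.add_const (δ ^ 2)).mul h2).congr_deriv ?_
      simp
      ring
    · intro t ht
      refine mul_nonpos_of_nonpos_of_nonneg ?_ (exp_pos _).le
      have h3 := hh t ht.1 (ht.2.trans_le hr)
      have h4 : 0 ≤ (n - 1) / t * w' t ^ 2 :=
        mul_nonneg (div_nonneg (by linarith) ht.1.le) (sq_nonneg _)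
      have h5 : -(w' t * h t) ≤ |w' t| * (L * |w t| + δ) := by
        calc -(w' t * h t) ≤ |w' t * h t| := neg_le_abs _
          _ = |w' t| * |h t| := abs_mul _ _
          _ ≤ _ := mul_le_mul_of_nonneg_left h3 (abs_nonneg _)
      have e1 := sq_abs (w t)
      have e2 := sq_abs (w' t)
      nlinarith [sq_nonneg (w t - w' t), sq_nonneg (|w' t| - δ), mul_nonneg hL
        (sq_nonneg (|w t| - |w' t|)), mul_nonneg hL (sq_nonneg δ), sq_nonneg δ]
  have h0 := hanti (left_mem_Icc.2 hr0) (right_mem_Icc.2 hr0) hr0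
  simp only [mul_zero, neg_zero, exp_zero, mul_one, H.deriv_zero] at h0
  have h6 : w r ^ 2 + w' r ^ 2 + δ ^ 2 ≤ (w 0 ^ 2 + 0 ^ 2 + δ ^ 2) * exp ((L + 2) * r) := by
    rw [exp_neg, ← div_eq_mul_inv, div_le_iff₀ (exp_pos _)] at h0
    exact h0
  nlinarith [sq_nonneg δ]

theorem sub {h₂ w₂ w₂' : ℝ → ℝ} (H : RadialSol n h w w') (H₂ : RadialSol n h₂ w₂ w₂') :
    RadialSol n (fun r => h r - h₂ r) (fun r => w r - w₂ r) (fun r => w' r - w₂' r) where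
  cont := H.cont.sub H₂.cont
  cont' := H.cont'.sub H₂.cont'
  deriv_zero := by rw [H.deriv_zero, H₂.deriv_zero, sub_zero]
  hasDeriv r hr := (H.hasDeriv r hr).sub (H₂.hasDeriv r hr)
  hasDeriv' r hr := ((H.hasDeriv' r hr).sub (H₂.hasDeriv' r hr)).congr_deriv (by ring)

theorem const_mul (H : RadialSol n h w w') (c : ℝ) :
    RadialSol n (fun r => c * h r) (fun r => c * w r) (fun r => c * w' r) where
  cont := continuousOn_const.mul H.cont
  cont' := continuousOn_const.mul H.cont'
  deriv_zero := by rw [H.deriv_zero, mul_zero]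
  hasDeriv r hr := (H.hasDeriv r hr).const_mul c
  hasDeriv' r hr := ((H.hasDeriv' r hr).const_mul c).congr_deriv (by ring)

theorem congr {h₂ : ℝ → ℝ} (H : RadialSol n h w w') (hh : ∀ r, 0 < r → h r = h₂ r) :
    RadialSol n h₂ w w' :=
  ⟨H.cont, H.cont', H.deriv_zero, H.hasDeriv, fun r hr => hh r hr ▸ H.hasDeriv' r hr⟩

end RadialSol

theorem IsSolution.radialSol {n : ℕ} {p α : ℝ} {u u' u'' : ℝ → ℝ}
    (H : IsSolution n p α u u' u'') : RadialSol n (fun r => f p (u r)) u u' where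
  cont r hr := (H.hasDeriv1 r hr).continuousWithinAt
  cont' r hr := (H.hasDeriv2 r hr).continuousWithinAt
  deriv_zero := H.initDeriv
  hasDeriv r hr := (H.hasDeriv1 r hr.le).hasDerivAt (Ici_mem_nhds hr)
  hasDeriv' r hr := ((H.hasDeriv2 r hr.le).hasDerivAt (Ici_mem_nhds hr)).congr_deriv (by
    have := H.ode r hr; linarith)

/-- The flux `r^(1-n) ∫₀^r t^(n-1) g(t, w(t)) dt`, written so that it makes sense at `r = 0`. -/
noncomputable def radialFlux (n : ℕ) (g : ℝ → ℝ → ℝ) (w : ℝ → ℝ) (s : ℝ) : ℝ :=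
  ∫ σ in (0:ℝ)..1, s * (σ ^ (n - 1) * g (s * σ) (w (s * σ)))

section Flux

variable {n : ℕ} {g : ℝ → ℝ → ℝ} {w w₂ : ℝ → ℝ}

theorem continuous_radialFlux (hg : Continuous (Function.uncurry g)) (hw : Continuous w) :
    Continuous (radialFlux n g w) := by
  unfold radialFlux
  refine intervalIntegral.continuous_parametric_intervalIntegral_of_continuous' ?_ 0 1
  have h1 : Continuous fun q : ℝ × ℝ => g (q.1 * q.2) (w (q.1 * q.2)) :=
    hg.comp ((continuous_fst.mul continuous_snd).prodMk
      (hw.comp (continuous_fst.mul continuous_snd)))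
  exact continuous_fst.mul ((continuous_snd.pow _).mul h1)

theorem radialFlux_zero : radialFlux n g w 0 = 0 := by simp [radialFlux]

theorem hasDerivAt_radialFlux (hn : 1 ≤ n) (hg : Continuous (Function.uncurry g))
    (hw : Continuous w) {r : ℝ} (hr : 0 < r) :
    HasDerivAt (radialFlux n g w) (-(((n:ℝ) - 1) / r * radialFlux n g w r) + g r (w r)) r := by
  have hgw : Continuous fun t => g t (w t) := hg.comp (continuous_id.prodMk hw)
  have hG : ∀ s : ℝ, s ^ (n - 1) * radialFlux n g w s =
      ∫ t in (0:ℝ)..s, t ^ (n - 1) * g t (w t) := by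
    intro s
    have h := intervalIntegral.mul_integral_comp_mul_left (a := 0) (b := 1)
      (f := fun t => t ^ (n - 1) * g t (w t)) s
    rw [mul_zero, mul_one] at h
    rw [← h, radialFlux, ← intervalIntegral.integral_const_mul,
      ← intervalIntegral.integral_const_mul]
    congr 1; funext σ; rw [mul_pow]; ring
  have hd : HasDerivAt (fun s => ∫ t in (0:ℝ)..s, t ^ (n - 1) * g t (w t))
      (r ^ (n - 1) * g r (w r)) r := by
    have hc : Continuous fun t => t ^ (n - 1) * g t (w t) := (continuous_pow _).mul hgw
    exact intervalIntegral.integral_hasDerivAt_right (hc.intervalIntegrable _ _)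
      hc.aestronglyMeasurable.stronglyMeasurableAtFilter hc.continuousAt
  have hq := hd.div (hasDerivAt_pow (n - 1) r) (pow_ne_zero _ hr.ne')
  have heq : radialFlux n g w =ᶠ[nhds r]
      fun s => (∫ t in (0:ℝ)..s, t ^ (n - 1) * g t (w t)) / s ^ (n - 1) := by
    filter_upwards [lt_mem_nhds hr] with s hs
    rw [← hG, mul_div_cancel_left₀ _ (pow_ne_zero _ hs.ne')]
  refine (hq.congr_of_eventuallyEq heq).congr_deriv ?_
  rw [← hG r]
  obtain ⟨N, rfl⟩ : ∃ N, n = N + 1 := ⟨n - 1, by omega⟩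
  simp only [Nat.add_sub_cancel]
  rcases Nat.eq_zero_or_pos N with rfl | hN
  · simp
  · obtain ⟨K, rfl⟩ : ∃ K, N = K + 1 := ⟨N - 1, by omega⟩
    simp only [Nat.add_sub_cancel]
    push_cast
    field_simp
    ring

theorem abs_integral_radialFlux_sub_le (hg : Continuous (Function.uncurry g)) {L lam C : ℝ}
    (hL : 0 ≤ L) (hlip : ∀ r x y, |g r x - g r y| ≤ L * |x - y|) (hlam : 0 < lam) (hC : 0 ≤ C)
    (hw : Continuous w) (hw₂ : Continuous w₂)
    (hww : ∀ t, 0 ≤ t → |w t - w₂ t| ≤ C * exp (lam * t)) {r : ℝ} (hr : 0 ≤ r) :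
    |(∫ s in (0:ℝ)..r, radialFlux n g w s) - ∫ s in (0:ℝ)..r, radialFlux n g w₂ s| ≤
      L * C / lam ^ 2 * exp (lam * r) := by
  have hq : ∀ s, 0 ≤ s → |radialFlux n g w s - radialFlux n g w₂ s| ≤
      L * C / lam * exp (lam * s) := by
    intro s hs
    have hcw : ∀ w : ℝ → ℝ, Continuous w →
        Continuous fun σ : ℝ => s * (σ ^ (n - 1) * g (s * σ) (w (s * σ))) := by
      intro w hw
      have h1 : Continuous fun σ : ℝ => g (s * σ) (w (s * σ)) :=
        hg.comp ((continuous_const.mul continuous_id).prodMk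
          (hw.comp (continuous_const.mul continuous_id)))
      exact continuous_const.mul ((continuous_pow _).mul h1)
    unfold radialFlux
    rw [← intervalIntegral.integral_sub ((hcw w hw).intervalIntegrable _ _)
      ((hcw w₂ hw₂).intervalIntegrable _ _)]
    have hcE : Continuous fun σ : ℝ => L * C * (s * exp (lam * (s * σ))) := by fun_prop
    have hle := intervalIntegral.norm_integral_le_of_norm_le (μ := MeasureTheory.volume)
      (zero_le_one' ℝ)
      (f := fun σ => s * (σ ^ (n - 1) * g (s * σ) (w (s * σ))) -
        s * (σ ^ (n - 1) * g (s * σ) (w₂ (s * σ))))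
      (g := fun σ => L * C * (s * exp (lam * (s * σ)))) (Eventually.of_forall fun σ hσ => by
        have e : s * (σ ^ (n - 1) * g (s * σ) (w (s * σ))) -
            s * (σ ^ (n - 1) * g (s * σ) (w₂ (s * σ))) =
            s * (σ ^ (n - 1) * (g (s * σ) (w (s * σ)) - g (s * σ) (w₂ (s * σ)))) := by ring
        rw [e, Real.norm_eq_abs, abs_mul, abs_mul, abs_of_nonneg hs,
          abs_of_nonneg (pow_nonneg hσ.1.le _)]
        have h2 := (hlip (s * σ) (w (s * σ)) (w₂ (s * σ))).trans
          (mul_le_mul_of_nonneg_left (hww (s * σ) (mul_nonneg hs hσ.1.le)) hL)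
        have h3 : σ ^ (n - 1) ≤ 1 := pow_le_one₀ hσ.1.le hσ.2
        have h4 := mul_le_mul h3 h2 (abs_nonneg _) zero_le_one
        calc _ ≤ s * (1 * (L * (C * exp (lam * (s * σ))))) := mul_le_mul_of_nonneg_left h4 hs
          _ = _ := by ring)
      (hcE.intervalIntegrable _ _)
    refine hle.trans ?_
    have hint : ∫ σ in (0:ℝ)..1, L * C * (s * exp (lam * (s * σ))) =
        L * C / lam * exp (lam * (s * 1)) - L * C / lam * exp (lam * (s * 0)) := by
      refine intervalIntegral.integral_eq_sub_of_hasDerivAt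
        (f := fun σ => L * C / lam * exp (lam * (s * σ))) (fun σ _ => ?_)
        (hcE.intervalIntegrable _ _)
      refine ((((hasDerivAt_id σ).const_mul s).const_mul lam).exp.const_mul
        (L * C / lam)).congr_deriv ?_
      simp only [id]; field_simp
    rw [hint, mul_one, mul_zero, mul_zero, exp_zero, mul_one]
    have : 0 ≤ L * C / lam := by positivity
    linarith
  have hq1 := continuous_radialFlux (n := n) hg hw
  have hq2 := continuous_radialFlux (n := n) hg hw₂
  rw [← intervalIntegral.integral_sub (hq1.intervalIntegrable _ _) (hq2.intervalIntegrable _ _)]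
  have hcE : Continuous fun s : ℝ => L * C / lam * exp (lam * s) := by fun_prop
  have hle := intervalIntegral.norm_integral_le_of_norm_le (μ := MeasureTheory.volume) hr
    (f := fun s => radialFlux n g w s - radialFlux n g w₂ s)
    (g := fun s => L * C / lam * exp (lam * s))
    (Eventually.of_forall fun s hs => hq s hs.1.le) (hcE.intervalIntegrable _ _)
  refine hle.trans ?_
  have hint : ∫ s in (0:ℝ)..r, L * C / lam * exp (lam * s) =
      L * C / lam ^ 2 * exp (lam * r) - L * C / lam ^ 2 * exp (lam * 0) := by
    refine intervalIntegral.integral_eq_sub_of_hasDerivAt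
      (f := fun s => L * C / lam ^ 2 * exp (lam * s)) (fun s _ => ?_)
      (hcE.intervalIntegrable _ _)
    refine (((hasDerivAt_id s).const_mul lam).exp.const_mul (L * C / lam ^ 2)).congr_deriv ?_
    simp only [id]; field_simp
  rw [hint, mul_zero, exp_zero, mul_one]
  have : 0 ≤ L * C / lam ^ 2 := by positivity
  linarith

end Flux

open scoped BoundedContinuousFunction in
theorem exists_radialSol {n : ℕ} (hn : 1 ≤ n) {g : ℝ → ℝ → ℝ}
    (hg : Continuous (Function.uncurry g)) {L : ℝ} (hL : 0 ≤ L)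
    (hlip : ∀ r x y, |g r x - g r y| ≤ L * |x - y|) (h0 : ∀ r, g r 0 = 0) (α : ℝ) :
    ∃ u u' : ℝ → ℝ, u 0 = α ∧ RadialSol n (fun r => g r (u r)) u u' := by
  set lam : ℝ := L + 2 with hlam
  have hlam0 : 0 < lam := by linarith
  have hquot : L / lam ^ 2 ≤ 1 / 2 := by
    rw [div_le_div_iff₀ (by positivity) (by norm_num)]; nlinarith
  let W : (ℝ →ᵇ ℝ) → ℝ → ℝ := fun φ r => exp (lam * |r|) * φ r
  have hW : ∀ φ, Continuous (W φ) := fun φ =>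
    (Real.continuous_exp.comp (continuous_const.mul continuous_abs)).mul φ.continuous
  let I : (ℝ →ᵇ ℝ) → ℝ → ℝ := fun φ r => ∫ s in (0:ℝ)..r, radialFlux n g (W φ) s
  have hI : ∀ φ, Continuous (I φ) := fun φ =>
    intervalIntegral.continuous_primitive
      (fun a b => (continuous_radialFlux hg (hW φ)).intervalIntegrable a b) 0
  have hIsub : ∀ φ ψ : ℝ →ᵇ ℝ, ∀ r : ℝ,
      |I φ (|r|) - I ψ (|r|)| ≤ 1 / 2 * dist φ ψ * exp (lam * |r|) := by
    intro φ ψ r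
    have h := abs_integral_radialFlux_sub_le (n := n) hg hL hlip hlam0
      (dist_nonneg (x := φ) (y := ψ)) (hW φ) (hW ψ) (fun t ht => by
        have h1 : W φ t - W ψ t = (φ t - ψ t) * exp (lam * t) := by
          simp only [W, abs_of_nonneg ht]; ring
        rw [h1, abs_mul, abs_of_pos (exp_pos _)]
        exact mul_le_mul_of_nonneg_right
          (by simpa [Real.dist_eq] using
            BoundedContinuousFunction.dist_coe_le_dist (f := φ) (g := ψ) t)
          (exp_pos _).le)
      (abs_nonneg r)
    refine h.trans (mul_le_mul_of_nonneg_right ?_ (exp_pos _).le)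
    calc _ = L / lam ^ 2 * dist φ ψ := by ring
      _ ≤ _ := mul_le_mul_of_nonneg_right hquot dist_nonneg
  have hI0 : ∀ r, I 0 r = 0 := by
    intro r
    have : ∀ s, radialFlux n g (W 0) s = 0 := by
      intro s; simp [radialFlux, W, h0]
    simp [I, this]
  have hexp1 : ∀ r : ℝ, exp (-(lam * |r|)) ≤ 1 := fun r => by
    rw [exp_le_one_iff]; have := mul_nonneg hlam0.le (abs_nonneg r); linarith
  let T : (ℝ →ᵇ ℝ) → (ℝ →ᵇ ℝ) := fun φ =>
    BoundedContinuousFunction.ofNormedAddCommGroup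
      (fun r => exp (-(lam * |r|)) * (α - I φ (|r|)))
      ((Real.continuous_exp.comp (continuous_const.mul continuous_abs).neg).mul
        (continuous_const.sub ((hI φ).comp continuous_abs)))
      (|α| + 1 / 2 * dist φ 0) (fun r => by
        have h1 := hIsub φ 0 r
        rw [hI0, sub_zero] at h1
        rw [Real.norm_eq_abs, abs_mul, abs_of_pos (exp_pos _)]
        have h2 : |α - I φ (|r|)| ≤ |α| + 1 / 2 * dist φ 0 * exp (lam * |r|) :=
          (abs_sub _ _).trans (by linarith)
        calc _ ≤ exp (-(lam * |r|)) * (|α| + 1 / 2 * dist φ 0 * exp (lam * |r|)) :=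
              mul_le_mul_of_nonneg_left h2 (exp_pos _).le
          _ = exp (-(lam * |r|)) * |α| +
              1 / 2 * dist φ 0 * (exp (-(lam * |r|)) * exp (lam * |r|)) := by ring
          _ ≤ _ := by
              rw [← exp_add, neg_add_cancel, exp_zero, mul_one]
              have := mul_le_mul_of_nonneg_right (hexp1 r) (abs_nonneg α)
              linarith)
  have hT : ContractingWith (1 / 2) T := by
    refine ⟨by rw [← NNReal.coe_lt_coe]; norm_num, LipschitzWith.of_dist_le_mul fun φ ψ => ?_⟩
    rw [BoundedContinuousFunction.dist_le (by positivity)]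
    intro r
    have h1 := hIsub φ ψ r
    have h2 : T φ r - T ψ r = -(exp (-(lam * |r|)) * (I φ (|r|) - I ψ (|r|))) := by
      simp only [T, BoundedContinuousFunction.coe_ofNormedAddCommGroup]; ring
    rw [Real.dist_eq, h2, abs_neg, abs_mul, abs_of_pos (exp_pos _)]
    calc _ ≤ exp (-(lam * |r|)) * (1 / 2 * dist φ ψ * exp (lam * |r|)) :=
          mul_le_mul_of_nonneg_left h1 (exp_pos _).le
      _ = 1 / 2 * dist φ ψ * (exp (-(lam * |r|)) * exp (lam * |r|)) := by ring
      _ = _ := by rw [← exp_add, neg_add_cancel, exp_zero]; simp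
  set φ := ContractingWith.fixedPoint T hT with hφ
  have hfix : T φ = φ := hT.fixedPoint_isFixedPt
  have hu : ∀ r, 0 ≤ r → W φ r = α - I φ r := by
    intro r hr
    have h1 : φ r = exp (-(lam * |r|)) * (α - I φ (|r|)) := by
      conv_lhs => rw [← hfix]
      rfl
    simp only [W]
    rw [h1, ← mul_assoc, ← exp_add, add_neg_cancel, exp_zero, one_mul, abs_of_nonneg hr]
  have hqc := continuous_radialFlux (n := n) hg (hW φ)
  refine ⟨W φ, fun r => -radialFlux n g (W φ) r, ?_, ⟨(hW φ).continuousOn, hqc.neg.continuousOn,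
    by simp [radialFlux_zero], ?_, ?_⟩⟩
  · rw [hu 0 le_rfl]; simp [I]
  · intro r hr
    have h1 : HasDerivAt (I φ) (radialFlux n g (W φ) r) r :=
      intervalIntegral.integral_hasDerivAt_right (hqc.intervalIntegrable _ _)
        hqc.aestronglyMeasurable.stronglyMeasurableAtFilter hqc.continuousAt
    refine (h1.const_sub α).congr_of_eventuallyEq ?_
    filter_upwards [lt_mem_nhds hr] with s hs using hu s hs.le
  · intro r hr
    exact (hasDerivAt_radialFlux hn hg (hW φ) hr).neg.congr_deriv (by ring)

theorem abs_fder_le {p M : ℝ} (hp : 1 < p) {s : ℝ} (hs : |s| ≤ M) :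
    |fder p s| ≤ 1 + p * M ^ (p - 1) := by
  have h1 : |s| ^ (p - 1) ≤ M ^ (p - 1) :=
    Real.rpow_le_rpow (abs_nonneg _) hs (by linarith)
  have h2 : 0 ≤ |s| ^ (p - 1) := Real.rpow_nonneg (abs_nonneg _) _
  have h3 : p * |s| ^ (p - 1) ≤ p * M ^ (p - 1) := mul_le_mul_of_nonneg_left h1 (by linarith)
  have h4 : 0 ≤ p * |s| ^ (p - 1) := mul_nonneg (by linarith) h2
  unfold fder
  rw [abs_le]; constructor <;> linarith

theorem lipschitz_const_nonneg {p M : ℝ} (hp : 1 < p) (hM : 0 ≤ M) : 0 ≤ 1 + p * M ^ (p - 1) := by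
  have := Real.rpow_nonneg hM (p - 1); positivity

theorem abs_f_sub_le {p M : ℝ} (hp : 1 < p) {s t : ℝ} (hs : |s| ≤ M) (ht : |t| ≤ M) :
    |f p s - f p t| ≤ (1 + p * M ^ (p - 1)) * |s - t| := by
  have h := Convex.norm_image_sub_le_of_norm_hasDerivWithin_le (f := f p) (f' := fder p)
    (s := Icc (-M) M) (C := 1 + p * M ^ (p - 1))
    (fun x _ => (hasDerivAt_f hp x).hasDerivWithinAt)
    (fun x hx => abs_fder_le hp (abs_le.2 hx)) (convex_Icc _ _) (abs_le.1 ht) (abs_le.1 hs)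
  simpa [Real.norm_eq_abs] using h

theorem f_zero {p : ℝ} : f p 0 = 0 := by simp [f]

theorem RadialSol.primitive_le {n : ℝ} (hn : 1 ≤ n) {g G u u' : ℝ → ℝ}
    (hG : ∀ s, HasDerivAt G (g s) s) (H : RadialSol n (fun r => g (u r)) u u') {r : ℝ}
    (hr : 0 ≤ r) : G (u r) ≤ G (u 0) := by
  have hs : Icc 0 r ⊆ Ici (0:ℝ) := Icc_subset_Ici_self
  have hGc : Continuous G := continuous_iff_continuousAt.2 fun s => (hG s).continuousAt
  have h := antitoneOn_Icc_of_hasDerivAt (a := 0) (b := r)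
    (g := fun t => u' t ^ 2 / 2 + G (u t)) (g' := fun t => -((n - 1) / t * u' t ^ 2))
    (((H.cont'.mono hs).pow 2).div_const 2 |>.add (hGc.comp_continuousOn (H.cont.mono hs)))
    (fun t ht => by
      refine ((((H.hasDeriv' t ht.1).pow 2).div_const 2).add
        ((hG (u t)).comp t (H.hasDeriv t ht.1))).congr_deriv ?_
      simp; ring)
    (fun t ht => neg_nonpos.2 (mul_nonneg (div_nonneg (by linarith) ht.1.le) (sq_nonneg _)))
    (left_mem_Icc.2 hr) (right_mem_Icc.2 hr) hr
  simp only [H.deriv_zero] at h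
  nlinarith [sq_nonneg (u' r)]

theorem RadialSol.abs_lt_of_primitive {n : ℝ} (hn : 1 ≤ n) {g G u u' : ℝ → ℝ} {M : ℝ}
    (hG : ∀ s, HasDerivAt G (g s) s) (H : RadialSol n (fun r => g (u r)) u u')
    (h0 : |u 0| < M) (h1 : ∀ s, |s| = M → G (u 0) < G s) {r : ℝ} (hr : 0 ≤ r) : |u r| < M := by
  by_contra! hcon
  have hs : Icc 0 r ⊆ Ici (0:ℝ) := Icc_subset_Ici_self
  obtain ⟨t, ht, htM⟩ := intermediate_value_Icc hr (H.cont.mono hs).abs ⟨h0.le, hcon⟩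
  exact absurd (H.primitive_le hn hG ht.1) (not_le.2 (h1 _ htM))

theorem F_le {p s A : ℝ} (hp : 1 < p) (hs : |s| ≤ A) : F p s ≤ A ^ (p + 1) / (p + 1) := by
  have h1 : |s| ^ (p + 1) ≤ A ^ (p + 1) := Real.rpow_le_rpow (abs_nonneg _) hs (by linarith)
  have h2 : |s| ^ (p + 1) / (p + 1) ≤ A ^ (p + 1) / (p + 1) := by gcongr
  unfold F; nlinarith [sq_nonneg s]

theorem exists_barrier {p : ℝ} (hp : 1 < p) (A : ℝ) :
    ∃ M, A < M ∧ ∀ s, |s| = M → A ^ (p + 1) / (p + 1) < F p s := by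
  have ht : Tendsto (fun M : ℝ => M ^ (p - 1)) atTop atTop := tendsto_rpow_atTop (by linarith)
  set K := A ^ (p + 1) / (p + 1) with hK
  obtain ⟨M, hM1, hM2, hM3⟩ := ((ht.eventually_ge_atTop ((p + 1) * (1 / 2 + (|K| + 1)))).and
    ((eventually_gt_atTop A).and (eventually_ge_atTop 1))).exists
  refine ⟨M, hM2, fun s hs => ?_⟩
  have h1 : |s| ^ (p + 1) / (p + 1) = s ^ 2 * (M ^ (p - 1) / (p + 1)) := by
    rw [abs_rpow_add_one_eq hp, hs]; ring
  have h2 : 1 / 2 + (|K| + 1) ≤ M ^ (p - 1) / (p + 1) := by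
    rw [le_div_iff₀ (by linarith)]; linarith
  have h3 : 1 ≤ s ^ 2 := by rw [← sq_abs, hs]; nlinarith
  have h4 := le_abs_self K
  have h5 : s ^ 2 * (1 / 2 + (|K| + 1)) ≤ s ^ 2 * (M ^ (p - 1) / (p + 1)) :=
    mul_le_mul_of_nonneg_left h2 (by positivity)
  unfold F
  rw [h1]
  nlinarith [abs_nonneg K]

/-- A family of global solutions indexed by the initial value, uniformly bounded by `M`. -/
structure SolFamily (n : ℕ) (p A M : ℝ) (U U' : ℝ → ℝ → ℝ) : Prop where
  init : ∀ α ∈ Ioc 0 A, U α 0 = α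
  sol : ∀ α ∈ Ioc 0 A, RadialSol n (fun r => f p (U α r)) (U α) (U' α)
  bound : ∀ α ∈ Ioc 0 A, ∀ r, 0 ≤ r → |U α r| ≤ M

theorem exists_solFamily {n : ℕ} (hn : 1 ≤ n) {p : ℝ} (hp : 1 < p) {A : ℝ} (hA : 0 < A) :
    ∃ M U U', SolFamily n p A M U U' := by
  obtain ⟨M, hAM, hMF⟩ := exists_barrier hp A
  have hM0 : 0 < M := hA.trans hAM
  let cl : ℝ → ℝ := fun x => max (-M) (min M x)
  have hcl : ∀ x, |cl x| ≤ M := fun x => abs_le.2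
    ⟨le_max_left _ _, max_le (by linarith) (min_le_left _ _)⟩
  have hcl' : ∀ x, |x| ≤ M → cl x = x := fun x hx => by
    simp only [cl]; rw [min_eq_right (abs_le.1 hx).2, max_eq_right (abs_le.1 hx).1]
  have hclc : Continuous cl := continuous_const.max (continuous_const.min continuous_id)
  have hcl1 : ∀ x y, |cl x - cl y| ≤ |x - y| := fun x y => by
    have h1 := abs_max_sub_max_le_max (-M) (min M x) (-M) (min M y)
    have h2 := abs_min_sub_min_le_max M x M y
    rw [sub_self, abs_zero] at h1 h2
    exact h1.trans (max_le (abs_nonneg _) (h2.trans (max_le (abs_nonneg _) le_rfl)))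
  have hfc : Continuous (f p) := continuous_iff_continuousAt.2 fun s =>
    (hasDerivAt_f hp s).continuousAt
  let fM : ℝ → ℝ := fun x => f p (cl x)
  have hfM : Continuous fM := hfc.comp hclc
  let FM : ℝ → ℝ := fun x => ∫ t in (0:ℝ)..x, fM t
  have hFM : ∀ s, HasDerivAt FM (fM s) s := fun s =>
    intervalIntegral.integral_hasDerivAt_right (hfM.intervalIntegrable _ _)
      hfM.aestronglyMeasurable.stronglyMeasurableAtFilter hfM.continuousAt
  have hFM' : ∀ x, |x| ≤ M → FM x = F p x := by
    intro x hx
    have h1 : FM x = ∫ t in (0:ℝ)..x, f p t := by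
      refine intervalIntegral.integral_congr fun t ht => ?_
      have : |t| ≤ M := by
        have := abs_sub_left_of_mem_uIcc ht
        rw [sub_zero, sub_zero] at this
        exact this.trans hx
      simp only [fM]; rw [hcl' t this]
    rw [h1, intervalIntegral.integral_eq_sub_of_hasDerivAt (fun t _ => hasDerivAt_F hp t)
      (hfc.intervalIntegrable _ _)]
    have : F p 0 = 0 := by
      have : p + 1 ≠ 0 := by linarith
      simp [F, Real.zero_rpow this]
    rw [this, sub_zero]
  have key : ∀ α : ℝ, ∃ u u' : ℝ → ℝ, α ∈ Ioc 0 A → u 0 = α ∧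
      RadialSol n (fun r => f p (u r)) u u' ∧ ∀ r, 0 ≤ r → |u r| ≤ M := by
    intro α
    obtain ⟨u, u', hu0, hu⟩ := exists_radialSol hn (g := fun _ x => fM x)
      (hfM.comp continuous_snd) (lipschitz_const_nonneg hp hM0.le)
      (fun _ x y => (abs_f_sub_le hp (hcl x) (hcl y)).trans
        (mul_le_mul_of_nonneg_left (hcl1 x y) (lipschitz_const_nonneg hp hM0.le)))
      (fun _ => by simp only [fM]; rw [hcl' 0 (by simpa using hM0.le), f_zero]) α
    refine ⟨u, u', fun hα => ⟨hu0, ?_⟩⟩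
    have habs : |u 0| ≤ A := by rw [hu0, abs_of_pos hα.1]; exact hα.2
    have hb : ∀ r, 0 ≤ r → |u r| ≤ M := fun r hr =>
      (hu.abs_lt_of_primitive (by exact_mod_cast hn) hFM (habs.trans_lt hAM) (fun s hs => by
        rw [hFM' s hs.le, hFM' _ (habs.trans hAM.le)]
        exact (F_le hp habs).trans_lt (hMF s hs)) hr).le
    refine ⟨hu.congr fun r hr => ?_, hb⟩
    simp only [fM]; rw [hcl' _ (hb r hr.le)]
  choose U U' h using key
  exact ⟨M, U, U', fun α hα => (h α hα).1, fun α hα => (h α hα).2.1, fun α hα => (h α hα).2.2⟩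

namespace SolFamily

variable {n : ℕ} {p A M : ℝ} {U U' : ℝ → ℝ → ℝ}

theorem bound_nonneg (S : SolFamily n p A M U U') {α : ℝ} (hα : α ∈ Ioc 0 A) : 0 ≤ M :=
  (abs_nonneg _).trans (S.bound α hα 0 le_rfl)

theorem sub_le (S : SolFamily n p A M U U') (hn : 1 ≤ n) (hp : 1 < p) {α β : ℝ}
    (hα : α ∈ Ioc 0 A) (hβ : β ∈ Ioc 0 A) {r : ℝ} (hr : 0 ≤ r) :
    (U β r - U α r) ^ 2 + (U' β r - U' α r) ^ 2 ≤
      (β - α) ^ 2 * exp ((1 + p * M ^ (p - 1) + 2) * r) := by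
  have hM := S.bound_nonneg hα
  have h := ((S.sol β hβ).sub (S.sol α hα)).energy_le (by exact_mod_cast hn) (R := r) (δ := 0)
    (lipschitz_const_nonneg hp hM) (fun t ht _ => by
      rw [add_zero]; exact abs_f_sub_le hp (S.bound β hβ t ht.le) (S.bound α hα t ht.le)) hr le_rfl
  simpa [S.init β hβ, S.init α hα] using h

/-- Any radial solution with the same initial value agrees with the family member. -/
theorem eq_of_init (S : SolFamily n p A M U U') (hn : 1 ≤ n) (hp : 1 < p) {α : ℝ}
    (hα : α ∈ Ioc 0 A) {u u' : ℝ → ℝ} (hu : RadialSol n (fun r => f p (u r)) u u')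
    (h0 : u 0 = α) {r : ℝ} (hr : 0 ≤ r) : u r = U α r ∧ u' r = U' α r := by
  obtain ⟨C, hC⟩ := (isCompact_Icc (a := (0:ℝ)) (b := r)).exists_bound_of_continuousOn
    (hu.cont.mono Icc_subset_Ici_self)
  have hM := S.bound_nonneg hα
  have h := (hu.sub (S.sol α hα)).energy_le (by exact_mod_cast hn) (R := r) (δ := 0)
    (lipschitz_const_nonneg hp (le_max_of_le_left hM : 0 ≤ max M C)) (fun t ht htr => by
      rw [add_zero]
      exact abs_f_sub_le hp ((hC t ⟨ht.le, htr.le⟩).trans (le_max_right _ _))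
        ((S.bound α hα t ht.le).trans (le_max_left _ _))) hr le_rfl
  simp only [h0, S.init α hα, sub_self, ne_eq, OfNat.ofNat_ne_zero, not_false_eq_true, zero_pow,
    add_zero, zero_mul] at h
  constructor
  · nlinarith [sq_nonneg (u r - U α r), sq_nonneg (u' r - U' α r),
      pow_eq_zero_iff (two_ne_zero) (M₀ := ℝ) (a := u r - U α r) |>.1
        (le_antisymm (by nlinarith [sq_nonneg (u' r - U' α r)]) (sq_nonneg _))]
  · nlinarith [sq_nonneg (u r - U α r), sq_nonneg (u' r - U' α r),
      pow_eq_zero_iff (two_ne_zero) (M₀ := ℝ) (a := u' r - U' α r) |>.1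
        (le_antisymm (by nlinarith [sq_nonneg (u r - U α r)]) (sq_nonneg _))]

theorem exists_variation (S : SolFamily n p A M U U') (hn : 1 ≤ n) (hp : 1 < p) {α : ℝ}
    (hα : α ∈ Ioc 0 A) :
    ∃ v v', v 0 = 1 ∧ RadialSol n (fun r => fder p (U α r) * v r) v v' := by
  have hM := S.bound_nonneg hα
  have hUc : Continuous fun r => U α |r| :=
    (S.sol α hα).cont.comp_continuous continuous_abs fun r => abs_nonneg r
  have hc : Continuous fun r => fder p (U α |r|) := (continuous_fder hp).comp hUc
  obtain ⟨v, v', h0, hv⟩ := exists_radialSol hn (g := fun r x => fder p (U α |r|) * x)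
    ((hc.comp continuous_fst).mul continuous_snd) (lipschitz_const_nonneg hp hM)
    (fun r x y => by
      rw [← mul_sub, abs_mul]
      exact mul_le_mul_of_nonneg_right (abs_fder_le hp (S.bound α hα _ (abs_nonneg r)))
        (abs_nonneg _)) (fun r => mul_zero _) 1
  exact ⟨v, v', h0, hv.congr fun r hr => by rw [abs_of_pos hr]⟩

end SolFamily

theorem exists_abs_taylor_le {p M η : ℝ} (hp : 1 < p) (hη : 0 < η) :
    ∃ ρ > 0, ∀ x y, |x| ≤ M → |y| ≤ M → |x - y| < ρ →
      |f p x - f p y - fder p y * (x - y)| ≤ η * |x - y| := by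
  have huc := isCompact_Icc (a := -M) (b := M) |>.uniformContinuousOn_of_continuous
    (continuous_fder hp).continuousOn
  rw [Metric.uniformContinuousOn_iff] at huc
  obtain ⟨ρ, hρ, h⟩ := huc η hη
  refine ⟨ρ, hρ, fun x y hx hy hxy => ?_⟩
  have hseg : ∀ s ∈ uIcc y x, |s| ≤ M ∧ |s - y| < ρ := by
    intro s hs
    constructor
    · have hsub : uIcc y x ⊆ Icc (-M) M := uIcc_subset_Icc (abs_le.1 hy) (abs_le.1 hx)
      exact abs_le.2 (hsub hs)
    · exact (abs_sub_left_of_mem_uIcc hs).trans_lt hxy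
  have h1 := Convex.norm_image_sub_le_of_norm_hasDerivWithin_le
    (f := fun s => f p s - fder p y * s) (f' := fun s => fder p s - fder p y)
    (s := uIcc y x) (C := η) (x := y) (y := x)
    (fun s _ => by
      have := (hasDerivAt_f hp s).sub ((hasDerivAt_id s).const_mul (fder p y))
      rw [mul_one] at this
      exact this.hasDerivWithinAt)
    (fun s hs => (h s (abs_le.1 (hseg s hs).1) y (abs_le.1 hy) (hseg s hs).2).le)
    (convex_uIcc _ _) left_mem_uIcc right_mem_uIcc
  rw [Real.norm_eq_abs, Real.norm_eq_abs] at h1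
  calc _ = |f p x - fder p y * x - (f p y - fder p y * y)| := by congr 1; ring
    _ ≤ _ := h1

namespace SolFamily

variable {n : ℕ} {p A M : ℝ} {U U' : ℝ → ℝ → ℝ}

theorem abs_sub_le (S : SolFamily n p A M U U') (hn : 1 ≤ n) (hp : 1 < p) {α β : ℝ}
    (hα : α ∈ Ioc 0 A) (hβ : β ∈ Ioc 0 A) {r R : ℝ} (hr : 0 ≤ r) (hrR : r ≤ R) :
    |U β r - U α r| ≤ |β - α| * exp ((1 + p * M ^ (p - 1) + 2) * R) ∧
    |U' β r - U' α r| ≤ |β - α| * exp ((1 + p * M ^ (p - 1) + 2) * R) := by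
  have hL := lipschitz_const_nonneg hp (S.bound_nonneg hα)
  have h := S.sub_le hn hp hα hβ hr
  set K := 1 + p * M ^ (p - 1) + 2 with hK
  have h1 : 1 ≤ exp (K * R) := one_le_exp (mul_nonneg (by linarith) (hr.trans hrR))
  have h2 : exp (K * r) ≤ exp (K * R) := exp_le_exp.2 (mul_le_mul_of_nonneg_left hrR (by linarith))
  have h3 : (β - α) ^ 2 * exp (K * r) ≤ (|β - α| * exp (K * R)) ^ 2 := by
    rw [mul_pow, sq_abs]
    refine mul_le_mul_of_nonneg_left (h2.trans ?_) (sq_nonneg _)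
    nlinarith
  have h4 : 0 ≤ |β - α| * exp (K * R) := by positivity
  constructor
  · exact abs_le_of_sq_le_sq (by nlinarith [sq_nonneg (U' β r - U' α r)]) h4
  · exact abs_le_of_sq_le_sq (by nlinarith [sq_nonneg (U β r - U α r)]) h4

theorem tendsto_slope (S : SolFamily n p A M U U') (hn : 1 ≤ n) (hp : 1 < p) {α : ℝ}
    (hα : α ∈ Ioc 0 A) (hαA : α < A) {v v' : ℝ → ℝ} (hv0 : v 0 = 1)
    (hv : RadialSol n (fun r => fder p (U α r) * v r) v v') {r : ℝ} (hr : 0 ≤ r) :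
    Tendsto (fun β => (U β r - U α r) / (β - α)) (nhdsWithin α (Ioi α)) (nhds (v r)) ∧
    Tendsto (fun β => (U' β r - U' α r) / (β - α)) (nhdsWithin α (Ioi α)) (nhds (v' r)) := by
  have hL := lipschitz_const_nonneg hp (S.bound_nonneg hα)
  set L := 1 + p * M ^ (p - 1) with hLdef
  set E := exp ((L + 2) * r) with hE
  have hE0 : 0 < E := exp_pos _
  have key : ∀ ε > 0, ∀ᶠ β in nhdsWithin α (Ioi α),
      |(U β r - U α r) / (β - α) - v r| ≤ ε ∧ |(U' β r - U' α r) / (β - α) - v' r| ≤ ε := by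
    intro ε hε
    obtain ⟨ρ, hρ, hT⟩ := exists_abs_taylor_le (p := p) (M := M) (η := ε / (E * E)) hp
      (by positivity)
    have hmem : ∀ᶠ β in nhdsWithin α (Ioi α), β ∈ Ioo α (min A (α + ρ / E)) :=
      Ioo_mem_nhdsGT (lt_min hαA (by linarith [div_pos hρ hE0]))
    filter_upwards [hmem] with β hβ
    have hβα : 0 < β - α := sub_pos.2 hβ.1
    have hβA : β ∈ Ioc 0 A := ⟨hα.1.trans hβ.1, (hβ.2.trans_le (min_le_left _ _)).le⟩
    have hβρ : (β - α) * E < ρ := by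
      rw [← lt_div_iff₀ hE0]; linarith [hβ.2.trans_le (min_le_right _ _)]
    have hw := (((S.sol β hβA).sub (S.sol α hα)).const_mul (β - α)⁻¹).sub hv
    have hen := hw.energy_le (by exact_mod_cast hn) (R := r) (δ := ε / E) hL (fun t ht htr => by
      have hd := (S.abs_sub_le hn hp hα hβA ht.le htr.le).1
      rw [abs_of_pos hβα] at hd
      have h1 := hT _ _ (S.bound β hβA t ht.le) (S.bound α hα t ht.le) (hd.trans_lt hβρ)
      have h2 := abs_fder_le hp (S.bound α hα t ht.le)
      have h3 : (β - α)⁻¹ * (f p (U β t) - f p (U α t)) - fder p (U α t) * v t =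
          fder p (U α t) * ((β - α)⁻¹ * (U β t - U α t) - v t) +
          (β - α)⁻¹ * (f p (U β t) - f p (U α t) - fder p (U α t) * (U β t - U α t)) := by ring
      rw [h3]
      refine (abs_add_le _ _).trans (add_le_add ?_ ?_)
      · rw [abs_mul]; exact mul_le_mul_of_nonneg_right h2 (abs_nonneg _)
      · rw [abs_mul, abs_of_pos (inv_pos.2 hβα)]
        calc _ ≤ (β - α)⁻¹ * (ε / (E * E) * ((β - α) * E)) :=
              mul_le_mul_of_nonneg_left
                (h1.trans (mul_le_mul_of_nonneg_left hd (by positivity))) (inv_pos.2 hβα).le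
          _ = ε / E := by field_simp) hr le_rfl
    simp only [S.init β hβA, S.init α hα, hv0, inv_mul_cancel₀ hβα.ne', sub_self] at hen
    have hE1 : 1 ≤ E := one_le_exp (mul_nonneg (by linarith) hr)
    have h5 : (0 ^ 2 + (ε / E) ^ 2) * E ≤ ε ^ 2 := by
      have : (0 ^ 2 + (ε / E) ^ 2) * E = ε ^ 2 / E := by field_simp; ring
      rw [this]; exact div_le_self (sq_nonneg _) hE1
    rw [div_eq_inv_mul, div_eq_inv_mul]
    constructor
    · exact abs_le_of_sq_le_sq (by
        nlinarith [sq_nonneg ((β - α)⁻¹ * (U' β r - U' α r) - v' r)]) hε.le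
    · exact abs_le_of_sq_le_sq (by
        nlinarith [sq_nonneg ((β - α)⁻¹ * (U β r - U α r) - v r)]) hε.le
  constructor
  · rw [Metric.tendsto_nhds]
    intro ε hε
    filter_upwards [key (ε / 2) (half_pos hε)] with β hβ
    rw [Real.dist_eq]; linarith [hβ.1]
  · rw [Metric.tendsto_nhds]
    intro ε hε
    filter_upwards [key (ε / 2) (half_pos hε)] with β hβ
    rw [Real.dist_eq]; linarith [hβ.2]

end SolFamily

/-- `Y = r w' + m w`. -/
noncomputable def yfun (m : ℝ) (w w' : ℝ → ℝ) (r : ℝ) : ℝ := r * w' r + m * w r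

/-- Pohozaev-type functional with parameter `m` (up to the weight `r ^ (n - 2)`). -/
noncomputable def jfun (n p m : ℝ) (u u' : ℝ → ℝ) (r : ℝ) : ℝ :=
  yfun m u u' r ^ 2 / 2 - (r ^ 2 + m * (n - 2 - m)) * u r ^ 2 / 2 +
    r ^ 2 * (|u r| ^ (p - 1) * u r ^ 2) / (p + 1)

/-- Half the first-order deficit of `yfun ^ 2`: `D = 2 J + ((p-1)/(p+1)) r^2 |u|^(p+1)`. -/
noncomputable def dfun (n p m : ℝ) (u u' : ℝ → ℝ) (r : ℝ) : ℝ :=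
  yfun m u u' r ^ 2 - (r ^ 2 + m * (n - 2 - m)) * u r ^ 2 + r ^ 2 * (|u r| ^ (p - 1) * u r ^ 2)

/-- The variation of `jfun` in the direction `v`. -/
noncomputable def kfun (n p m : ℝ) (u u' v v' : ℝ → ℝ) (r : ℝ) : ℝ :=
  yfun m u u' r * yfun m v v' r - (r ^ 2 + m * (n - 2 - m)) * (u r * v r) +
    r ^ 2 * (|u r| ^ (p - 1) * u r * v r)

/-- The Wronskian of `u` and `v`, weighted by `r`. -/
noncomputable def wfun (u u' v v' : ℝ → ℝ) (r : ℝ) : ℝ := r * (u' r * v r - u r * v' r)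

structure SolPair (n p : ℝ) (u u' v v' : ℝ → ℝ) : Prop where
  hn : 3 ≤ n
  hp : 1 < p
  sol : RadialSol n (fun r => f p (u r)) u u'
  init : 0 < u 0
  var : RadialSol n (fun r => fder p (u r) * v r) v v'
  var_init : v 0 = 1

theorem dfun_eq {n p m : ℝ} (hp : 1 < p) (u u' : ℝ → ℝ) (r : ℝ) :
    dfun n p m u u' r = 2 * jfun n p m u u' r +
      (p - 1) / (p + 1) * (r ^ 2 * (|u r| ^ (p - 1) * u r ^ 2)) := by
  have : p + 1 ≠ 0 := by linarith
  unfold dfun jfun; field_simp; ring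

theorem dfun_pos {n p m : ℝ} (hp : 1 < p) {u u' : ℝ → ℝ} {r : ℝ} (h : 0 < jfun n p m u u' r) :
    0 < dfun n p m u u' r := by
  rw [dfun_eq hp]
  have : 0 ≤ (p - 1) / (p + 1) * (r ^ 2 * (|u r| ^ (p - 1) * u r ^ 2)) :=
    mul_nonneg (div_nonneg (by linarith) (by linarith))
      (mul_nonneg (sq_nonneg _) (mul_nonneg (Real.rpow_nonneg (abs_nonneg _) _) (sq_nonneg _)))
  linarith

theorem dfun_mul_eq (n p m : ℝ) (u u' v v' : ℝ → ℝ) (r : ℝ) :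
    dfun n p m u u' r * v r =
      yfun m u u' r * wfun u u' v v' r + u r * kfun n p m u u' v v' r := by
  unfold dfun wfun kfun yfun; ring

section Continuity

variable {n p m : ℝ} {u u' v v' h h₂ : ℝ → ℝ}

theorem RadialSol.continuousOn_yfun (H : RadialSol n h u u') : ContinuousOn (yfun m u u') (Ici 0) :=
  (continuousOn_id.mul H.cont').add (continuousOn_const.mul H.cont)

theorem RadialSol.continuousOn_rpow (H : RadialSol n h u u') (hp : 1 < p) :
    ContinuousOn (fun r => |u r| ^ (p - 1)) (Ici 0) :=
  (continuous_abs_rpow_sub hp).comp_continuousOn H.cont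

theorem RadialSol.continuousOn_jfun (H : RadialSol n h u u') (hp : 1 < p) :
    ContinuousOn (jfun n p m u u') (Ici 0) := by
  have h1 := H.continuousOn_yfun (m := m)
  have h2 := H.continuousOn_rpow hp
  have h3 := H.cont
  unfold jfun; fun_prop

theorem RadialSol.continuousOn_dfun (H : RadialSol n h u u') (hp : 1 < p) :
    ContinuousOn (dfun n p m u u') (Ici 0) := by
  have h1 := H.continuousOn_yfun (m := m)
  have h2 := H.continuousOn_rpow hp
  have h3 := H.cont
  unfold dfun; fun_prop

theorem RadialSol.continuousOn_kfun (H : RadialSol n h u u') (H₂ : RadialSol n h₂ v v')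
    (hp : 1 < p) : ContinuousOn (kfun n p m u u' v v') (Ici 0) := by
  have h1 := H.continuousOn_yfun (m := m)
  have h2 := H.continuousOn_rpow hp
  have h3 := H.cont
  have h4 := H₂.continuousOn_yfun (m := m)
  have h5 := H₂.cont
  unfold kfun; fun_prop

theorem RadialSol.continuousOn_wfun (H : RadialSol n h u u') (H₂ : RadialSol n h₂ v v') :
    ContinuousOn (wfun u u' v v') (Ici 0) := by
  have h1 := H.cont
  have h2 := H.cont'
  have h3 := H₂.cont
  have h4 := H₂.cont'
  unfold wfun; fun_prop

end Continuity

section Derivatives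

variable {n p m : ℝ} {u u' v v' : ℝ → ℝ} {r : ℝ}

theorem RadialSol.hasDerivAt_yfun {h w w' : ℝ → ℝ} (H : RadialSol n h w w') (hr : 0 < r) :
    HasDerivAt (yfun m w w')
      ((-(n - 2 - m) * yfun m w w' r + m * (n - 2 - m) * w r - r ^ 2 * h r) / r) r := by
  refine (((hasDerivAt_id r).mul (H.hasDeriv' r hr)).add
    ((H.hasDeriv r hr).const_mul m)).congr_deriv
    ?_
  unfold yfun; simp only [id]; field_simp; ring

theorem RadialSol.hasDerivAt_div {h w w' : ℝ → ℝ} (H : RadialSol n h w w') (hr : 0 < r) (m : ℝ) :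
    HasDerivAt w ((yfun m w w' r - m * w r) / r) r := by
  refine (H.hasDeriv r hr).congr_deriv ?_
  unfold yfun; field_simp; ring

theorem RadialSol.hasDerivAt_pot {h w w' : ℝ → ℝ} (H : RadialSol n h w w') (hr : 0 < r) (m : ℝ)
    (hp : 1 < p) : HasDerivAt (fun r => |w r| ^ (p - 1) * w r ^ 2)
      ((p + 1) * (|w r| ^ (p - 1) * w r) * (yfun m w w' r - m * w r) / r) r := by
  refine ((hasDerivAt_abs_rpow_mul_sq hp (w r)).comp r (H.hasDerivAt_div hr m)).congr_deriv ?_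
  ring

theorem RadialSol.hasDerivAt_nonlin {h w w' : ℝ → ℝ} (H : RadialSol n h w w') (hr : 0 < r) (m : ℝ)
    (hp : 1 < p) : HasDerivAt (fun r => |w r| ^ (p - 1) * w r)
      (p * |w r| ^ (p - 1) * (yfun m w w' r - m * w r) / r) r := by
  refine ((hasDerivAt_abs_rpow_mul hp (w r)).comp r (H.hasDerivAt_div hr m)).congr_deriv ?_
  ring

theorem hasDerivAt_jfun (hp : 1 < p) (H : RadialSol n (fun r => f p (u r)) u u') (hr : 0 < r) :
    HasDerivAt (jfun n p m u u')
      ((-2 * (n - 2 - m) * jfun n p m u u' r -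
        ((1 - (2 * m - n + 2)) * r ^ 2 - (2 * m - n + 2) * (m * (n - 2 - m))) * u r ^ 2 -
        (m * (p + 3) - 2 * (n - 1)) / (p + 1) * (r ^ 2 * (|u r| ^ (p - 1) * u r ^ 2))) / r) r := by
  have hY := H.hasDerivAt_yfun (m := m) hr
  have hu := H.hasDerivAt_div hr m
  have hN := H.hasDerivAt_pot hr m hp
  have hr2 := hasDerivAt_pow 2 r
  have h := ((hY.pow 2).div_const 2).sub
    (((hr2.add_const (m * (n - 2 - m))).mul (hu.pow 2)).div_const 2) |>.add
    ((hr2.mul hN).div_const (p + 1))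
  refine h.congr_deriv ?_
  have hp1 : p + 1 ≠ 0 := by linarith
  unfold jfun f
  simp only [Pi.pow_apply]
  generalize yfun m u u' r = Y
  generalize |u r| ^ (p - 1) = q
  generalize u r = x
  simp
  field_simp
  ring

theorem hasDerivAt_dfun (hp : 1 < p) (H : RadialSol n (fun r => f p (u r)) u u') (hr : 0 < r) :
    HasDerivAt (dfun n p m u u')
      ((-2 * (n - 2 - m) * dfun n p m u u' r -
        2 * ((1 - (2 * m - n + 2)) * r ^ 2 - (2 * m - n + 2) * (m * (n - 2 - m))) * u r ^ 2 -
        (m * (p + 3) - 2 * (n - 1)) * (r ^ 2 * (|u r| ^ (p - 1) * u r ^ 2)) +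
        (p - 1) * r ^ 2 * (|u r| ^ (p - 1) * u r) * yfun m u u' r) / r) r := by
  have hY := H.hasDerivAt_yfun (m := m) hr
  have hu := H.hasDerivAt_div hr m
  have hN := H.hasDerivAt_pot hr m hp
  have hr2 := hasDerivAt_pow 2 r
  have h := (hY.pow 2).sub ((hr2.add_const (m * (n - 2 - m))).mul (hu.pow 2)) |>.add (hr2.mul hN)
  refine h.congr_deriv ?_
  unfold dfun f
  simp only [Pi.pow_apply]
  generalize yfun m u u' r = Y
  generalize |u r| ^ (p - 1) = q
  generalize u r = x
  simp
  field_simp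
  ring

theorem SolPair.hasDerivAt_kfun (P : SolPair n p u u' v v') (hr : 0 < r) :
    HasDerivAt (kfun n p m u u' v v')
      ((-2 * (n - 2 - m) * kfun n p m u u' v v' r -
        2 * ((1 - (2 * m - n + 2)) * r ^ 2 - (2 * m - n + 2) * (m * (n - 2 - m))) * (u r * v r) -
        (m * (p + 3) - 2 * (n - 1)) * (r ^ 2 * (|u r| ^ (p - 1) * u r * v r))) / r) r := by
  have hY := P.sol.hasDerivAt_yfun (m := m) hr
  have hYv := P.var.hasDerivAt_yfun (m := m) hr
  have hu := P.sol.hasDerivAt_div hr m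
  have hv := P.var.hasDerivAt_div hr m
  have hN := P.sol.hasDerivAt_nonlin hr m P.hp
  have hr2 := hasDerivAt_pow 2 r
  have h := (hY.mul hYv).sub ((hr2.add_const (m * (n - 2 - m))).mul (hu.mul hv)) |>.add
    (hr2.mul (hN.mul hv))
  refine h.congr_deriv ?_
  unfold kfun f fder
  simp only [Pi.mul_apply]
  generalize yfun m u u' r = Y
  generalize yfun m v v' r = Yv
  generalize |u r| ^ (p - 1) = q
  generalize u r = x
  generalize v r = y
  simp
  field_simp
  ring

theorem SolPair.hasDerivAt_wfun (P : SolPair n p u u' v v') (hr : 0 < r) :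
    HasDerivAt (wfun u u' v v')
      ((-(n - 2) * wfun u u' v v' r +
        (p - 1) * (r ^ 2 * (|u r| ^ (p - 1) * u r * v r))) / r) r := by
  have h := (hasDerivAt_id r).mul (((P.sol.hasDeriv' r hr).mul (P.var.hasDeriv r hr)).sub
    ((P.sol.hasDeriv r hr).mul (P.var.hasDeriv' r hr)))
  refine h.congr_deriv ?_
  unfold wfun f fder
  simp only [id, Pi.mul_apply, Pi.sub_apply]
  field_simp
  ring

end Derivatives

/-- Positivity of a cooperative linear system, starting from positive data. -/
theorem pos_of_cooperative {x y x' y' A B : ℝ → ℝ} {a b : ℝ}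
    (hx : ContinuousOn x (Icc a b)) (hy : ContinuousOn y (Icc a b))
    (hx' : ∀ t ∈ Ioo a b, HasDerivAt x (x' t) t) (hy' : ∀ t ∈ Ioo a b, HasDerivAt y (y' t) t)
    (hA : ContinuousOn A (Icc a b)) (hB : ContinuousOn B (Icc a b))
    (hxA : ∀ t ∈ Ioo a b, 0 < y t → A t * x t ≤ x' t)
    (hyB : ∀ t ∈ Ioo a b, 0 < x t → B t * y t ≤ y' t)
    (hxa : 0 < x a) (hya : 0 < y a) : ∀ t ∈ Icc a b, 0 < x t ∧ 0 < y t := by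
  intro t₁ ht₁
  by_contra hcon
  obtain ⟨CA, hCA⟩ := isCompact_Icc.exists_bound_of_continuousOn hA
  obtain ⟨CB, hCB⟩ := isCompact_Icc.exists_bound_of_continuousOn hB
  set S := {t ∈ Icc a b | min (x t) (y t) ≤ 0} with hS
  have hmin : ContinuousOn (fun t => min (x t) (y t)) (Icc a b) := hx.inf hy
  have hSc : IsClosed S := by
    have := hmin.preimage_isClosed_of_isClosed isClosed_Icc (isClosed_Iic (a := (0:ℝ)))
    exact this
  have hSne : S.Nonempty := ⟨t₁, ht₁, by
    rw [min_le_iff]; by_contra! h; exact hcon h⟩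
  have hSb : BddBelow S := ⟨a, fun t ht => ht.1.1⟩
  set τ := sInf S with hτ
  have hτS : τ ∈ S := hSc.csInf_mem hSne hSb
  have hbefore : ∀ t ∈ Ico a τ, 0 < x t ∧ 0 < y t := by
    intro t ht
    by_contra h
    have : t ∈ S := ⟨⟨ht.1, ht.2.le.trans hτS.1.2⟩, by
      rw [min_le_iff]; by_contra! h'; exact h h'⟩
    exact absurd (csInf_le hSb this) (not_le.2 ht.2)
  have hsub : Icc a τ ⊆ Icc a b := Icc_subset_Icc_right hτS.1.2
  have main : ∀ (z z' E : ℝ → ℝ) (C : ℝ), ContinuousOn z (Icc a b) →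
      (∀ t ∈ Ioo a b, HasDerivAt z (z' t) t) → (∀ t ∈ Icc a b, ‖E t‖ ≤ C) →
      (∀ t ∈ Ioo a τ, 0 < z t ∧ E t * z t ≤ z' t) → 0 < z a → 0 < z τ := by
    intro z z' E C hz hz' hE hzE hza
    have h := monotoneOn_Icc_of_hasDerivAt (a := a) (b := τ) (g := fun t => z t * exp (C * t))
      (g' := fun t => (z' t + C * z t) * exp (C * t))
      ((hz.mono hsub).mul (by fun_prop))
      (fun t ht => by
        have := (hz' t ⟨ht.1, ht.2.trans_le hτS.1.2⟩).mul (((hasDerivAt_id t).const_mul C).exp)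
        refine this.congr_deriv ?_
        simp; ring)
      (fun t ht => mul_nonneg (by
        have h1 := (abs_le.1 (hE t ⟨ht.1.le, (ht.2.trans_le hτS.1.2).le⟩)).1
        have h2 := hzE t ht
        nlinarith [h2.1, h2.2]) (exp_pos _).le)
      (left_mem_Icc.2 hτS.1.1) (right_mem_Icc.2 hτS.1.1) hτS.1.1
    have h0 : 0 < z a * exp (C * a) := mul_pos hza (exp_pos _)
    exact pos_of_mul_pos_left (h0.trans_le h) (exp_pos _).le
  have h1 := main x x' A CA hx hx' hCA (fun t ht => ⟨(hbefore t ⟨ht.1.le, ht.2⟩).1,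
    hxA t ⟨ht.1, ht.2.trans_le hτS.1.2⟩ (hbefore t ⟨ht.1.le, ht.2⟩).2⟩) hxa
  have h2 := main y y' B CB hy hy' hCB (fun t ht => ⟨(hbefore t ⟨ht.1.le, ht.2⟩).2,
    hyB t ⟨ht.1, ht.2.trans_le hτS.1.2⟩ (hbefore t ⟨ht.1.le, ht.2⟩).1⟩) hya
  exact absurd hτS.2 (not_le.2 (lt_min h1 h2))

theorem ContinuousOn.eventually_pos_zero {g : ℝ → ℝ} (hg : ContinuousOn g (Ici 0)) (h : 0 < g 0) :
    ∃ ρ > 0, ∀ r, 0 ≤ r → r ≤ ρ → 0 < g r := by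
  have h1 := (hg 0 self_mem_Ici).eventually (lt_mem_nhds h)
  rw [eventually_nhdsWithin_iff, Metric.eventually_nhds_iff] at h1
  obtain ⟨ε, hε, h2⟩ := h1
  refine ⟨ε / 2, half_pos hε, fun r hr hrε => h2 ?_ hr⟩
  rw [Real.dist_eq, sub_zero, abs_of_nonneg hr]; linarith

namespace SolPair

variable {n p : ℝ} {u u' v v' : ℝ → ℝ}

theorem abs_rpow_pos_of_ne {x : ℝ} (hx : x ≠ 0) : 0 < |x| ^ (p - 1) :=
  Real.rpow_pos_of_pos (abs_pos.2 hx) _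

theorem wfun_pos_near_zero (P : SolPair n p u u' v v') :
    ∃ ρ > 0, ∀ r, 0 < r → r ≤ ρ → 0 < wfun u u' v v' r := by
  have hn := P.hn
  obtain ⟨ρ₁, hρ₁, h1⟩ := P.sol.cont.eventually_pos_zero P.init
  obtain ⟨ρ₂, hρ₂, h2⟩ := P.var.cont.eventually_pos_zero (by rw [P.var_init]; exact one_pos)
  refine ⟨min ρ₁ ρ₂, lt_min hρ₁ hρ₂, fun r hr hrρ => ?_⟩
  have hs : Icc 0 r ⊆ Ici (0:ℝ) := Icc_subset_Ici_self
  have hm := strictMonoOn_Icc_of_hasDerivAt (a := 0) (b := r)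
    (g := fun t => t ^ (n - 2) * wfun u u' v v' t)
    (g' := fun t => t ^ (n - 2) * ((p - 1) * (t ^ 2 * (|u t| ^ (p - 1) * u t * v t))) / t)
    ((Real.continuous_rpow_const (by linarith)).continuousOn.mul
      ((P.sol.continuousOn_wfun P.var).mono hs))
    (fun t ht => by
      refine ((Real.hasDerivAt_rpow_const (Or.inl ht.1.ne')).mul
        (P.hasDerivAt_wfun ht.1)).congr_deriv ?_
      rw [Real.rpow_sub_one ht.1.ne']
      have := ht.1.ne'
      field_simp; ring)
    (fun t ht => by
      have h3 := h1 t ht.1.le (ht.2.le.trans (hrρ.trans (min_le_left _ _)))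
      have h4 := h2 t ht.1.le (ht.2.le.trans (hrρ.trans (min_le_right _ _)))
      have h5 := abs_rpow_pos_of_ne (p := p) h3.ne'
      have h6 : 0 < t ^ (n - 2) := Real.rpow_pos_of_pos ht.1 _
      have h7 : 0 < p - 1 := by linarith [P.hp]
      have h8 := ht.1
      positivity)
    (left_mem_Icc.2 hr.le) (right_mem_Icc.2 hr.le) hr
  simp only [wfun, zero_mul, mul_zero] at hm
  exact pos_of_mul_pos_right hm (Real.rpow_nonneg hr.le _)

end SolPair

section JPos

variable {n p m : ℝ} {u u' : ℝ → ℝ}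

/-- The coefficient of `-u^2` in the derivative of the weighted `jfun`. -/
noncomputable def jcoef (n p m : ℝ) (u : ℝ → ℝ) (r : ℝ) : ℝ :=
  (1 - (2 * m - n + 2)) * r ^ 2 - (2 * m - n + 2) * (m * (n - 2 - m)) +
    (m * (p + 3) - 2 * (n - 1)) / (p + 1) * (r ^ 2 * |u r| ^ (p - 1))

theorem hasDerivAt_rpow_mul_jfun (hp : 1 < p) (H : RadialSol n (fun r => f p (u r)) u u') {r : ℝ}
    (hr : 0 < r) : HasDerivAt (fun r => r ^ (2 * (n - 2 - m)) * jfun n p m u u' r)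
      (-(r ^ (2 * (n - 2 - m)) / r * (jcoef n p m u r * u r ^ 2))) r := by
  refine ((Real.hasDerivAt_rpow_const (Or.inl hr.ne')).mul (hasDerivAt_jfun hp H hr)).congr_deriv ?_
  rw [Real.rpow_sub_one hr.ne']
  unfold jcoef
  field_simp
  ring

theorem RadialSol.continuousOn_rpow_mul_jfun (H : RadialSol n (fun r => f p (u r)) u u')
    (hp : 1 < p) (hm : m ≤ n - 2) :
    ContinuousOn (fun r => r ^ (2 * (n - 2 - m)) * jfun n p m u u' r) (Ici 0) :=
  (Real.continuous_rpow_const (by linarith)).continuousOn.mul (H.continuousOn_jfun hp)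

theorem jfun_pos_of_pos (hp : 1 < p) (H : RadialSol n (fun r => f p (u r)) u u') (h0 : u 0 ≠ 0)
    (hm : m ≤ n - 2) (hme : 0 < m * (2 * m - n + 2)) {ρ : ℝ}
    (h1 : ∀ r, 0 < r → r < ρ → jcoef n p m u r ≤ 0)
    (h2 : ∀ r, 0 < r → ρ < r → 0 ≤ jcoef n p m u r) {R : ℝ} (hR : 0 < jfun n p m u u' R)
    {r : ℝ} (hr0 : 0 < r) (hr : r ≤ R) : 0 < jfun n p m u u' r := by
  have hc := H.continuousOn_rpow_mul_jfun hp hm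
  have hw : ∀ t : ℝ, 0 < t → 0 < t ^ (2 * (n - 2 - m)) := fun t ht => Real.rpow_pos_of_pos ht _
  rcases le_total ρ r with hρ | hρ
  · have h := antitoneOn_Icc_of_hasDerivAt (a := r) (b := R)
      (hc.mono fun t ht => hr0.le.trans ht.1)
      (fun t ht => hasDerivAt_rpow_mul_jfun hp H (hr0.trans ht.1))
      (fun t ht => by
        have ht0 := hr0.trans ht.1
        have := mul_nonneg (div_pos (hw t ht0) ht0).le
          (mul_nonneg (h2 t ht0 (hρ.trans_lt ht.1)) (sq_nonneg (u t)))
        linarith) (left_mem_Icc.2 hr) (right_mem_Icc.2 hr) hr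
    exact pos_of_mul_pos_right ((mul_pos (hw R (hr0.trans_le hr)) hR).trans_le h) (hw r hr0).le
  · obtain ⟨ε, hε, hJ⟩ := (H.continuousOn_jfun (n := n) (m := m) hp).eventually_pos_zero (by
      unfold jfun yfun
      have : 0 < u 0 ^ 2 := by positivity
      have h3 := mul_pos hme this
      norm_num
      nlinarith)
    have ha : 0 < min ε r := lt_min hε hr0
    have h := monotoneOn_Icc_of_hasDerivAt (a := min ε r) (b := r)
      (hc.mono fun t ht => ha.le.trans ht.1)
      (fun t ht => hasDerivAt_rpow_mul_jfun hp H (ha.trans ht.1))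
      (fun t ht => by
        have ht0 := ha.trans ht.1
        have := mul_nonneg (div_pos (hw t ht0) ht0).le
          (mul_nonneg (neg_nonneg.2 (h1 t ht0 (ht.2.trans_le hρ))) (sq_nonneg (u t)))
        linarith) (left_mem_Icc.2 (min_le_right _ _)) (right_mem_Icc.2 (min_le_right _ _))
        (min_le_right _ _)
    exact pos_of_mul_pos_right
      ((mul_pos (hw _ ha) (hJ _ ha.le (min_le_left _ _))).trans_le h) (hw r hr0).le

theorem jfun_pos_of_tendsto (hp : 1 < p) (H : RadialSol n (fun r => f p (u r)) u u') (h0 : u 0 ≠ 0)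
    (hm : m ≤ n - 2) (hme : 0 < m * (2 * m - n + 2)) {ρ : ℝ}
    (h1 : ∀ r, 0 < r → r < ρ → jcoef n p m u r ≤ 0)
    (h2 : ∀ r, 0 < r → ρ < r → 0 ≤ jcoef n p m u r)
    (h3 : ∀ᶠ r in atTop, 0 < jcoef n p m u r * u r ^ 2)
    (ht : Tendsto (fun r => r ^ (2 * (n - 2 - m)) * jfun n p m u u' r) atTop (nhds 0))
    {r : ℝ} (hr : 0 < r) : 0 < jfun n p m u u' r := by
  obtain ⟨R, hR⟩ := eventually_atTop.1 h3
  set R₁ := max R r with hR₁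
  have hR0 : 0 < R₁ := hr.trans_le (le_max_right _ _)
  have hanti : ∀ b, StrictAntiOn (fun r => r ^ (2 * (n - 2 - m)) * jfun n p m u u' r)
      (Icc R₁ b) := fun b => strictAntiOn_Icc_of_hasDerivAt
    ((H.continuousOn_rpow_mul_jfun hp hm).mono fun t ht => hR0.le.trans ht.1)
    (fun t ht => hasDerivAt_rpow_mul_jfun hp H (hR0.trans ht.1))
    (fun t ht => by
      have ht0 := hR0.trans ht.1
      have := mul_pos (div_pos (Real.rpow_pos_of_pos ht0 (2 * (n - 2 - m))) ht0)
        (hR t ((le_max_left _ _).trans ht.1.le))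
      linarith)
  have h4 : 0 ≤ (R₁ + 1) ^ (2 * (n - 2 - m)) * jfun n p m u u' (R₁ + 1) :=
    le_of_tendsto ht (eventually_atTop.2 ⟨R₁ + 1, fun b hb =>
      (hanti b).antitoneOn ⟨by linarith, hb⟩ ⟨by linarith, le_rfl⟩ hb⟩)
  have h5 := hanti (R₁ + 1) ⟨le_rfl, by linarith⟩ ⟨by linarith, le_rfl⟩ (lt_add_one R₁)
  exact jfun_pos_of_pos hp H h0 hm hme h1 h2
    (pos_of_mul_pos_right (h4.trans_lt h5) (Real.rpow_nonneg hR0.le _)) hr (le_max_right _ _)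

theorem RadialSol.deriv_ne_zero_of_zero (hn : 1 ≤ n) (hp : 1 < p)
    (H : RadialSol n (fun r => f p (u r)) u u') (h0 : u 0 ≠ 0) {R : ℝ} (hR : 0 < R)
    (hz : u R = 0) : u' R ≠ 0 := by
  intro hz'
  apply h0
  have key : ∀ r ∈ Ioo 0 R, u r = 0 := by
    intro r hr
    have hs : ∀ t ∈ Icc r R, 0 < t := fun t ht => hr.1.trans_le ht.1
    have hq : ContinuousOn (fun t => |u t| ^ (p - 1)) (Icc r R) :=
      (continuous_abs_rpow_sub hp).comp_continuousOn (H.cont.mono fun t ht => (hs t ht).le)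
    obtain ⟨C, hC⟩ := isCompact_Icc.exists_bound_of_continuousOn hq
    set N := 2 * (n - 1) / r + 2 + C with hN
    have h := monotoneOn_Icc_of_hasDerivAt (a := r) (b := R)
      (g := fun t => (u t ^ 2 + u' t ^ 2) * exp (N * t))
      (g' := fun t => (2 * u t * u' t + 2 * u' t * (-((n - 1) / t * u' t) - f p (u t)) +
        N * (u t ^ 2 + u' t ^ 2)) * exp (N * t))
      ((((H.cont.mono fun t ht => (hs t ht).le).pow 2).add
        ((H.cont'.mono fun t ht => (hs t ht).le).pow 2)).mul (by fun_prop))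
      (fun t ht => by
        have ht0 := hs t ⟨ht.1.le, ht.2.le⟩
        refine ((((H.hasDeriv t ht0).pow 2).add ((H.hasDeriv' t ht0).pow 2)).mul
          (((hasDerivAt_id t).const_mul N).exp)).congr_deriv ?_
        simp; ring)
      (fun t ht => by
        have ht0 := hs t ⟨ht.1.le, ht.2.le⟩
        refine mul_nonneg ?_ (exp_pos _).le
        have h1 := hC t ⟨ht.1.le, ht.2.le⟩
        have hq0 : 0 ≤ |u t| ^ (p - 1) := Real.rpow_nonneg (abs_nonneg _) _
        rw [Real.norm_of_nonneg hq0] at h1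
        have h2 : (n - 1) / t ≤ (n - 1) / r :=
          div_le_div_of_nonneg_left (by linarith) hr.1 ht.1.le
        unfold f
        rw [hN]
        generalize |u t| ^ (p - 1) = q at *
        have h3 : 2 * (n - 1) / r = 2 * ((n - 1) / r) := by ring
        rw [h3]
        generalize (n - 1) / t = a at *
        generalize ha' : (n - 1) / r = a' at *
        have ha0 : 0 ≤ a' := by rw [← ha']; exact div_nonneg (by linarith) hr.1.le
        have e1 : 0 ≤ (a' - a) * u' t ^ 2 := mul_nonneg (by linarith) (sq_nonneg _)
        have e2 : 0 ≤ (C - q) * (u t ^ 2 + u' t ^ 2) := mul_nonneg (by linarith) (by positivity)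
        have e3 : 0 ≤ q * (u t - u' t) ^ 2 := by positivity
        have e4 : 0 ≤ a' * u t ^ 2 := by positivity
        nlinarith [sq_nonneg (u t + u' t)])
      (left_mem_Icc.2 hr.2.le) (right_mem_Icc.2 hr.2.le) hr.2.le
    simp only [hz, hz'] at h
    have h4 : u r ^ 2 + u' r ^ 2 ≤ 0 := by
      by_contra! hc
      have := mul_pos hc (exp_pos (N * r))
      norm_num at h; linarith
    nlinarith [sq_nonneg (u r), sq_nonneg (u' r)]
  have h1 : Tendsto u (nhdsWithin 0 (Ioi 0)) (nhds (u 0)) :=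
    (H.cont 0 self_mem_Ici).mono_left (nhdsWithin_mono _ Ioi_subset_Ici_self)
  refine tendsto_nhds_unique h1 (tendsto_const_nhds.congr' ?_)
  filter_upwards [Ioo_mem_nhdsGT hR] with r hr using (key r hr).symm

theorem jfun_pos_at_zero {R : ℝ} (hR : 0 < R) (hz : u R = 0) (hz' : u' R ≠ 0) :
    0 < jfun n p m u u' R := by
  have : jfun n p m u u' R = (R * u' R) ^ 2 / 2 := by simp [jfun, yfun, hz]
  rw [this]; positivity

end JPos

/-- The exponent `m` for which the `|u|^(p+1)` term drops out of the derivative of `jfun`. -/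
structure CriticalParam (n p m : ℝ) : Prop where
  hn : 3 ≤ n
  hp : 1 < p
  sub : p * (n - 2) < n + 2
  eq : m * (p + 3) = 2 * (n - 1)

namespace CriticalParam

variable {n p m : ℝ}

theorem pos (h : CriticalParam n p m) : 0 < m := by
  have := h.hn; have := h.hp; have := h.eq
  by_contra! hc
  nlinarith

theorem exc_pos (h : CriticalParam n p m) : 0 < 2 * m - n + 2 := by
  have := h.hn; have := h.hp; have := h.eq; have := h.sub
  by_contra! hc
  nlinarith

theorem exc_lt_one (h : CriticalParam n p m) : 2 * m - n + 2 < 1 := by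
  have := h.hn; have := h.hp; have := h.eq; have := h.sub
  by_contra! hc
  nlinarith

theorem le (h : CriticalParam n p m) : m ≤ n - 2 := by
  have := h.hn; have := h.hp; have := h.eq; have := h.sub
  by_contra! hc
  nlinarith

theorem mul_exc_pos (h : CriticalParam n p m) : 0 < m * (2 * m - n + 2) := mul_pos h.pos h.exc_pos

theorem prod_nonneg (h : CriticalParam n p m) : 0 ≤ (2 * m - n + 2) * (m * (n - 2 - m)) :=
  mul_nonneg h.exc_pos.le (mul_nonneg h.pos.le (by linarith [h.le]))

theorem jcoef_eq (h : CriticalParam n p m) (u : ℝ → ℝ) (r : ℝ) : jcoef n p m u r =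
    (1 - (2 * m - n + 2)) * r ^ 2 - (2 * m - n + 2) * (m * (n - 2 - m)) := by
  unfold jcoef; rw [h.eq]; simp

/-- The radius at which `jcoef` changes sign. -/
noncomputable def radius (n m : ℝ) : ℝ :=
  √((2 * m - n + 2) * (m * (n - 2 - m)) / (1 - (2 * m - n + 2)))

theorem sq_radius (h : CriticalParam n p m) :
    (1 - (2 * m - n + 2)) * radius n m ^ 2 = (2 * m - n + 2) * (m * (n - 2 - m)) := by
  have h1 : 0 < 1 - (2 * m - n + 2) := by linarith [h.exc_lt_one]
  rw [radius, Real.sq_sqrt (div_nonneg h.prod_nonneg h1.le)]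
  field_simp

theorem jcoef_nonpos (h : CriticalParam n p m) (u : ℝ → ℝ) {r : ℝ} (hr : 0 < r)
    (hr' : r < radius n m) : jcoef n p m u r ≤ 0 := by
  rw [h.jcoef_eq, ← h.sq_radius, ← mul_sub]
  exact mul_nonpos_of_nonneg_of_nonpos (by linarith [h.exc_lt_one]) (by nlinarith)

theorem jcoef_pos (h : CriticalParam n p m) (u : ℝ → ℝ) {r : ℝ}
    (hr' : radius n m < r) : 0 < jcoef n p m u r := by
  rw [h.jcoef_eq, ← h.sq_radius, ← mul_sub]
  have : 0 ≤ radius n m := Real.sqrt_nonneg _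
  exact mul_pos (by linarith [h.exc_lt_one]) (by nlinarith)

end CriticalParam

theorem critical_coef_nonneg {e J s D g b k₁ η p : ℝ} (he : 0 < e) (he1 : e < 1) (hp3 : p ≤ 3)
    (hJ : 0 < J) (hs : 0 ≤ s) (hD : D = 2 * J + s) (hb : g ≤ b) (hb0 : 0 ≤ b)
    (hk : k₁ = (p + 1) * s) (hη : η = e * J - g / 2) :
    0 ≤ e ^ 2 * J * D - e * g * D - 2 * e * g * J + g ^ 2 + b * D - η ^ 2 * k₁ / D := by
  have hD0 : 0 < D := by linarith
  have h1 : 0 ≤ (b - e * g) := by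
    rcases le_total 0 g with h | h
    · nlinarith
    · nlinarith
  have h2 : 0 ≤ (b - e * g) * D ^ 2 := by positivity
  have h3 : 0 ≤ J * ((e * (s - 2 * J) + g) ^ 2 + g ^ 2 + 4 * e ^ 2 * s * J) := by positivity
  have h4 : 0 ≤ (3 - p) * (s * η ^ 2) := mul_nonneg (by linarith) (by positivity)
  have h5 : e ^ 2 * J * D - e * g * D - 2 * e * g * J + g ^ 2 + b * D - η ^ 2 * k₁ / D =
      ((b - e * g) * D ^ 2 + (3 - p) * (s * η ^ 2) +
        J * ((e * (s - 2 * J) + g) ^ 2 + g ^ 2 + 4 * e ^ 2 * s * J)) / D := by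
    rw [eq_div_iff hD0.ne', sub_mul, div_mul_cancel₀ _ hD0.ne', hk, hη, hD]; ring
  rw [h5]; positivity

/-- `η = e J - g / 2`. -/
noncomputable def etafun (n p m : ℝ) (u u' : ℝ → ℝ) (r : ℝ) : ℝ :=
  (2 * m - n + 2) * jfun n p m u u' r -
    ((1 - (2 * m - n + 2)) * r ^ 2 - (2 * m - n + 2) * (m * (n - 2 - m))) * u r ^ 2

/-- `Λ = D K - η W`. -/
noncomputable def lamfun (n p m : ℝ) (u u' v v' : ℝ → ℝ) (r : ℝ) : ℝ :=
  dfun n p m u u' r * kfun n p m u u' v v' r - etafun n p m u u' r * wfun u u' v v' r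

namespace SolPair

variable {n p m : ℝ} {u u' v v' : ℝ → ℝ}

theorem continuousOn_etafun (P : SolPair n p u u' v v') :
    ContinuousOn (etafun n p m u u') (Ici 0) := by
  have h1 := P.sol.continuousOn_jfun (n := n) (m := m) P.hp
  have h2 := P.sol.cont
  unfold etafun; fun_prop

theorem continuousOn_lamfun (P : SolPair n p u u' v v') :
    ContinuousOn (lamfun n p m u u' v v') (Ici 0) :=
  ((P.sol.continuousOn_dfun P.hp).mul (P.sol.continuousOn_kfun P.var P.hp)).sub
    (P.continuousOn_etafun.mul (P.sol.continuousOn_wfun P.var))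

/-!
Coefficients of the system satisfied by `lamfun` and `wfun`:
* `lamRate`: the diagonal coefficient in the equation of `lamfun`
* `wronRate`: the diagonal coefficient in the equation of `wfun`
* `lamForce`: the forcing coefficient in the equation of `lamfun`
-/

noncomputable def lamRate (n p m : ℝ) (u u' : ℝ → ℝ) (r : ℝ) : ℝ :=
  2 * (2 * m - n + 2) - 2 * (n - 2) +
  (-4 * (((1 - (2 * m - n + 2)) * r ^ 2 - (2 * m - n + 2) * (m * (n - 2 - m))) * u r ^ 2) +
    (p - 1) * r ^ 2 * (|u r| ^ (p - 1) * u r) * yfun m u u' r) / dfun n p m u u' r -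
    etafun n p m u u' r * ((p - 1) * (r ^ 2 * (|u r| ^ (p - 1) * u r ^ 2))) / dfun n p m u u' r ^ 2

noncomputable def wronRate (n p m : ℝ) (u u' : ℝ → ℝ) (r : ℝ) : ℝ :=
  -(n - 2) + (p - 1) * r ^ 2 * (|u r| ^ (p - 1) * u r) * yfun m u u' r / dfun n p m u u' r +
    etafun n p m u u' r * ((p - 1) * (r ^ 2 * (|u r| ^ (p - 1) * u r ^ 2))) / dfun n p m u u' r ^ 2

noncomputable def lamForce (n p m : ℝ) (u u' : ℝ → ℝ) (r : ℝ) : ℝ :=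
  let e := 2 * m - n + 2
  let J := jfun n p m u u' r
  let D := dfun n p m u u' r
  let g := 2 * (((1 - e) * r ^ 2 - e * (m * (n - 2 - m))) * u r ^ 2)
  e ^ 2 * J * D - e * g * D - 2 * e * g * J + g ^ 2 + 2 * (1 - e) * r ^ 2 * u r ^ 2 * D -
    etafun n p m u u' r ^ 2 * ((p - 1) * (r ^ 2 * (|u r| ^ (p - 1) * u r ^ 2))) / D

theorem lamForce_nonneg (hC : CriticalParam n p m) (hp3 : p ≤ 3) {r : ℝ}
    (hJ : 0 < jfun n p m u u' r) : 0 ≤ lamForce n p m u u' r := by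
  have hp := hC.hp
  have hq : 0 ≤ |u r| ^ (p - 1) := Real.rpow_nonneg (abs_nonneg _) _
  have hp1 : 0 < p - 1 := by linarith
  have hp2 : 0 < p + 1 := by linarith
  have he : 0 < 1 - (2 * m - n + 2) := by linarith [hC.exc_lt_one]
  refine critical_coef_nonneg (s := (p - 1) / (p + 1) * (r ^ 2 * (|u r| ^ (p - 1) * u r ^ 2)))
    hC.exc_pos hC.exc_lt_one hp3 hJ (by positivity) (dfun_eq hp u u' r) ?_ (by positivity) ?_ ?_
  · have := mul_nonneg hC.prod_nonneg (sq_nonneg (u r)); nlinarith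
  · field_simp
  · unfold etafun; ring

theorem hasDerivAt_lamfun (P : SolPair n p u u' v v') (hC : CriticalParam n p m) {r : ℝ}
    (hr : 0 < r) (hD : dfun n p m u u' r ≠ 0) :
    HasDerivAt (lamfun n p m u u' v v')
      ((lamRate n p m u u' r * lamfun n p m u u' v v' r +
        lamForce n p m u u' r / dfun n p m u u' r * wfun u u' v v' r) / r) r := by
  have hη := ((hasDerivAt_jfun (m := m) P.hp P.sol hr).const_mul (2 * m - n + 2)).sub
    ((((hasDerivAt_pow 2 r).const_mul (1 - (2 * m - n + 2))).sub_const
      ((2 * m - n + 2) * (m * (n - 2 - m)))).mul ((P.sol.hasDerivAt_div hr m).pow 2))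
  have h := ((hasDerivAt_dfun (m := m) P.hp P.sol hr).mul (P.hasDerivAt_kfun (m := m) hr)).sub
    (hη.mul (P.hasDerivAt_wfun hr))
  refine h.congr_deriv ?_
  have hv := dfun_mul_eq n p m u u' v v' r
  have hDJ := dfun_eq (n := n) (m := m) P.hp u u' r
  rw [hC.eq]
  have hn : n = m * (p + 3) / 2 + 1 := by linarith [hC.eq]
  have hp1 : p + 1 ≠ 0 := by linarith [hC.hp]
  unfold lamRate lamForce lamfun etafun
  simp only [Pi.mul_apply, Pi.pow_apply, Pi.sub_apply]
  generalize dfun n p m u u' r = D at *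
  generalize kfun n p m u u' v v' r = K at *
  generalize wfun u u' v v' r = W at *
  generalize yfun m u u' r = Y at *
  generalize |u r| ^ (p - 1) = q at *
  generalize jfun n p m u u' r = J at *
  generalize u r = x at *
  have hv' : v r = (Y * W + x * K) / D := by field_simp; linarith
  rw [hv']
  have hq : J = (D - (p - 1) / (p + 1) * (r ^ 2 * (q * x ^ 2))) / 2 := by linarith
  subst hq
  simp only [Nat.cast_ofNat]
  field_simp
  ring

end SolPair

namespace SolPair

variable {n p m : ℝ} {u u' v v' : ℝ → ℝ}

theorem hasDerivAt_wfun_rate (P : SolPair n p u u' v v') {r : ℝ}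
    (hr : 0 < r) (hD : dfun n p m u u' r ≠ 0) :
    HasDerivAt (wfun u u' v v')
      ((wronRate n p m u u' r * wfun u u' v v' r +
        (p - 1) * (r ^ 2 * (|u r| ^ (p - 1) * u r ^ 2)) / dfun n p m u u' r ^ 2 *
          lamfun n p m u u' v v' r) / r) r := by
  refine (P.hasDerivAt_wfun hr).congr_deriv ?_
  have hv := dfun_mul_eq n p m u u' v v' r
  unfold wronRate lamfun
  generalize dfun n p m u u' r = D at *
  generalize kfun n p m u u' v v' r = K at *
  generalize wfun u u' v v' r = W at *
  generalize yfun m u u' r = Y at *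
  have hv' : v r = (Y * W + u r * K) / D := by field_simp; linarith
  rw [hv']
  field_simp
  ring

theorem lamfun_pos_near_zero (P : SolPair n p u u' v v') (hC : CriticalParam n p m) :
    ∃ ρ > 0, ∀ r, 0 ≤ r → r ≤ ρ → 0 < lamfun n p m u u' v v' r := by
  refine (P.continuousOn_lamfun (m := m)).eventually_pos_zero ?_
  have h1 : lamfun n p m u u' v v' 0 = (m * (2 * m - n + 2)) ^ 2 * u 0 ^ 3 := by
    unfold lamfun dfun kfun etafun wfun yfun jfun
    rw [P.var_init]; ring
  rw [h1]
  have := P.init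
  have := hC.mul_exc_pos
  positivity

theorem lam_wfun_pos_of_critical (P : SolPair n p u u' v v') (hC : CriticalParam n p m)
    (hp3 : p ≤ 3) {R : ℝ} (hJ : ∀ r, 0 < r → r ≤ R → 0 < jfun n p m u u' r) {r : ℝ} (hr : 0 < r)
    (hrR : r ≤ R) : 0 < lamfun n p m u u' v v' r ∧ 0 < wfun u u' v v' r := by
  obtain ⟨ρ₁, hρ₁, h1⟩ := P.wfun_pos_near_zero
  obtain ⟨ρ₂, hρ₂, h2⟩ := P.lamfun_pos_near_zero hC
  have ha : 0 < min r (min ρ₁ ρ₂) := lt_min hr (lt_min hρ₁ hρ₂)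
  have har : min r (min ρ₁ ρ₂) ≤ r := min_le_left _ _
  have ha1 : min r (min ρ₁ ρ₂) ≤ ρ₁ := (min_le_right _ _).trans (min_le_left _ _)
  have ha2 : min r (min ρ₁ ρ₂) ≤ ρ₂ := (min_le_right _ _).trans (min_le_right _ _)
  generalize min r (min ρ₁ ρ₂) = a at *
  have hsub : Icc a R ⊆ Ici (0:ℝ) := fun t ht => ha.le.trans ht.1
  have hp := P.hp
  have hJ' : ∀ t ∈ Icc a R, 0 < jfun n p m u u' t := fun t ht => hJ t (ha.trans_le ht.1) ht.2
  have hD : ∀ t ∈ Icc a R, dfun n p m u u' t ≠ 0 := fun t ht => (dfun_pos hp (hJ' t ht)).ne'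
  have hD2 : ∀ t ∈ Icc a R, dfun n p m u u' t ^ 2 ≠ 0 := fun t ht => pow_ne_zero 2 (hD t ht)
  have ht0 : ∀ t ∈ Icc a R, t ≠ 0 := fun t ht => (ha.trans_le ht.1).ne'
  have c1 := (P.sol.continuousOn_yfun (m := m)).mono hsub
  have c2 := (P.sol.continuousOn_dfun (m := m) hp).mono hsub
  have c3 := (P.sol.cont).mono hsub
  have c4 := (P.sol.continuousOn_rpow hp).mono hsub
  have c5 := (P.continuousOn_etafun (m := m)).mono hsub
  refine pos_of_cooperative (A := fun t => lamRate n p m u u' t / t)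
    (B := fun t => wronRate n p m u u' t / t)
    (P.continuousOn_lamfun.mono hsub) ((P.sol.continuousOn_wfun P.var).mono hsub)
    (fun t ht => P.hasDerivAt_lamfun hC (ha.trans ht.1) (hD t ⟨ht.1.le, ht.2.le⟩))
    (fun t ht => P.hasDerivAt_wfun_rate (m := m) (ha.trans ht.1) (hD t ⟨ht.1.le, ht.2.le⟩))
    ?_ ?_ ?_ ?_ (h2 a ha.le ha2) (h1 a ha ha1) r ⟨har, hrR⟩
  · refine ContinuousOn.div ?_ continuousOn_id ht0
    unfold lamRate; fun_prop (disch := assumption)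
  · refine ContinuousOn.div ?_ continuousOn_id ht0
    unfold wronRate; fun_prop (disch := assumption)
  · intro t ht hy
    have h3 : 0 < t := ha.trans ht.1
    have h4 := hJ' t ⟨ht.1.le, ht.2.le⟩
    have h5 : 0 ≤ lamForce n p m u u' t / dfun n p m u u' t * wfun u u' v v' t :=
      mul_nonneg (div_nonneg (lamForce_nonneg hC hp3 h4) (dfun_pos hp h4).le) hy.le
    rw [div_mul_eq_mul_div]
    gcongr; linarith
  · intro t ht hx
    have h3 : 0 < t := ha.trans ht.1
    have h6 : 0 ≤ |u t| ^ (p - 1) := Real.rpow_nonneg (abs_nonneg _) _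
    have h7 : 0 < p - 1 := by linarith
    have h5 : 0 ≤ (p - 1) * (t ^ 2 * (|u t| ^ (p - 1) * u t ^ 2)) / dfun n p m u u' t ^ 2 *
          lamfun n p m u u' v v' t := by positivity
    rw [div_mul_eq_mul_div]
    gcongr; linarith

/-- A monotone quantity forcing algebraic lower bounds at infinity. -/
theorem monotoneOn_lam_mul_wfun (P : SolPair n p u u' v v') (hC : CriticalParam n p m)
    (hp3 : p ≤ 3) (hJ : ∀ r, 0 < r → 0 < jfun n p m u u' r) :
    MonotoneOn (fun r => r ^ (n - 2) * (lamfun n p m u u' v v' r * wfun u u' v v' r /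
      dfun n p m u u' r ^ 2)) (Ioi 0) := by
  have hp := P.hp
  intro a ha b hb hab
  rw [mem_Ioi] at ha hb
  have hsub : Icc a b ⊆ Ici (0:ℝ) := fun t ht => ha.le.trans ht.1
  have hD : ∀ t, 0 < t → 0 < dfun n p m u u' t := fun t ht => dfun_pos hp (hJ t ht)
  refine monotoneOn_Icc_of_hasDerivAt (a := a) (b := b)
    (g := fun r => r ^ (n - 2) * (lamfun n p m u u' v v' r * wfun u u' v v' r /
      dfun n p m u u' r ^ 2)) (g' := fun t => t ^ (n - 2) / t *
    ((lamForce n p m u u' t / dfun n p m u u' t * wfun u u' v v' t ^ 2 +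
      (p - 1) * (t ^ 2 * (|u t| ^ (p - 1) * u t ^ 2)) / dfun n p m u u' t ^ 2 *
          lamfun n p m u u' v v' t ^ 2) / dfun n p m u u' t ^ 2)) ?_ ?_ ?_
    (left_mem_Icc.2 hab) (right_mem_Icc.2 hab) hab
  · refine ((Real.continuous_rpow_const (by linarith [P.hn])).continuousOn).mul
      (((P.continuousOn_lamfun.mul (P.sol.continuousOn_wfun P.var)).mono hsub).div
        (((P.sol.continuousOn_dfun hp).mono hsub).pow 2) fun t ht => ?_)
    exact pow_ne_zero 2 (hD t (ha.trans_le ht.1)).ne'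
  · intro t ht
    have ht0 : 0 < t := ha.trans ht.1
    have hDt := (hD t ht0).ne'
    refine ((Real.hasDerivAt_rpow_const (Or.inl ht0.ne')).mul
      (((P.hasDerivAt_lamfun hC ht0 hDt).mul (P.hasDerivAt_wfun_rate ht0 hDt)).div
        ((hasDerivAt_dfun hp P.sol ht0).pow 2) (pow_ne_zero 2 hDt))).congr_deriv ?_
    rw [Real.rpow_sub_one ht0.ne', hC.eq]
    simp only [Pi.mul_apply, Pi.pow_apply, Pi.div_apply, Nat.cast_ofNat]
    generalize lamForce n p m u u' t = E at *
    unfold lamRate wronRate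
    generalize dfun n p m u u' t = D at *
    generalize lamfun n p m u u' v v' t = L at *
    generalize wfun u u' v v' t = W at *
    generalize yfun m u u' t = Y at *
    generalize etafun n p m u u' t = η at *
    generalize |u t| ^ (p - 1) = q at *
    generalize t ^ (n - 2) = τ at *
    field_simp
    ring
  · intro t ht
    have ht0 : 0 < t := ha.trans ht.1
    have h6 : 0 ≤ |u t| ^ (p - 1) := Real.rpow_nonneg (abs_nonneg _) _
    have h7 : 0 < p - 1 := by linarith
    have h8 := lamForce_nonneg hC hp3 (hJ t ht0)
    have h9 := hD t ht0
    have h10 : 0 < t ^ (n - 2) := Real.rpow_pos_of_pos ht0 _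
    positivity

end SolPair

/-- Parameters of the barrier argument in dimension three, as functions of `d = 2 / (p - 1)`. -/
noncomputable def hpar (d t : ℝ) : ℝ := 3 / 2 - (d - 1 / 2) * (1 + d) * (1 - t)

theorem half_le_hpar {d t : ℝ} (hd : 1 / 2 < d) (hd1 : d < 1) (ht : 0 < t) :
    1 / 2 ≤ hpar d t := by
  unfold hpar
  have h1 : (d - 1 / 2) * (1 + d) ≤ 1 := by nlinarith
  have h2 : 0 ≤ (d - 1 / 2) * (1 + d) := by nlinarith
  nlinarith

/-- `Sd` as an explicit expression. -/
theorem barrier_source_eq {d t G B A x h : ℝ} (hd : d ≠ 0) (ht : t ≠ 0) (hG : G ≠ 0)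
    (hH : hpar d t ≠ 0) (hx : x = 2 * (1 + d) / d * (1 - t)) (hh : h = t * hpar d t)
    (hA : G * A = G * (1 - (1 + d) * (1 - t)) + (1 - G) * h) :
    (1 - G * B) * ((1 + d) * t - 1 + 2 * (1 + d) * (1 - t) + (G * x * A - G * B * x)) +
      (G * (-1 + (2 - x) * A + (x - 1) * B) +
        (1 - G) * G * (hpar d t + (d - 1 / 2) * (1 + d) * t) / (t * hpar d t) *
          (-t * x * A + t * x * B - 2 * (1 - t) * B) -
        G * (1 - G) * ((2 - x) * A + x * B)) * (1 - (1 + d) * t) -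
      x * ((1 + d) * t - G * B) ^ 2 =
    (1 - G) * ((1 + d) * (2 - t) - 1 - x * (1 + d) ^ 2 * t ^ 2 + x * (1 + d) * t * h +
      2 * (1 - (1 + d) * t) * (h - (1 - (1 + d) * (1 - t))) * G -
      (1 - (1 + d) * t) * x * ((d - 1 / 2) * (1 + d) * t / hpar d t) *
        (h - G * (h - (1 - (1 + d) * (1 - t)))) -
      G * B * (x * (h - (1 - (1 + d) * (1 - t))) + (1 - (1 + d) * t) *
        (-x * ((d - 1 / 2) * (1 + d) * t / hpar d t) +
          2 * (1 - t) * ((hpar d t + (d - 1 / 2) * (1 + d) * t) / (t * hpar d t))))) := by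
  have hA' : A = (1 - (1 + d) * (1 - t)) + (1 - G) * h / G := by field_simp; linarith
  rw [hA', hx, hh]
  unfold hpar at *
  generalize hHH : 3 / 2 - (d - 1 / 2) * (1 + d) * (1 - t) = H at *
  field_simp
  ring

theorem barrier_const_pos {E t : ℝ} (hE : 0 < E) (hE1 : E < 1) (ht : 0 < t) (ht1 : t ≤ 1) :
    0 < (1 + (1 + E) / 2) * (2 - t) - 1 -
      2 * (1 + (1 + E) / 2) / ((1 + E) / 2) * (1 - t) * (1 + (1 + E) / 2) ^ 2 * t ^ 2 +
      2 * (1 + (1 + E) / 2) / ((1 + E) / 2) * (1 - t) * (1 + (1 + E) / 2) * t *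
        (t * hpar ((1 + E) / 2) t) -
      (1 - (1 + (1 + E) / 2) * t) * (2 * (1 + (1 + E) / 2) / ((1 + E) / 2) * (1 - t)) *
        (((1 + E) / 2 - 1 / 2) * (1 + (1 + E) / 2) * t ^ 2) := by
  have h1 : 0 < 1 - E := by linarith
  have h2 : 0 ≤ 1 - t := by linarith
  have h3 : 0 < 1 + E := by linarith
  have h4 : 0 <
      1 * (1 - E) ^ 4 *
        (1 * (1 - t) ^ 5 + (17/4) * t * (1 - t) ^ 4 + 7 * t ^ 2 * (1 - t) ^ 3 + (11/2) * t ^ 3 *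
        (1 - t) ^ 2 + 2 * t ^ 4 * (1 - t) + (1/4) * t ^ 5) +
      4 * E * (1 - E) ^ 3 *
        ((11/8) * (1 - t) ^ 5 + (47/8) * t * (1 - t) ^ 4 + (249/32) * t ^ 2 * (1 - t) ^ 3 +
        (11/2) * t ^ 3 * (1 - t) ^ 2 + (83/32) * t ^ 4 * (1 - t) + (3/8) * t ^ 5) +
      6 * E ^ 2 * (1 - E) ^ 2 *
        ((11/6) * (1 - t) ^ 5 + (63/8) * t * (1 - t) ^ 4 + (49/6) * t ^ 2 * (1 - t) ^ 3 +
        (61/12) * t ^ 3 * (1 - t) ^ 2 + (7/2) * t ^ 4 * (1 - t) + (13/24) * t ^ 5) +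
      4 * E ^ 3 * (1 - E) *
        ((19/8) * (1 - t) ^ 5 + (41/4) * t * (1 - t) ^ 4 + (31/4) * t ^ 2 * (1 - t) ^ 3 +
          4 * t ^ 3 * (1 - t) ^ 2 + (39/8) * t ^ 4 * (1 - t) + (3/4) * t ^ 5) +
      1 * E ^ 4 *
        (3 * (1 - t) ^ 5 + 13 * t * (1 - t) ^ 4 + 6 * t ^ 2 * (1 - t) ^ 3 +
          2 * t ^ 3 * (1 - t) ^ 2 + 7 * t ^ 4 * (1 - t) + 1 * t ^ 5) := by
    positivity
  refine (div_pos h4 (half_pos h3)).trans_eq ?_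
  unfold hpar
  field_simp
  ring

/-- The polynomial governing the dependence of the source term on `B`. -/
noncomputable def qpoly (E t : ℝ) : ℝ :=
      1 * (1 - E) ^ 5 *
        ((3/2) * (1 - t) ^ 5 + (15/2) * t * (1 - t) ^ 4 + 15 * t ^ 2 * (1 - t) ^ 3 + 15 * t ^ 3
        * (1 - t) ^ 2 + (15/2) * t ^ 4 * (1 - t) + (3/2) * t ^ 5) +
      5 * E * (1 - E) ^ 4 *
        ((33/20) * (1 - t) ^ 5 + (171/20) * t * (1 - t) ^ 4 + (159/10) * t ^ 2 * (1 - t) ^ 3 +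
        (57/4) * t ^ 3 * (1 - t) ^ 2 + (27/4) * t ^ 4 * (1 - t) + (3/2) * t ^ 5) +
      10 * E ^ 2 * (1 - E) ^ 3 *
        ((17/10) * (1 - t) ^ 5 + (93/10) * t * (1 - t) ^ 4 + (2599/160) * t ^ 2 * (1 - t) ^ 3 +
        (2039/160) * t ^ 3 * (1 - t) ^ 2 + (45/8) * t ^ 4 * (1 - t) + (61/40) * t ^ 5) +
      10 * E ^ 3 * (1 - E) ^ 2 *
        ((13/8) * (1 - t) ^ 5 + (387/40) * t * (1 - t) ^ 4 + (643/40) * t ^ 2 * (1 - t) ^ 3 +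
        (211/20) * t ^ 3 * (1 - t) ^ 2 + (33/8) * t ^ 4 * (1 - t) + (8/5) * t ^ 5) +
      5 * E ^ 4 * (1 - E) *
        ((7/5) * (1 - t) ^ 5 + (48/5) * t * (1 - t) ^ 4 + (311/20) * t ^ 2 * (1 - t) ^ 3 +
        (157/20) * t ^ 3 * (1 - t) ^ 2 + (9/4) * t ^ 4 * (1 - t) + (7/4) * t ^ 5) +
      1 * E ^ 5 *
        (1 * (1 - t) ^ 5 + 9 * t * (1 - t) ^ 4 + 15 * t ^ 2 * (1 - t) ^ 3 +
          5 * t ^ 3 * (1 - t) ^ 2 + 2 * t ^ 5)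

theorem qpoly_nonneg {E t : ℝ} (hE : 0 < E) (hE1 : E < 1) (ht : 0 < t) (ht1 : t ≤ 1) :
    0 ≤ qpoly E t := by
  have h1 : 0 < 1 - E := by linarith
  have h2 : 0 ≤ 1 - t := by linarith
  unfold qpoly
  positivity

theorem barrier_slope_eq {E t : ℝ} (hE : 0 < E) (ht : t ≠ 0)
    (hH : hpar ((1 + E) / 2) t ≠ 0) :
    2 * (1 + (1 + E) / 2) / ((1 + E) / 2) * (1 - t) *
        (t * hpar ((1 + E) / 2) t - (1 - (1 + (1 + E) / 2) * (1 - t))) +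
      (1 - (1 + (1 + E) / 2) * t) *
      (-(2 * (1 + (1 + E) / 2) / ((1 + E) / 2) * (1 - t)) *
          (((1 + E) / 2 - 1 / 2) * (1 + (1 + E) / 2) * t / hpar ((1 + E) / 2) t) +
        2 * (1 - t) * ((hpar ((1 + E) / 2) t + ((1 + E) / 2 - 1 / 2) * (1 + (1 + E) / 2) * t) /
          (t * hpar ((1 + E) / 2) t))) =
    (1 - t) * qpoly E t / ((1 + E) / 2 * t * hpar ((1 + E) / 2) t) := by
  have h3 : 1 + E ≠ 0 := by linarith
  rw [eq_div_iff (by positivity)]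
  generalize hHH : hpar ((1 + E) / 2) t = H at *
  field_simp
  rw [← hHH]
  unfold hpar qpoly
  ring

theorem barrier_end_eq {E t : ℝ} (hE : 0 < E) (ht : t ≠ 0) (hH : hpar ((1 + E) / 2) t ≠ 0) :
    (1 + (1 + E) / 2) * (2 - t) - 1 -
      2 * (1 + (1 + E) / 2) / ((1 + E) / 2) * (1 - t) * (1 + (1 + E) / 2) ^ 2 * t ^ 2 +
      2 * (1 + (1 + E) / 2) / ((1 + E) / 2) * (1 - t) * (1 + (1 + E) / 2) * t *
        (t * hpar ((1 + E) / 2) t) +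
      2 * (1 - (1 + (1 + E) / 2) * t) *
        (t * hpar ((1 + E) / 2) t - (1 - (1 + (1 + E) / 2) * (1 - t))) -
      (1 - (1 + (1 + E) / 2) * t) * (2 * (1 + (1 + E) / 2) / ((1 + E) / 2) * (1 - t)) *
        (((1 + E) / 2 - 1 / 2) * (1 + (1 + E) / 2) * t / hpar ((1 + E) / 2) t) *
        (1 - (1 + (1 + E) / 2) * (1 - t)) -
      (1 + (1 + E) / 2) * t *
        ((1 - t) * qpoly E t / ((1 + E) / 2 * t * hpar ((1 + E) / 2) t)) =
    E * (1 - t) * ((2 - (3 + E) * t) ^ 2 * ((81 / 16 + 297 / 32 * E + 135 / 32 * E ^ 2 -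
      15 / 16 * E ^ 3 - 5 / 4 * E ^ 4 - 11 / 32 * E ^ 5 - 1 / 32 * E ^ 6) -
      (27 / 32 * E + 27 / 16 * E ^ 2 + 9 / 8 * E ^ 3 + 5 / 16 * E ^ 4 + 1 / 32 * E ^ 5) *
        (2 - (3 + E) * t)) / (3 + E) ^ 3) / ((1 + E) / 2 * hpar ((1 + E) / 2) t) := by
  have h3 : 1 + E ≠ 0 := by linarith
  have h4 : 3 + E ≠ 0 := by linarith
  generalize hHH : hpar ((1 + E) / 2) t = H at *
  field_simp
  rw [← hHH]
  unfold hpar qpoly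
  ring

theorem barrier_end_nonneg {E t : ℝ} (hE : 0 < E) (hE1 : E < 1) (ht : 0 < t) (ht1 : t ≤ 1)
    (hH : 0 < hpar ((1 + E) / 2) t) :
    0 ≤ E * (1 - t) * ((2 - (3 + E) * t) ^ 2 * ((81 / 16 + 297 / 32 * E + 135 / 32 * E ^ 2 -
      15 / 16 * E ^ 3 - 5 / 4 * E ^ 4 - 11 / 32 * E ^ 5 - 1 / 32 * E ^ 6) -
      (27 / 32 * E + 27 / 16 * E ^ 2 + 9 / 8 * E ^ 3 + 5 / 16 * E ^ 4 + 1 / 32 * E ^ 5) *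
        (2 - (3 + E) * t)) / (3 + E) ^ 3) / ((1 + E) / 2 * hpar ((1 + E) / 2) t) := by
  have h1 : 0 < 1 - E := by linarith
  have h2 : 0 ≤ 1 - t := by linarith
  have h5 : 0 ≤ (27 / 32 * E + 27 / 16 * E ^ 2 + 9 / 8 * E ^ 3 + 5 / 16 * E ^ 4 +
      1 / 32 * E ^ 5) * ((3 + E) * t) := by positivity
  have h6 : 0 ≤ E ^ 2 * (1 - E) := by positivity
  have h7 : 0 ≤ E ^ 3 * (1 - E) := by positivity
  have h8 : 0 ≤ E ^ 4 * (1 - E) := by positivity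
  have h9 : 0 ≤ E ^ 5 * (1 - E) := by positivity
  have h10 : 0 ≤ E * (1 - E) := by positivity
  have h11 : 0 ≤ (81 / 16 + 297 / 32 * E + 135 / 32 * E ^ 2 -
      15 / 16 * E ^ 3 - 5 / 4 * E ^ 4 - 11 / 32 * E ^ 5 - 1 / 32 * E ^ 6) -
      (27 / 32 * E + 27 / 16 * E ^ 2 + 9 / 8 * E ^ 3 + 5 / 16 * E ^ 4 + 1 / 32 * E ^ 5) *
        (2 - (3 + E) * t) := by nlinarith
  positivity

/-- The source term of the barrier equation is positive. -/
theorem barrier_source_pos {d t G B x h : ℝ} (hd : 1 / 2 < d) (hd1 : d < 1) (ht : 0 < t)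
    (ht1 : t ≤ 1) (hG : 0 < G) (hG1 : G < 1) (hB : B ≤ (1 + d) * t)
    (hx : x = 2 * (1 + d) / d * (1 - t)) (hh : h = t * hpar d t) :
    0 < (1 - G) * ((1 + d) * (2 - t) - 1 - x * (1 + d) ^ 2 * t ^ 2 + x * (1 + d) * t * h +
      2 * (1 - (1 + d) * t) * (h - (1 - (1 + d) * (1 - t))) * G -
      (1 - (1 + d) * t) * x * ((d - 1 / 2) * (1 + d) * t / hpar d t) *
        (h - G * (h - (1 - (1 + d) * (1 - t)))) -
      G * B * (x * (h - (1 - (1 + d) * (1 - t))) + (1 - (1 + d) * t) *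
        (-x * ((d - 1 / 2) * (1 + d) * t / hpar d t) +
          2 * (1 - t) * ((hpar d t + (d - 1 / 2) * (1 + d) * t) / (t * hpar d t))))) := by
  have hH : 0 < hpar d t := by linarith [half_le_hpar hd hd1 ht]
  obtain ⟨E, rfl⟩ : ∃ E, d = (1 + E) / 2 := ⟨2 * d - 1, by ring⟩
  have hE : 0 < E := by linarith
  have hE1 : E < 1 := by linarith
  subst hx hh
  have h0 := barrier_const_pos hE hE1 ht ht1
  have h1 := barrier_end_nonneg hE hE1 ht ht1 hH
  rw [← barrier_end_eq hE ht.ne' hH.ne'] at h1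
  rw [barrier_slope_eq hE ht.ne' hH.ne']
  have h2 : 0 ≤ (1 - t) * qpoly E t / ((1 + E) / 2 * t * hpar ((1 + E) / 2) t) := by
    have := qpoly_nonneg hE hE1 ht ht1
    have : 0 ≤ 1 - t := by linarith
    positivity
  generalize (1 - t) * qpoly E t / ((1 + E) / 2 * t * hpar ((1 + E) / 2) t) = q at *
  have h3 := mul_nonneg (mul_nonneg hG.le (sub_nonneg.2 hB)) h2
  refine mul_pos (by linarith) ?_
  have h4 := mul_pos (sub_pos.2 hG1) h0
  have h5 := mul_nonneg hG.le h1
  have h6 : ((1 + E) / 2 - 1 / 2) * (1 + (1 + E) / 2) * t ^ 2 =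
      ((1 + E) / 2 - 1 / 2) * (1 + (1 + E) / 2) * t / hpar ((1 + E) / 2) t *
        (t * hpar ((1 + E) / 2) t) := by field_simp
  rw [h6] at h4
  linarith

/-!
Barrier functions in dimension three:
* `thetafun`: `θ = 2 J / D`
* `zfun`: `Z = r^2 u^2 / D`
* `bfun`: `B = u Y / D`
* `hfun`: `h = θ H(θ)`
* `gfun`: `G = h / (Z + h)`
* `xfun`: `x = (p-1) r^2 |u|^(p+1) / D`
* `xifun`: `ξ = (p-1) r^2 |u|^(p-1) u Y / D`
* `gapfun`: `c θ - G B`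
* `nufun`: the barrier slope `ν = (1 - G B) / (c θ - G B)`
* `sourcefun`: the source term of the barrier equations
* `mfun`: `M = r (K + W)`
* `lfun`: `ν M - r W`
* `tailfun`: `M - r W / ν`
* `drate`: `(ξ - x) / r`
* `nurate`: `ν / r`
-/

/-- Conditions under which the barrier functions are defined. -/
structure Admissible (p : ℝ) (u u' : ℝ → ℝ) (r : ℝ) : Prop where
  hp3 : 3 < p
  hp5 : p < 5
  one : 0 < jfun 3 p 1 u u' r
  crit : 0 < jfun 3 p (4 / (p + 3)) u u' r

noncomputable def thetafun (p : ℝ) (u u' : ℝ → ℝ) (r : ℝ) : ℝ :=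
  2 * jfun 3 p 1 u u' r / dfun 3 p 1 u u' r

noncomputable def zfun (p : ℝ) (u u' : ℝ → ℝ) (r : ℝ) : ℝ := r ^ 2 * u r ^ 2 / dfun 3 p 1 u u' r

noncomputable def bfun (p : ℝ) (u u' : ℝ → ℝ) (r : ℝ) : ℝ :=
  u r * yfun 1 u u' r / dfun 3 p 1 u u' r

noncomputable def hfun (p : ℝ) (u u' : ℝ → ℝ) (r : ℝ) : ℝ :=
  thetafun p u u' r * hpar (2 / (p - 1)) (thetafun p u u' r)

noncomputable def gfun (p : ℝ) (u u' : ℝ → ℝ) (r : ℝ) : ℝ :=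
  hfun p u u' r / (zfun p u u' r + hfun p u u' r)

noncomputable def xfun (p : ℝ) (u u' : ℝ → ℝ) (r : ℝ) : ℝ :=
  (p - 1) * (r ^ 2 * (|u r| ^ (p - 1) * u r ^ 2)) / dfun 3 p 1 u u' r

noncomputable def xifun (p : ℝ) (u u' : ℝ → ℝ) (r : ℝ) : ℝ :=
  (p - 1) * (r ^ 2 * (|u r| ^ (p - 1) * u r)) * yfun 1 u u' r / dfun 3 p 1 u u' r

noncomputable def gapfun (p : ℝ) (u u' : ℝ → ℝ) (r : ℝ) : ℝ :=
  (1 + 2 / (p - 1)) * thetafun p u u' r - gfun p u u' r * bfun p u u' r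

noncomputable def nufun (p : ℝ) (u u' : ℝ → ℝ) (r : ℝ) : ℝ :=
  (1 - gfun p u u' r * bfun p u u' r) / gapfun p u u' r

noncomputable def sourcefun (p : ℝ) (u u' : ℝ → ℝ) (r : ℝ) : ℝ :=
  let d := 2 / (p - 1)
  let t := thetafun p u u' r
  let G := gfun p u u' r
  let B := bfun p u u' r
  let x := xfun p u u' r
  let h := hfun p u u' r
  (1 - G) * ((1 + d) * (2 - t) - 1 - x * (1 + d) ^ 2 * t ^ 2 + x * (1 + d) * t * h +
      2 * (1 - (1 + d) * t) * (h - (1 - (1 + d) * (1 - t))) * G -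
      (1 - (1 + d) * t) * x * ((d - 1 / 2) * (1 + d) * t / hpar d t) *
        (h - G * (h - (1 - (1 + d) * (1 - t)))) -
      G * B * (x * (h - (1 - (1 + d) * (1 - t))) + (1 - (1 + d) * t) *
        (-x * ((d - 1 / 2) * (1 + d) * t / hpar d t) +
          2 * (1 - t) * ((hpar d t + (d - 1 / 2) * (1 + d) * t) / (t * hpar d t)))))

namespace Admissible

variable {p : ℝ} {u u' : ℝ → ℝ} {r : ℝ}

theorem zero (hp3 : 3 < p) (hp5 : p < 5) (h0 : u 0 ≠ 0) : Admissible p u u' 0 := by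
  have h1 : 0 < u 0 ^ 2 := by positivity
  refine ⟨hp3, hp5, ?_, ?_⟩
  · unfold jfun yfun; norm_num; positivity
  · have h2 : jfun 3 p (4 / (p + 3)) u u' 0 =
        4 / (p + 3) * ((5 - p) / (p + 3)) * u 0 ^ 2 / 2 := by
      have : p + 3 ≠ 0 := by linarith
      unfold jfun yfun; field_simp; ring
    rw [h2]
    have : 0 < p + 3 := by linarith
    have : 0 < 5 - p := by linarith
    positivity

variable (H : Admissible p u u' r)
include H

theorem one_lt : 1 < p := by linarith [H.hp3]

theorem half_lt : 1 / 2 < 2 / (p - 1) := by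
  have := H.hp3; have := H.hp5
  rw [div_lt_div_iff₀ (by norm_num) (by linarith)]; linarith

theorem lt_one : 2 / (p - 1) < 1 := by
  have := H.hp3
  rw [div_lt_one (by linarith)]; linarith

theorem dpos : 0 < dfun 3 p 1 u u' r := dfun_pos H.one_lt H.one

theorem theta_pos : 0 < thetafun p u u' r := div_pos (by linarith [H.one]) H.dpos

theorem xfun_nonneg : 0 ≤ xfun p u u' r :=
  div_nonneg (mul_nonneg (by linarith [H.one_lt]) (mul_nonneg (sq_nonneg _)
    (mul_nonneg (Real.rpow_nonneg (abs_nonneg _) _) (sq_nonneg _)))) H.dpos.le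

theorem xfun_eq : xfun p u u' r =
    2 * (1 + 2 / (p - 1)) / (2 / (p - 1)) * (1 - thetafun p u u' r) := by
  have h1 := dfun_eq (n := 3) (m := 1) H.one_lt u u' r
  have h2 := H.dpos.ne'
  have h3 : p - 1 ≠ 0 := by linarith [H.one_lt]
  have h4 : p + 1 ≠ 0 := by linarith [H.one_lt]
  unfold xfun thetafun
  generalize dfun 3 p 1 u u' r = D at *
  have h5 : (r ^ 2 * (|u r| ^ (p - 1) * u r ^ 2)) =
    (D - 2 * jfun 3 p 1 u u' r) * (p + 1) / (p - 1) := by rw [h1]; field_simp; ring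
  rw [h5]
  field_simp
  ring

theorem theta_le_one : thetafun p u u' r ≤ 1 := by
  have h := H.xfun_nonneg
  have h1 : 0 < 2 / (p - 1) := by linarith [H.half_lt]
  rw [H.xfun_eq] at h
  by_contra! hc
  exact absurd h (not_le.2 (mul_neg_of_pos_of_neg (by positivity) (by linarith)))

theorem xfun_le : xfun p u u' r ≤ p + 1 := by
  have h3 : p - 1 ≠ 0 := by linarith [H.one_lt]
  have h4 : 2 * (1 + 2 / (p - 1)) / (2 / (p - 1)) = p + 1 := by field_simp; ring
  rw [H.xfun_eq, h4]
  nlinarith [H.theta_pos, H.one_lt]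

theorem hpar_pos : 0 < hpar (2 / (p - 1)) (thetafun p u u' r) := by
  linarith [half_le_hpar H.half_lt H.lt_one H.theta_pos]

theorem hfun_pos : 0 < hfun p u u' r := mul_pos H.theta_pos H.hpar_pos

theorem zfun_nonneg : 0 ≤ zfun p u u' r := div_nonneg (by positivity) H.dpos.le

theorem zh_pos : 0 < zfun p u u' r + hfun p u u' r := by
  linarith [H.zfun_nonneg, H.hfun_pos]

theorem gfun_pos : 0 < gfun p u u' r := div_pos H.hfun_pos H.zh_pos

theorem gfun_le_one : gfun p u u' r ≤ 1 := by
  rw [gfun, div_le_one H.zh_pos]; linarith [H.zfun_nonneg]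

theorem gfun_lt_one (hr : 0 < r) (hu : u r ≠ 0) : gfun p u u' r < 1 := by
  have : 0 < zfun p u u' r := div_pos (by positivity) H.dpos
  rw [gfun, div_lt_one H.zh_pos]; linarith

theorem bfun_lt : bfun p u u' r < (1 + 2 / (p - 1)) * thetafun p u u' r := by
  have hp3 := H.hp3
  have hp5 := H.hp5
  have h1 := H.one
  have h2 := H.crit
  have h3 : jfun 3 p (4 / (p + 3)) u u' r = jfun 3 p 1 u u' r -
      (p - 1) / (p + 3) * (u r * yfun 1 u u' r) -
      (p - 1) * (5 - p) / (p + 3) ^ 2 * u r ^ 2 / 2 := by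
    have : p + 3 ≠ 0 := by linarith
    unfold jfun yfun; field_simp; ring
  have h4 : 0 ≤ (p - 1) * (5 - p) / (p + 3) ^ 2 * u r ^ 2 / 2 := by
    have : 0 ≤ p - 1 := by linarith
    have : 0 ≤ 5 - p := by linarith
    positivity
  have h5 : (p - 1) / (p + 3) * (u r * yfun 1 u u' r) < jfun 3 p 1 u u' r := by linarith
  rw [div_mul_eq_mul_div, div_lt_iff₀ (by linarith)] at h5
  have h6 : u r * yfun 1 u u' r < (1 + 2 / (p - 1)) * (2 * jfun 3 p 1 u u' r) := by
    have h7 : (1 + 2 / (p - 1)) * (2 * jfun 3 p 1 u u' r) =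
        (2 * (p + 1) * jfun 3 p 1 u u' r) / (p - 1) := by
      have : p - 1 ≠ 0 := by linarith
      field_simp; ring
    rw [h7, lt_div_iff₀ (by linarith)]
    nlinarith
  unfold bfun thetafun
  rw [← mul_div_assoc]
  exact div_lt_div_of_pos_right h6 H.dpos

theorem gap_pos : 0 < gapfun p u u' r := by
  have h1 := H.bfun_lt
  have h2 := H.theta_pos
  have h3 := H.gfun_pos
  have h4 := H.gfun_le_one
  have h5 : 0 < 2 / (p - 1) := by linarith [H.half_lt]
  have h6 : 0 < (1 + 2 / (p - 1)) * thetafun p u u' r := by positivity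
  unfold gapfun
  rcases le_total 0 (bfun p u u' r) with h | h <;> nlinarith

theorem source_pos (hr : 0 < r) (hu : u r ≠ 0) : 0 < sourcefun p u u' r :=
  barrier_source_pos H.half_lt H.lt_one H.theta_pos H.theta_le_one H.gfun_pos
    (H.gfun_lt_one hr hu) H.bfun_lt.le H.xfun_eq rfl

theorem source_nonneg (hr : 0 < r) : 0 ≤ sourcefun p u u' r := by
  by_cases hu : u r = 0
  · have h1 : gfun p u u' r = 1 := by
      have : zfun p u u' r = 0 := by simp [zfun, hu]
      rw [gfun, this, zero_add, div_self H.hfun_pos.ne']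
    simp [sourcefun, h1]
  · exact (H.source_pos hr hu).le

theorem xi_mul_bfun : xifun p u u' r * bfun p u u' r = xfun p u u' r *
    (1 - (1 + 2 / (p - 1)) * (1 - thetafun p u u' r) + zfun p u u' r) := by
  have h1 : (1 + 2 / (p - 1)) * (1 - thetafun p u u' r) =
      r ^ 2 * (|u r| ^ (p - 1) * u r ^ 2) / dfun 3 p 1 u u' r := by
    have h := H.xfun_eq
    unfold xfun at h
    have h3 : p - 1 ≠ 0 := by linarith [H.one_lt]
    field_simp at h ⊢
    linarith
  rw [h1]
  unfold xifun bfun xfun zfun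
  have h2 := H.dpos.ne'
  have h3 : yfun 1 u u' r ^ 2 = dfun 3 p 1 u u' r + r ^ 2 * u r ^ 2 -
    r ^ 2 * (|u r| ^ (p - 1) * u r ^ 2) := by unfold dfun; ring
  generalize dfun 3 p 1 u u' r = D at *
  generalize |u r| ^ (p - 1) = q at *
  field_simp
  rw [h3]; ring

theorem sq_mul_bfun_sq : r ^ 2 * bfun p u u' r ^ 2 = zfun p u u' r *
    (1 - (1 + 2 / (p - 1)) * (1 - thetafun p u u' r) + zfun p u u' r) := by
  have h1 : (1 + 2 / (p - 1)) * (1 - thetafun p u u' r) =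
      r ^ 2 * (|u r| ^ (p - 1) * u r ^ 2) / dfun 3 p 1 u u' r := by
    have h := H.xfun_eq
    unfold xfun at h
    have h3 : p - 1 ≠ 0 := by linarith [H.one_lt]
    field_simp at h ⊢
    linarith
  rw [h1]
  unfold bfun zfun
  have h2 := H.dpos.ne'
  have h3 : yfun 1 u u' r ^ 2 = dfun 3 p 1 u u' r + r ^ 2 * u r ^ 2 -
    r ^ 2 * (|u r| ^ (p - 1) * u r ^ 2) := by unfold dfun; ring
  generalize dfun 3 p 1 u u' r = D at *
  generalize |u r| ^ (p - 1) = q at *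
  field_simp
  rw [h3]; ring

end Admissible

/-- The logarithmic derivative of `G B`. -/
noncomputable def betaRate (d t G B A x : ℝ) : ℝ :=
  G * (-1 + (2 - x) * A + (x - 1) * B) +
        (1 - G) * G * (hpar d t + (d - 1 / 2) * (1 + d) * t) / (t * hpar d t) *
          (-t * x * A + t * x * B - 2 * (1 - t) * B) -
        G * (1 - G) * ((2 - x) * A + x * B)

theorem hasDerivAt_hpar_mul (d t : ℝ) : HasDerivAt (fun t => t * hpar d t)
    (hpar d t + (d - 1 / 2) * (1 + d) * t) t := by
  have h := (hasDerivAt_id t).mul ((((hasDerivAt_id t).const_sub 1).const_mul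
    ((d - 1 / 2) * (1 + d))).const_sub (3 / 2))
  refine h.congr_deriv ?_
  unfold hpar; simp; ring

theorem hasDerivAt_beta {d r x ξ A : ℝ} {θ Z B : ℝ → ℝ} (hr : r ≠ 0)
    (hθ : HasDerivAt θ ((-θ r * (ξ - x) - 2 * (1 - θ r)) / r) r)
    (hZ : HasDerivAt Z ((2 * (r ^ 2 * B r) - (ξ - x) * Z r) / r) r)
    (hB : HasDerivAt B ((-1 + 2 * A - B r - (ξ - x) * B r) / r) r)
    (h1 : ξ * B r = x * A) (h2 : r ^ 2 * B r ^ 2 = Z r * A) (ht : θ r ≠ 0)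
    (hH : hpar d (θ r) ≠ 0) (hZh : Z r + θ r * hpar d (θ r) ≠ 0) :
    HasDerivAt (fun s => θ s * hpar d (θ s) / (Z s + θ s * hpar d (θ s)) * B s)
      (betaRate d (θ r) (θ r * hpar d (θ r) / (Z r + θ r * hpar d (θ r))) (B r) A x / r) r := by
  have hh := (hasDerivAt_hpar_mul d (θ r)).comp r hθ
  have h := (hh.div (hZ.add hh) hZh).mul hB
  refine h.congr_deriv ?_
  simp only [Pi.add_apply, Function.comp_def, Pi.div_apply]
  unfold betaRate
  generalize hpar d (θ r) = H at *
  generalize (d - 1 / 2) * (1 + d) = k at *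
  generalize θ r = t at *
  generalize Z r = z at *
  generalize B r = b at *
  have e2 : (-t * (ξ - x) - 2 * (1 - t)) * b = -t * (x * A - x * b) - 2 * (1 - t) * b := by
    rw [← h1]; ring
  have e3 : (2 * (r ^ 2 * b) - (ξ - x) * z) * b = 2 * (z * A) - (x * A - x * b) * z := by
    rw [← h1, ← h2]; ring
  have e4 : -1 + 2 * A - b - (ξ - x) * b = -1 + 2 * A - b - (x * A - x * b) := by
    rw [← h1]; ring
  rw [e4]
  generalize -t * (ξ - x) - 2 * (1 - t) = δt at *
  generalize 2 * (r ^ 2 * b) - (ξ - x) * z = δz at *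
  have key : ((H + k * t) * (δt / r) * (z + t * H) - t * H * (δz / r + (H + k * t) * (δt / r))) /
      (z + t * H) ^ 2 * b =
        ((H + k * t) * z * (δt * b) - t * H * (δz * b)) / (z + t * H) ^ 2 / r := by
    field_simp; ring
  rw [key, e2, e3]
  obtain ⟨s, rfl⟩ : ∃ s, z = s - t * H := ⟨z + t * H, by ring⟩
  rw [sub_add_cancel] at hZh ⊢
  field_simp
  ring

namespace Admissible

variable {p : ℝ} {u u' v v' : ℝ → ℝ} {r : ℝ}

theorem hasDerivAt_dfun (H : Admissible p u u' r)
    (hS : RadialSol 3 (fun r => f p (u r)) u u') (hr : 0 < r) :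
    HasDerivAt (dfun 3 p 1 u u')
      (dfun 3 p 1 u u' r * (xifun p u u' r - xfun p u u' r) / r) r := by
  refine (_root_.hasDerivAt_dfun (m := 1) H.one_lt hS hr).congr_deriv ?_
  have := H.dpos.ne'
  unfold xifun xfun
  field_simp
  ring

theorem hasDerivAt_thetafun (H : Admissible p u u' r)
    (hS : RadialSol 3 (fun r => f p (u r)) u u') (hr : 0 < r) :
    HasDerivAt (thetafun p u u') ((-thetafun p u u' r * (xifun p u u' r - xfun p u u' r) -
      2 * (1 - thetafun p u u' r)) / r) r := by
  have h := ((hasDerivAt_jfun (m := 1) H.one_lt hS hr).const_mul 2).div (H.hasDerivAt_dfun hS hr)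
    H.dpos.ne'
  refine h.congr_deriv ?_
  have h1 := dfun_eq (n := 3) (m := 1) H.one_lt u u' r
  have h2 := H.dpos.ne'
  have h3 : p + 1 ≠ 0 := by linarith [H.one_lt]
  unfold thetafun
  generalize xifun p u u' r - xfun p u u' r = e at *
  generalize dfun 3 p 1 u u' r = D at *
  have h4 : jfun 3 p 1 u u' r =
    (D - (p - 1) / (p + 1) * (r ^ 2 * (|u r| ^ (p - 1) * u r ^ 2))) / 2 := by linarith
  rw [h4]
  field_simp
  ring

theorem hasDerivAt_zfun (H : Admissible p u u' r)
    (hS : RadialSol 3 (fun r => f p (u r)) u u') (hr : 0 < r) :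
    HasDerivAt (zfun p u u') ((2 * (r ^ 2 * bfun p u u' r) -
      (xifun p u u' r - xfun p u u' r) * zfun p u u' r) / r) r := by
  have h := ((hasDerivAt_pow 2 r).mul ((hS.hasDerivAt_div hr 1).pow 2)).div
    (H.hasDerivAt_dfun hS hr) H.dpos.ne'
  refine h.congr_deriv ?_
  have h2 := H.dpos.ne'
  unfold zfun bfun
  simp only [Pi.mul_apply, Pi.pow_apply, Nat.cast_ofNat]
  generalize xifun p u u' r - xfun p u u' r = e at *
  generalize dfun 3 p 1 u u' r = D at *
  field_simp
  ring

theorem hasDerivAt_bfun (H : Admissible p u u' r)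
    (hS : RadialSol 3 (fun r => f p (u r)) u u') (hr : 0 < r) :
    HasDerivAt (bfun p u u') ((-1 +
      2 * (1 - (1 + 2 / (p - 1)) * (1 - thetafun p u u' r) + zfun p u u' r) - bfun p u u' r -
      (xifun p u u' r - xfun p u u' r) * bfun p u u' r) / r) r := by
  have h := ((hS.hasDerivAt_div hr 1).mul (hS.hasDerivAt_yfun (m := 1) hr)).div
    (H.hasDerivAt_dfun hS hr) H.dpos.ne'
  refine h.congr_deriv ?_
  have h1 : (1 + 2 / (p - 1)) * (1 - thetafun p u u' r) =
      r ^ 2 * (|u r| ^ (p - 1) * u r ^ 2) / dfun 3 p 1 u u' r := by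
    have h := H.xfun_eq
    unfold xfun at h
    have h3 : p - 1 ≠ 0 := by linarith [H.one_lt]
    have h2 := H.dpos.ne'
    field_simp at h ⊢
    linarith
  rw [h1]
  have h2 := H.dpos.ne'
  have h3 : yfun 1 u u' r ^ 2 = dfun 3 p 1 u u' r + r ^ 2 * u r ^ 2 -
    r ^ 2 * (|u r| ^ (p - 1) * u r ^ 2) := by unfold dfun; ring
  unfold zfun bfun f
  simp only [Pi.mul_apply]
  generalize xifun p u u' r - xfun p u u' r = e at *
  generalize dfun 3 p 1 u u' r = D at *
  generalize |u r| ^ (p - 1) = q at *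
  generalize yfun 1 u u' r = Y at *
  field_simp
  linear_combination h3

theorem hasDerivAt_beta (H : Admissible p u u' r)
    (hS : RadialSol 3 (fun r => f p (u r)) u u') (hr : 0 < r) :
    HasDerivAt (fun s => gfun p u u' s * bfun p u u' s)
      (betaRate (2 / (p - 1)) (thetafun p u u' r) (gfun p u u' r) (bfun p u u' r)
        (1 - (1 + 2 / (p - 1)) * (1 - thetafun p u u' r) + zfun p u u' r) (xfun p u u' r) / r) r :=
  _root_.hasDerivAt_beta hr.ne' (H.hasDerivAt_thetafun hS hr) (H.hasDerivAt_zfun hS hr)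
    (H.hasDerivAt_bfun hS hr) H.xi_mul_bfun H.sq_mul_bfun_sq H.theta_pos.ne' H.hpar_pos.ne'
    H.zh_pos.ne'

theorem sourcefun_eq (H : Admissible p u u' r) : sourcefun p u u' r =
    (1 - gfun p u u' r * bfun p u u' r) * ((1 + 2 / (p - 1)) * thetafun p u u' r - 1 +
      2 * (1 + 2 / (p - 1)) * (1 - thetafun p u u' r) + (xifun p u u' r - xfun p u u' r) *
        (gfun p u u' r * bfun p u u' r)) +
      betaRate (2 / (p - 1)) (thetafun p u u' r) (gfun p u u' r) (bfun p u u' r)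
        (1 - (1 + 2 / (p - 1)) * (1 - thetafun p u u' r) + zfun p u u' r) (xfun p u u' r) *
        (1 - (1 + 2 / (p - 1)) * thetafun p u u' r) - xfun p u u' r * gapfun p u u' r ^ 2 := by
  have h1 : gfun p u u' r * (zfun p u u' r) = (1 - gfun p u u' r) * hfun p u u' r := by
    have := H.zh_pos.ne'
    unfold gfun; field_simp; ring
  have h2 : (0:ℝ) < 2 / (p - 1) := by linarith [H.half_lt]
  rw [sourcefun, ← barrier_source_eq (h := hfun p u u' r)
    (A := 1 - (1 + 2 / (p - 1)) * (1 - thetafun p u u' r) + zfun p u u' r)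
    h2.ne' H.theta_pos.ne' H.gfun_pos.ne' H.hpar_pos.ne' H.xfun_eq rfl (by rw [← h1]; ring)]
  have h3 := H.xi_mul_bfun
  unfold betaRate gapfun
  linear_combination (-(1 - gfun p u u' r * bfun p u u' r) * gfun p u u' r) * h3

end Admissible

noncomputable def mfun (p : ℝ) (u u' v v' : ℝ → ℝ) (r : ℝ) : ℝ :=
  r * (kfun 3 p 1 u u' v v' r + wfun u u' v v' r)

noncomputable def lfun (p : ℝ) (u u' v v' : ℝ → ℝ) (r : ℝ) : ℝ :=
  nufun p u u' r * mfun p u u' v v' r - r * wfun u u' v v' r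

noncomputable def tailfun (p : ℝ) (u u' v v' : ℝ → ℝ) (r : ℝ) : ℝ :=
  mfun p u u' v v' r - gapfun p u u' r / (1 - gfun p u u' r * bfun p u u' r) *
    (r * wfun u u' v v' r)

namespace SolPair

variable {p : ℝ} {u u' v v' : ℝ → ℝ} {r : ℝ}

theorem hasDerivAt_mfun (P : SolPair 3 p u u' v v') (hr : 0 < r) :
    HasDerivAt (mfun p u u' v v') ((mfun p u u' v v' r - r * wfun u u' v v' r) / r) r := by
  refine ((hasDerivAt_id r).mul ((P.hasDerivAt_kfun (m := 1) hr).add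
    (P.hasDerivAt_wfun hr))).congr_deriv ?_
  unfold mfun
  simp only [id, Pi.add_apply]
  field_simp
  ring

theorem hasDerivAt_mul_wfun (P : SolPair 3 p u u' v v') (H : Admissible p u u' r) (hr : 0 < r) :
    HasDerivAt (fun s => s * wfun u u' v v' s)
      (((xifun p u u' r - xfun p u u' r) * (r * wfun u u' v v' r) +
        xfun p u u' r * mfun p u u' v v' r) / r) r := by
  refine ((hasDerivAt_id r).mul (P.hasDerivAt_wfun hr)).congr_deriv ?_
  have hv := dfun_mul_eq 3 p 1 u u' v v' r
  have hD := H.dpos.ne'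
  unfold mfun xifun xfun
  simp only [id]
  generalize dfun 3 p 1 u u' r = D at *
  generalize kfun 3 p 1 u u' v v' r = K at *
  generalize wfun u u' v v' r = W at *
  generalize yfun 1 u u' r = Y at *
  have hv' : v r = (Y * W + u r * K) / D := by field_simp; linarith
  rw [hv']
  field_simp
  ring

theorem hasDerivAt_lfun (P : SolPair 3 p u u' v v') (H : Admissible p u u' r) (hr : 0 < r) :
    HasDerivAt (lfun p u u' v v')
      (((nufun p u u' r + xifun p u u' r - xfun p u u' r) * lfun p u u' v v' r +
        sourcefun p u u' r / gapfun p u u' r ^ 2 * mfun p u u' v v' r) / r) r := by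
  have hβ := H.hasDerivAt_beta P.sol hr
  have hg := ((H.hasDerivAt_thetafun P.sol hr).const_mul (1 + 2 / (p - 1))).sub hβ
  have h := (((hβ.const_sub 1).div hg H.gap_pos.ne').mul (P.hasDerivAt_mfun hr)).sub
    (P.hasDerivAt_mul_wfun H hr)
  refine h.congr_deriv ?_
  have hgap := H.gap_pos.ne'
  rw [H.sourcefun_eq]
  simp only [Pi.sub_apply, Pi.div_apply]
  unfold lfun nufun
  generalize betaRate _ _ _ _ _ _ = b at *
  have e : gapfun p u u' r = (1 + 2 / (p - 1)) * thetafun p u u' r -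
    gfun p u u' r * bfun p u u' r := rfl
  generalize gapfun p u u' r = g at *
  rw [← e]
  have e1 : gfun p u u' r * bfun p u u' r = (1 + 2 / (p - 1)) * thetafun p u u' r - g := by linarith
  rw [e1]
  generalize 1 + 2 / (p - 1) = c at *
  field_simp
  ring

theorem hasDerivAt_tailfun (P : SolPair 3 p u u' v v') (H : Admissible p u u' r) (hr : 0 < r)
    (h1 : gfun p u u' r * bfun p u u' r ≠ 1) :
    HasDerivAt (tailfun p u u' v v')
      (((1 - gapfun p u u' r / (1 - gfun p u u' r * bfun p u u' r) * xfun p u u' r) *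
          tailfun p u u' v v' r +
        sourcefun p u u' r / (1 - gfun p u u' r * bfun p u u' r) ^ 2 *
          (r * wfun u u' v v' r)) / r) r := by
  have hβ := H.hasDerivAt_beta P.sol hr
  have hg := ((H.hasDerivAt_thetafun P.sol hr).const_mul (1 + 2 / (p - 1))).sub hβ
  have h2 : 1 - gfun p u u' r * bfun p u u' r ≠ 0 := sub_ne_zero.2 (Ne.symm h1)
  have h := (P.hasDerivAt_mfun hr).sub ((hg.div (hβ.const_sub 1) h2).mul
    (P.hasDerivAt_mul_wfun H hr))
  refine h.congr_deriv ?_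
  rw [H.sourcefun_eq]
  simp only [Pi.sub_apply, Pi.div_apply]
  unfold tailfun
  generalize betaRate _ _ _ _ _ _ = b at *
  have e : gapfun p u u' r = (1 + 2 / (p - 1)) * thetafun p u u' r -
    gfun p u u' r * bfun p u u' r := rfl
  generalize gfun p u u' r * bfun p u u' r = β at *
  generalize gapfun p u u' r = g at *
  rw [← e]
  obtain ⟨s, rfl⟩ : ∃ s, β = 1 - s := ⟨1 - β, by ring⟩
  rw [sub_sub_cancel] at h2 ⊢
  obtain rfl : g = (1 + 2 / (p - 1)) * thetafun p u u' r - (1 - s) := e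
  generalize 1 + 2 / (p - 1) = c at *
  field_simp
  ring

end SolPair

theorem nonneg_of_deriv_ge {l l' A : ℝ → ℝ} {a b : ℝ} (hl : ContinuousOn l (Icc a b))
    (hl' : ∀ t ∈ Ioo a b, HasDerivAt l (l' t) t) (hA : ContinuousOn A (Icc a b))
    (h : ∀ t ∈ Ioo a b, A t * l t ≤ l' t) (ha : 0 ≤ l a) : ∀ t ∈ Icc a b, 0 ≤ l t := by
  obtain ⟨N, hN⟩ := isCompact_Icc.exists_bound_of_continuousOn hA
  intro t ht
  refine le_of_forall_pos_lt_add fun ε hε => ?_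
  have := pos_of_cooperative (x := fun s => l s + ε * exp (N * (s - t))) (y := fun _ => 1)
    (x' := fun s => l' s + ε * (exp (N * (s - t)) * N)) (y' := fun _ => 0) (A := A)
    (B := fun _ => 0) (a := a) (b := b) (by fun_prop) (by fun_prop)
    (fun s hs => by
      refine (hl' s hs).add ((((hasDerivAt_id s).sub_const t).const_mul N).exp.const_mul ε)
        |>.congr_deriv ?_
      simp)
    (fun s _ => hasDerivAt_const s _) hA continuousOn_const
    (fun s hs _ => by
      have h1 := h s hs
      have h2 := (abs_le.1 (hN s ⟨hs.1.le, hs.2.le⟩)).2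
      have h3 := mul_nonneg (mul_pos hε (exp_pos (N * (s - t)))).le (sub_nonneg.2 h2)
      linarith) (fun _ _ _ => by simp) (by positivity) one_pos t ht
  simpa using this.1

section Continuity

variable {p : ℝ} {u u' v v' : ℝ → ℝ} {s : Set ℝ}

theorem continuousOn_thetafun (hS : RadialSol 3 (fun r => f p (u r)) u u')
    (hs : s ⊆ Ici 0) (H : ∀ r ∈ s, Admissible p u u' r) : ContinuousOn (thetafun p u u') s := by
  rcases s.eq_empty_or_nonempty with rfl | ⟨a, ha⟩
  · exact continuousOn_empty _
  have hp := (H a ha).one_lt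
  exact (continuousOn_const.mul ((hS.continuousOn_jfun hp).mono hs)).div
    ((hS.continuousOn_dfun hp).mono hs) fun r hr => (H r hr).dpos.ne'

theorem continuousOn_hfun (hS : RadialSol 3 (fun r => f p (u r)) u u')
    (hs : s ⊆ Ici 0) (H : ∀ r ∈ s, Admissible p u u' r) : ContinuousOn (hfun p u u') s := by
  have := continuousOn_thetafun hS hs H
  unfold hfun hpar; fun_prop

theorem continuousOn_zfun (hS : RadialSol 3 (fun r => f p (u r)) u u')
    (hs : s ⊆ Ici 0) (H : ∀ r ∈ s, Admissible p u u' r) : ContinuousOn (zfun p u u') s := by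
  rcases s.eq_empty_or_nonempty with rfl | ⟨a, ha⟩
  · exact continuousOn_empty _
  have hp := (H a ha).one_lt
  exact ((continuousOn_id.pow 2).mul ((hS.cont.mono hs).pow 2)).div
    ((hS.continuousOn_dfun hp).mono hs) fun r hr => (H r hr).dpos.ne'

theorem continuousOn_bfun (hS : RadialSol 3 (fun r => f p (u r)) u u')
    (hs : s ⊆ Ici 0) (H : ∀ r ∈ s, Admissible p u u' r) : ContinuousOn (bfun p u u') s := by
  rcases s.eq_empty_or_nonempty with rfl | ⟨a, ha⟩
  · exact continuousOn_empty _
  have hp := (H a ha).one_lt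
  exact ((hS.cont.mono hs).mul (hS.continuousOn_yfun.mono hs)).div
    ((hS.continuousOn_dfun hp).mono hs) fun r hr => (H r hr).dpos.ne'

theorem continuousOn_gfun (hS : RadialSol 3 (fun r => f p (u r)) u u')
    (hs : s ⊆ Ici 0) (H : ∀ r ∈ s, Admissible p u u' r) : ContinuousOn (gfun p u u') s :=
  (continuousOn_hfun hS hs H).div ((continuousOn_zfun hS hs H).add (continuousOn_hfun hS hs H))
    fun r hr => (H r hr).zh_pos.ne'

theorem continuousOn_gapfun (hS : RadialSol 3 (fun r => f p (u r)) u u')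
    (hs : s ⊆ Ici 0) (H : ∀ r ∈ s, Admissible p u u' r) : ContinuousOn (gapfun p u u') s :=
  (continuousOn_const.mul (continuousOn_thetafun hS hs H)).sub
    ((continuousOn_gfun hS hs H).mul (continuousOn_bfun hS hs H))

theorem continuousOn_nufun (hS : RadialSol 3 (fun r => f p (u r)) u u')
    (hs : s ⊆ Ici 0) (H : ∀ r ∈ s, Admissible p u u' r) : ContinuousOn (nufun p u u') s :=
  (continuousOn_const.sub ((continuousOn_gfun hS hs H).mul (continuousOn_bfun hS hs H))).div
    (continuousOn_gapfun hS hs H) fun r hr => (H r hr).gap_pos.ne'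

noncomputable def drate (p : ℝ) (u u' : ℝ → ℝ) (r : ℝ) : ℝ :=
  (p - 1) * (r * (|u r| ^ (p - 1) * u r)) * (yfun 1 u u' r - u r) / dfun 3 p 1 u u' r

noncomputable def nurate (p : ℝ) (u u' : ℝ → ℝ) (r : ℝ) : ℝ :=
  (r * u r ^ 2 + hfun p u u' r * (yfun 1 u u' r * u' r - r * u r ^ 2 +
    r * (|u r| ^ (p - 1) * u r ^ 2))) /
    (dfun 3 p 1 u u' r * (zfun p u u' r + hfun p u u' r) * gapfun p u u' r)

theorem mul_drate (r : ℝ) : r * drate p u u' r = xifun p u u' r - xfun p u u' r := by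
  unfold drate xifun xfun
  generalize dfun 3 p 1 u u' r = D at *
  ring

theorem Admissible.mul_nurate {r : ℝ} (H : Admissible p u u' r) :
    r * nurate p u u' r = nufun p u u' r := by
  have h1 := H.dpos.ne'
  have h2 := H.zh_pos.ne'
  have h3 := H.gap_pos.ne'
  unfold nufun nurate
  have h4 : r * (yfun 1 u u' r * u' r - r * u r ^ 2 + r * (|u r| ^ (p - 1) * u r ^ 2)) =
      dfun 3 p 1 u u' r - u r * yfun 1 u u' r := by unfold dfun yfun; ring
  rw [← mul_div_assoc, mul_add, mul_left_comm r (hfun p u u' r), h4]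
  generalize gapfun p u u' r = g at *
  unfold gfun bfun
  have h5 : zfun p u u' r * dfun 3 p 1 u u' r = r ^ 2 * u r ^ 2 := by unfold zfun; field_simp
  generalize dfun 3 p 1 u u' r = D at *
  generalize hs : zfun p u u' r + hfun p u u' r = s at *
  have h6 : zfun p u u' r = s - hfun p u u' r := by linarith
  rw [h6] at h5
  field_simp
  linear_combination -h5

theorem continuousOn_drate (hS : RadialSol 3 (fun r => f p (u r)) u u')
    (hs : s ⊆ Ici 0) (H : ∀ r ∈ s, Admissible p u u' r) : ContinuousOn (drate p u u') s := by
  rcases s.eq_empty_or_nonempty with rfl | ⟨a, ha⟩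
  · exact continuousOn_empty _
  have hp := (H a ha).one_lt
  have h1 := hS.cont.mono hs
  have h2 := (hS.continuousOn_yfun (m := 1)).mono hs
  have h3 := (hS.continuousOn_rpow hp).mono hs
  refine ContinuousOn.div ?_ ((hS.continuousOn_dfun hp).mono hs) fun r hr => (H r hr).dpos.ne'
  fun_prop

theorem continuousOn_nurate (hS : RadialSol 3 (fun r => f p (u r)) u u')
    (hs : s ⊆ Ici 0) (H : ∀ r ∈ s, Admissible p u u' r) : ContinuousOn (nurate p u u') s := by
  rcases s.eq_empty_or_nonempty with rfl | ⟨a, ha⟩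
  · exact continuousOn_empty _
  have hp := (H a ha).one_lt
  have h1 := hS.cont.mono hs
  have h2 := (hS.continuousOn_yfun (m := 1)).mono hs
  have h3 := (hS.continuousOn_rpow hp).mono hs
  have h4 := hS.cont'.mono hs
  have h5 := continuousOn_hfun hS hs H
  refine ContinuousOn.div ?_ ((((hS.continuousOn_dfun hp).mono hs).mul
    ((continuousOn_zfun hS hs H).add h5)).mul (continuousOn_gapfun hS hs H)) fun r hr => ?_
  · fun_prop
  · exact (mul_pos (mul_pos (H r hr).dpos (H r hr).zh_pos) (H r hr).gap_pos).ne'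

end Continuity

namespace SolPair

variable {p : ℝ} {u u' v v' : ℝ → ℝ}

theorem continuousOn_mfun (P : SolPair 3 p u u' v v') : ContinuousOn (mfun p u u' v v') (Ici 0) :=
  continuousOn_id.mul ((P.sol.continuousOn_kfun P.var P.hp).add (P.sol.continuousOn_wfun P.var))

theorem continuousOn_lfun (P : SolPair 3 p u u' v v') {s : Set ℝ}
    (hs : s ⊆ Ici 0) (H : ∀ r ∈ s, Admissible p u u' r) : ContinuousOn (lfun p u u' v v') s :=
  ((continuousOn_nufun P.sol hs H).mul (P.continuousOn_mfun.mono hs)).sub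
    (continuousOn_id.mul ((P.sol.continuousOn_wfun P.var).mono hs))

/-- Sign propagation as long as `K + W` is positive. -/
theorem lfun_nonneg_of_pos (P : SolPair 3 p u u' v v') {T : ℝ}
    (H : ∀ r ∈ Icc 0 T, Admissible p u u' r)
    (hN : ∀ r ∈ Ioo 0 T, 0 < kfun 3 p 1 u u' v v' r + wfun u u' v v' r) :
    ∀ r ∈ Icc 0 T, 0 ≤ lfun p u u' v v' r := by
  have hs : Icc 0 T ⊆ Ici (0:ℝ) := Icc_subset_Ici_self
  refine nonneg_of_deriv_ge (A := fun r => nurate p u u' r + drate p u u' r)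
    (P.continuousOn_lfun hs H)
    (fun t ht => P.hasDerivAt_lfun (H t ⟨ht.1.le, ht.2.le⟩) ht.1)
    ((continuousOn_nurate P.sol hs H).add (continuousOn_drate P.sol hs H)) (fun t ht => ?_) ?_
  · have hH := H t ⟨ht.1.le, ht.2.le⟩
    rw [le_div_iff₀ ht.1, add_sub_assoc, ← mul_drate, ← hH.mul_nurate]
    have h1 : 0 ≤ sourcefun p u u' t / gapfun p u u' t ^ 2 * mfun p u u' v v' t :=
      mul_nonneg (div_nonneg (hH.source_nonneg ht.1) (sq_nonneg _)) (mul_pos ht.1 (hN t ht)).le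
    linarith
  · simp [lfun, mfun]

theorem kfun_add_wfun_pos (P : SolPair 3 p u u' v v') {T : ℝ}
    (H : ∀ r ∈ Icc 0 T, Admissible p u u' r) :
    ∀ r ∈ Icc 0 T, 0 < kfun 3 p 1 u u' v v' r + wfun u u' v v' r := by
  intro t₁ ht₁
  by_contra hcon
  have hcont : ContinuousOn (fun r => kfun 3 p 1 u u' v v' r + wfun u u' v v' r) (Icc 0 T) :=
    ((P.sol.continuousOn_kfun P.var P.hp).add (P.sol.continuousOn_wfun P.var)).mono
      Icc_subset_Ici_self
  have h0 : 0 < kfun 3 p 1 u u' v v' 0 + wfun u u' v v' 0 := by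
    have : kfun 3 p 1 u u' v v' 0 + wfun u u' v v' 0 = u 0 := by
      unfold kfun wfun yfun; rw [P.var_init]; ring
    rw [this]; exact P.init
  set S := {t ∈ Icc 0 T | kfun 3 p 1 u u' v v' t + wfun u u' v v' t ≤ 0} with hS
  have hSc : IsClosed S :=
    hcont.preimage_isClosed_of_isClosed isClosed_Icc (isClosed_Iic (a := (0:ℝ)))
  have hSb : BddBelow S := ⟨0, fun t ht => ht.1.1⟩
  have hτS : sInf S ∈ S := hSc.csInf_mem ⟨t₁, ht₁, not_lt.1 hcon⟩ hSb
  set τ := sInf S with hτ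
  have hbefore : ∀ t ∈ Ioo 0 τ, 0 < kfun 3 p 1 u u' v v' t + wfun u u' v v' t := by
    intro t ht
    by_contra h
    exact absurd (csInf_le hSb (⟨⟨ht.1.le, ht.2.le.trans hτS.1.2⟩, not_lt.1 h⟩ : t ∈ S))
      (not_le.2 ht.2)
  have hsub : Icc 0 τ ⊆ Icc 0 T := Icc_subset_Icc_right hτS.1.2
  have hl := P.lfun_nonneg_of_pos (fun r hr => H r (hsub hr)) hbefore
  have := pos_of_cooperative (x := fun r => kfun 3 p 1 u u' v v' r + wfun u u' v v' r)
    (y := fun _ => 1) (y' := fun _ => 0) (A := fun r => - nurate p u u' r)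
    (B := fun _ => 0) (a := 0) (b := τ) (hcont.mono hsub) continuousOn_const
    (fun t ht => (P.hasDerivAt_kfun (m := 1) ht.1).add (P.hasDerivAt_wfun ht.1))
    (fun s _ => hasDerivAt_const s _)
    ((continuousOn_nurate P.sol (hsub.trans Icc_subset_Ici_self) fun r hr => H r (hsub hr)).neg)
    continuousOn_const ?_ (fun _ _ _ => by simp) h0 one_pos τ (right_mem_Icc.2 hτS.1.1)
  · exact absurd hτS.2 (not_le.2 this.1)
  · intro t ht _
    have h1 := hl t ⟨ht.1.le, ht.2.le⟩
    have h2 := (H t (hsub ⟨ht.1.le, ht.2.le⟩)).mul_nurate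
    have h3 : 0 ≤ nurate p u u' t * (t * (kfun 3 p 1 u u' v v' t + wfun u u' v v' t)) -
        wfun u u' v v' t := by
      unfold lfun mfun at h1
      rw [← h2] at h1
      exact nonneg_of_mul_nonneg_right (a := t) (by linarith) ht.1
    rw [← add_div, le_div_iff₀ ht.1]
    linarith

theorem wfun_pos_of_admissible (P : SolPair 3 p u u' v v') {R : ℝ}
    (H : ∀ r, 0 < r → r ≤ R → Admissible p u u' r) {r : ℝ} (hr : 0 < r) (hrR : r ≤ R) :
    0 < wfun u u' v v' r ∧ 0 < mfun p u u' v v' r ∧ 0 ≤ lfun p u u' v v' r := by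
  have hH := H r hr hrR
  have H' : ∀ t ∈ Icc 0 R, Admissible p u u' t := fun t ht => by
    rcases ht.1.eq_or_lt with h | h
    · rw [← h]; exact Admissible.zero hH.hp3 hH.hp5 P.init.ne'
    · exact H t h ht.2
  have hN := P.kfun_add_wfun_pos H'
  have hl := P.lfun_nonneg_of_pos H' fun t ht => hN t ⟨ht.1.le, ht.2.le⟩
  refine ⟨?_, mul_pos hr (hN r ⟨hr.le, hrR⟩), hl r ⟨hr.le, hrR⟩⟩
  obtain ⟨ρ, hρ, h1⟩ := P.wfun_pos_near_zero
  have ha : 0 < min r ρ := lt_min hr hρ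
  have hsub : Icc (min r ρ) R ⊆ Icc 0 R := Icc_subset_Icc_left ha.le
  have hsub' := hsub.trans (Icc_subset_Ici_self : Icc (0:ℝ) R ⊆ Ici 0)
  have := pos_of_cooperative (x := fun s => s * wfun u u' v v' s)
    (y := fun _ => 1) (y' := fun _ => 0) (A := drate p u u')
    (B := fun _ => 0) (a := min r ρ) (b := R)
    (continuousOn_id.mul ((P.sol.continuousOn_wfun P.var).mono hsub')) continuousOn_const
    (fun t ht => P.hasDerivAt_mul_wfun (H' t (hsub ⟨ht.1.le, ht.2.le⟩)) (ha.trans ht.1))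
    (fun s _ => hasDerivAt_const s _)
    (continuousOn_drate P.sol hsub' fun r hr => H' r (hsub hr)) continuousOn_const
    (fun t ht _ => ?_) (fun _ _ _ => by simp) (mul_pos ha (h1 _ ha (min_le_right _ _))) one_pos
    r ⟨min_le_left _ _, hrR⟩
  · exact pos_of_mul_pos_right this.1 hr.le
  · have ht0 := ha.trans ht.1
    have ht1 := hsub ⟨ht.1.le, ht.2.le⟩
    rw [le_div_iff₀ ht0, ← mul_drate]
    have := mul_nonneg (H' t ht1).xfun_nonneg (mul_pos ht0 (hN t ht1)).le
    unfold mfun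
    linarith

end SolPair

open Asymptotics in
/-- Exponential decay at infinity. -/
def ExpSmall (g : ℝ → ℝ) : Prop := ∃ δ > 0, g =O[atTop] fun r => exp (-δ * r)

namespace ExpSmall

open Asymptotics

variable {g h : ℝ → ℝ}

theorem exp_isBigO {δ ε : ℝ} (h : δ ≤ ε) :
    (fun r => exp (-ε * r)) =O[atTop] fun r : ℝ => exp (-δ * r) := by
  refine IsBigO.of_bound 1 ?_
  filter_upwards [eventually_ge_atTop 0] with r hr
  rw [Real.norm_eq_abs, Real.norm_eq_abs, abs_of_pos (exp_pos _), abs_of_pos (exp_pos _), one_mul]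
  exact exp_le_exp.2 (by nlinarith)

theorem add (hg : ExpSmall g) (hh : ExpSmall h) : ExpSmall fun r => g r + h r := by
  obtain ⟨δ, hδ, h1⟩ := hg
  obtain ⟨ε, hε, h2⟩ := hh
  exact ⟨min δ ε, lt_min hδ hε, (h1.trans (exp_isBigO (min_le_left _ _))).add
    (h2.trans (exp_isBigO (min_le_right _ _)))⟩

theorem mul_isBigO_one (hg : ExpSmall g) (hh : h =O[atTop] fun _ => (1:ℝ)) :
    ExpSmall fun r => g r * h r := by
  obtain ⟨δ, hδ, h1⟩ := hg
  exact ⟨δ, hδ, by simpa using h1.mul hh⟩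

theorem const_mul (hg : ExpSmall g) (c : ℝ) : ExpSmall fun r => c * g r := by
  obtain ⟨δ, hδ, h1⟩ := hg
  exact ⟨δ, hδ, h1.const_mul_left c⟩

theorem neg (hg : ExpSmall g) : ExpSmall fun r => -g r := by
  simpa using hg.const_mul (-1)

theorem sub (hg : ExpSmall g) (hh : ExpSmall h) : ExpSmall fun r => g r - h r := by
  simpa [sub_eq_add_neg] using hg.add hh.neg

theorem tendsto (hg : ExpSmall g) : Tendsto g atTop (nhds 0) := by
  obtain ⟨δ, hδ, h1⟩ := hg
  refine h1.trans_tendsto (tendsto_exp_atBot.comp ?_)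
  exact tendsto_id.const_mul_atTop_of_neg (by linarith)

theorem isBigO_one (hg : ExpSmall g) : g =O[atTop] fun _ => (1:ℝ) := hg.tendsto.isBigO_one ℝ

theorem mul (hg : ExpSmall g) (hh : ExpSmall h) : ExpSmall fun r => g r * h r :=
  hg.mul_isBigO_one hh.isBigO_one

theorem rpow_mul (hg : ExpSmall g) (s : ℝ) : ExpSmall fun r => r ^ s * g r := by
  obtain ⟨δ, hδ, h1⟩ := hg
  refine ⟨δ / 2, half_pos hδ, ?_⟩
  have h2 := (isLittleO_rpow_exp_pos_mul_atTop s (half_pos hδ)).isBigO.mul h1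
  refine h2.congr_right fun r => ?_
  rw [← exp_add]; congr 1; ring

theorem pow_mul (hg : ExpSmall g) (k : ℕ) : ExpSmall fun r => r ^ k * g r := by
  simpa using hg.rpow_mul k

theorem id_mul (hg : ExpSmall g) : ExpSmall fun r => r * g r := by
  simpa using hg.pow_mul 1

theorem abs_rpow (hg : ExpSmall g) {s : ℝ} (hs : 0 < s) : ExpSmall fun r => |g r| ^ s := by
  obtain ⟨δ, hδ, h1⟩ := hg
  refine ⟨δ * s, mul_pos hδ hs, ?_⟩
  refine (h1.abs_left.rpow hs.le (Eventually.of_forall fun r => (exp_pos _).le)).congr_right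
    fun r => ?_
  rw [← Real.exp_mul]; congr 1; ring

theorem of_abs_le (hg : ExpSmall g) (hh : ∀ᶠ r in atTop, |h r| ≤ |g r|) : ExpSmall h := by
  obtain ⟨δ, hδ, h1⟩ := hg
  exact ⟨δ, hδ, (IsBigO.of_bound 1 (by simpa using hh)).trans h1⟩

end ExpSmall

/-- A function vanishing at infinity and nondecreasing where positive is nonpositive. -/
theorem nonpos_of_tendsto_zero {g g' : ℝ → ℝ} {R : ℝ} (hd : ∀ r, R < r → HasDerivAt g (g' r) r)
    (h : ∀ r, R < r → 0 < g r → 0 ≤ g' r) (ht : Tendsto g atTop (nhds 0)) {r : ℝ} (hr : R < r) :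
    g r ≤ 0 := by
  by_contra! hpos
  have hφ : ∀ t, R < t → HasDerivAt (fun t => |g t| ^ ((2:ℝ) - 1) * g t + g t ^ 2)
      (2 * (|g t| + g t) * g' t) t := by
    intro t htR
    refine (((hasDerivAt_abs_rpow_mul (p := 2) (by norm_num) (g t)).comp t (hd t htR)).add
      ((hd t htR).pow 2)).congr_deriv ?_
    norm_num
    ring
  have hle : ∀ b, r ≤ b → 2 * g r ^ 2 ≤ |g b| ^ ((2:ℝ) - 1) * g b + g b ^ 2 := by
    intro b hb
    have hm := monotoneOn_Icc_of_hasDerivAt (a := r) (b := b)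
      (fun t ht => (hφ t (hr.trans_le ht.1)).continuousAt.continuousWithinAt)
      (fun t ht => hφ t (hr.trans ht.1)) (fun t ht => by
        rcases le_or_gt (g t) 0 with h0 | h0
        · rw [abs_of_nonpos h0]; simp
        · have := h t (hr.trans ht.1) h0
          positivity)
    have := hm (left_mem_Icc.2 hb) (right_mem_Icc.2 hb) hb
    simp only [abs_of_pos hpos] at this
    norm_num at this ⊢
    nlinarith
  have hlim : Tendsto (fun b => |g b| ^ ((2:ℝ) - 1) * g b + g b ^ 2) atTop (nhds 0) := by
    have h1 : Tendsto (fun b => |g b| * g b + g b ^ 2) atTop (nhds (|0| * 0 + 0 ^ 2)) :=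
      (ht.abs.mul ht).add (ht.pow 2)
    norm_num at h1 ⊢
    exact h1
  have := ge_of_tendsto hlim (eventually_atTop.2 ⟨r, hle⟩)
  nlinarith

/-- A nonlinear radial solution that is eventually positive and vanishes at infinity. -/
structure DecayingTail (n p : ℝ) (w w' : ℝ → ℝ) : Prop where
  hn : 3 ≤ n
  hp : 1 < p
  sol : RadialSol n (fun r => f p (w r)) w w'
  pos : ∀ᶠ r in atTop, 0 < w r
  tendsto : Tendsto w atTop (nhds 0)
  tendsto' : Tendsto w' atTop (nhds 0)

namespace DecayingTail

variable {n p : ℝ} {w w' : ℝ → ℝ}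

theorem tendsto_abs_rpow (T : DecayingTail n p w w') :
    Tendsto (fun r => |w r| ^ (p - 1)) atTop (nhds 0) := by
  have := ((continuous_abs_rpow_sub T.hp).tendsto 0).comp T.tendsto
  simpa [Function.comp_def, Real.zero_rpow (by linarith [T.hp] : p - 1 ≠ 0)] using this

theorem eventually_small (T : DecayingTail n p w w') {ε : ℝ} (hε : 0 < ε) :
    ∀ᶠ r in atTop, 0 < r ∧ (n - 1) / r < ε ∧ 0 < w r ∧ |w r| ^ (p - 1) < ε := by
  have h1 : Tendsto (fun r : ℝ => (n - 1) / r) atTop (nhds 0) :=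
    tendsto_const_nhds.div_atTop tendsto_id
  filter_upwards [eventually_gt_atTop 0, h1.eventually_lt_const hε, T.pos,
    T.tendsto_abs_rpow.eventually_lt_const hε] with r a b c d
  exact ⟨a, b, c, d⟩

theorem deriv_le (T : DecayingTail n p w w') : ∀ᶠ r in atTop, w' r ≤ -(w r / 2) := by
  obtain ⟨R, hR⟩ := eventually_atTop.1 (T.eventually_small (ε := 1 / 8) (by norm_num))
  filter_upwards [eventually_gt_atTop R] with r hr
  have := nonpos_of_tendsto_zero (R := R) (g := fun r => w' r + w r / 2)
    (fun t ht => (T.sol.hasDeriv' t (hR t ht.le).1).add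
      ((T.sol.hasDeriv t (hR t ht.le).1).div_const 2)) ?_ ?_ hr
  · linarith
  · intro t ht hpos
    obtain ⟨h0, h1, h2, h3⟩ := hR t ht.le
    have h4 : 0 ≤ (n - 1) / t := div_nonneg (by linarith [T.hn]) h0.le
    have e : -((n - 1) / t * w' t) - f p (w t) + w' t / 2 =
        (1 / 2 - (n - 1) / t) * (w' t + w t / 2) +
          w t * (1 - |w t| ^ (p - 1) - (1 / 2 - (n - 1) / t) / 2) := by unfold f; ring
    rw [e]
    have h5 : 0 ≤ 1 / 2 - (n - 1) / t := by linarith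
    have h6 : 0 ≤ 1 - |w t| ^ (p - 1) - (1 / 2 - (n - 1) / t) / 2 := by linarith
    exact add_nonneg (mul_nonneg h5 hpos.le) (mul_nonneg h2.le h6)
  · simpa using T.tendsto'.add (T.tendsto.div_const 2)

theorem le_deriv (T : DecayingTail n p w w') : ∀ᶠ r in atTop, -(2 * w r) ≤ w' r := by
  obtain ⟨R, hR⟩ := eventually_atTop.1 (T.eventually_small (ε := 1 / 8) (by norm_num))
  filter_upwards [eventually_gt_atTop R] with r hr
  have := nonpos_of_tendsto_zero (R := R) (g := fun r => -(w' r + 2 * w r))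
    (fun t ht => ((T.sol.hasDeriv' t (hR t ht.le).1).add
      ((T.sol.hasDeriv t (hR t ht.le).1).const_mul 2)).neg) ?_ ?_ hr
  · linarith
  · intro t ht hpos
    obtain ⟨h0, h1, h2, h3⟩ := hR t ht.le
    have h4 : 0 ≤ (n - 1) / t := div_nonneg (by linarith [T.hn]) h0.le
    have h5 : 0 ≤ |w t| ^ (p - 1) := Real.rpow_nonneg (abs_nonneg _) _
    have e : -(-((n - 1) / t * w' t) - f p (w t) + 2 * w' t) =
        (2 - (n - 1) / t) * (-(w' t + 2 * w t)) +
          w t * (2 * (2 - (n - 1) / t) - 1 + |w t| ^ (p - 1)) := by unfold f; ring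
    rw [e]
    exact add_nonneg (mul_nonneg (by linarith) hpos.le) (mul_nonneg h2.le (by linarith))
  · simpa using (T.tendsto'.add (T.tendsto.const_mul 2)).neg

theorem abs_deriv_le (T : DecayingTail n p w w') : ∀ᶠ r in atTop, |w' r| ≤ 2 * w r := by
  filter_upwards [T.deriv_le, T.le_deriv, T.pos] with r h1 h2 h3
  rw [abs_le]; constructor <;> linarith

theorem expSmall (T : DecayingTail n p w w') : ExpSmall w := by
  obtain ⟨R, hR⟩ := eventually_atTop.1 ((T.deriv_le.and T.pos).and (eventually_gt_atTop 0))
  refine ⟨1 / 2, by norm_num, Asymptotics.IsBigO.of_bound (w R * exp (1 / 2 * R)) ?_⟩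
  filter_upwards [eventually_ge_atTop R] with r hr
  have hd : ∀ t, R ≤ t → HasDerivAt (fun t => w t * exp (1 / 2 * t))
      ((w' t + w t / 2) * exp (1 / 2 * t)) t := fun t ht => by
    refine ((T.sol.hasDeriv t (hR t ht).2).mul
      (((hasDerivAt_id t).const_mul (1 / 2)).exp)).congr_deriv ?_
    simp only [id, mul_one]; ring
  have ha := antitoneOn_Icc_of_hasDerivAt (a := R) (b := r)
    (fun t ht => (hd t ht.1).continuousAt.continuousWithinAt) (fun t ht => hd t ht.1.le)
    (fun t ht => mul_nonpos_of_nonpos_of_nonneg (by linarith [(hR t ht.1.le).1.1]) (exp_pos _).le)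
  have h1 : w r * exp (1 / 2 * r) ≤ w R * exp (1 / 2 * R) :=
    ha (left_mem_Icc.2 hr) (right_mem_Icc.2 hr) hr
  rw [Real.norm_eq_abs, Real.norm_eq_abs, abs_of_pos (hR r hr).1.2, abs_of_pos (exp_pos _)]
  have h2 : exp (1 / 2 * r) * exp (-(1 / 2) * r) = 1 := by rw [← exp_add]; simp
  calc w r = w r * exp (1 / 2 * r) * exp (-(1 / 2) * r) := by rw [mul_assoc, h2, mul_one]
    _ ≤ _ := by gcongr

theorem expSmall' (T : DecayingTail n p w w') : ExpSmall w' :=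
  (T.expSmall.const_mul 2).of_abs_le (by
    filter_upwards [T.abs_deriv_le] with r h using h.trans (le_abs_self _))

theorem expSmall_abs_rpow (T : DecayingTail n p w w') : ExpSmall fun r => |w r| ^ (p - 1) :=
  T.expSmall.abs_rpow (by linarith [T.hp])

end DecayingTail

theorem ExpSmall.congr {g h : ℝ → ℝ} (hg : ExpSmall g) (e : ∀ r, h r = g r) : ExpSmall h := by
  rwa [funext e]

section Tail

variable {n p m : ℝ} {w w' : ℝ → ℝ}

theorem DecayingTail.expSmall_yfun (T : DecayingTail n p w w') : ExpSmall (yfun m w w') :=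
  T.expSmall'.id_mul.add (T.expSmall.const_mul m)

theorem DecayingTail.expSmall_jfun (T : DecayingTail n p w w') : ExpSmall (jfun n p m w w') := by
  have hY := T.expSmall_yfun (m := m)
  have h2 := T.expSmall.mul T.expSmall
  refine (((hY.mul hY).const_mul (1 / 2)).sub (((h2.pow_mul 2).const_mul (1 / 2)).add
    (h2.const_mul (m * (n - 2 - m) / 2)))).add
      (((T.expSmall_abs_rpow.mul h2).pow_mul 2).const_mul (1 / (p + 1))) |>.congr fun r => ?_
  unfold jfun; ring

theorem DecayingTail.tendsto_rpow_mul_jfun (T : DecayingTail n p w w') (s : ℝ) :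
    Tendsto (fun r => r ^ s * jfun n p m w w' r) atTop (nhds 0) :=
  (T.expSmall_jfun.rpow_mul s).tendsto

end Tail

section Sign

variable {n p m σ : ℝ} {u u' v v' : ℝ → ℝ}

theorem jfun_sign (hσ : σ = 1 ∨ σ = -1) :
    jfun n p m (fun r => σ * u r) (fun r => σ * u' r) = jfun n p m u u' := by
  funext r
  rcases hσ with rfl | rfl
  · simp [jfun, yfun]
  · simp [jfun, yfun]; ring

theorem dfun_sign (hσ : σ = 1 ∨ σ = -1) :
    dfun n p m (fun r => σ * u r) (fun r => σ * u' r) = dfun n p m u u' := by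
  funext r
  rcases hσ with rfl | rfl
  · simp [dfun, yfun]
  · simp [dfun, yfun]; ring

theorem wfun_sign (hσ : σ = 1 ∨ σ = -1) :
    wfun (fun r => σ * u r) (fun r => σ * u' r) (fun r => σ * v r) (fun r => σ * v' r) =
      wfun u u' v v' := by
  funext r
  rcases hσ with rfl | rfl <;> simp [wfun]

theorem kfun_sign (hσ : σ = 1 ∨ σ = -1) :
    kfun n p m (fun r => σ * u r) (fun r => σ * u' r) (fun r => σ * v r) (fun r => σ * v' r) =
      kfun n p m u u' v v' := by
  funext r
  rcases hσ with rfl | rfl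
  · simp [kfun, yfun]
  · simp [kfun, yfun]; ring

end Sign

section JPosBound

variable {n p m σ : ℝ} {u u' : ℝ → ℝ}

theorem jfun_pos_of_decaying (hσ : σ = 1 ∨ σ = -1)
    (T : DecayingTail n p (fun r => σ * u r) (fun r => σ * u' r))
    (H : RadialSol n (fun r => f p (u r)) u u') (h0 : u 0 ≠ 0)
    (hm : m ≤ n - 2) (hme : 0 < m * (2 * m - n + 2)) {ρ : ℝ}
    (h1 : ∀ r, 0 < r → r < ρ → jcoef n p m u r ≤ 0)
    (h2 : ∀ r, 0 < r → ρ < r → 0 ≤ jcoef n p m u r)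
    (h3 : ∀ r, 0 < r → ρ < r → u r ≠ 0 → 0 < jcoef n p m u r)
    {r : ℝ} (hr : 0 < r) : 0 < jfun n p m u u' r := by
  refine jfun_pos_of_tendsto T.hp H h0 hm hme h1 h2 ?_ ?_ hr
  · filter_upwards [T.pos, eventually_gt_atTop 0, eventually_gt_atTop ρ] with t ht ht0 htρ
    have hu : u t ≠ 0 := fun h => by simp [h] at ht
    exact mul_pos (h3 t ht0 htρ hu) (by positivity)
  · rw [← jfun_sign hσ]
    exact T.tendsto_rpow_mul_jfun _

theorem CriticalParam.jfun_pos_of_decaying (hC : CriticalParam n p m) (hσ : σ = 1 ∨ σ = -1)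
    (T : DecayingTail n p (fun r => σ * u r) (fun r => σ * u' r))
    (H : RadialSol n (fun r => f p (u r)) u u') (h0 : u 0 ≠ 0) {r : ℝ} (hr : 0 < r) :
    0 < jfun n p m u u' r :=
  _root_.jfun_pos_of_decaying hσ T H h0 hC.le hC.mul_exc_pos (ρ := radius n m)
    (fun _ a b => hC.jcoef_nonpos u a b) (fun _ _ b => (hC.jcoef_pos u b).le)
    (fun _ _ b _ => hC.jcoef_pos u b) hr

theorem CriticalParam.jfun_pos_of_zero (hC : CriticalParam n p m)
    (H : RadialSol n (fun r => f p (u r)) u u') (h0 : u 0 ≠ 0) {R : ℝ} (hR : 0 < R)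
    (hz : u R = 0) {r : ℝ} (hr : 0 < r) (hrR : r ≤ R) :
    0 < jfun n p m u u' r :=
  _root_.jfun_pos_of_pos hC.hp H h0 hC.le hC.mul_exc_pos (ρ := radius n m)
    (fun _ a b => hC.jcoef_nonpos u a b) (fun _ _ b => (hC.jcoef_pos u b).le)
    (jfun_pos_at_zero hR hz (H.deriv_ne_zero_of_zero (by linarith [hC.hn]) hC.hp h0 hR hz)) hr hrR

theorem jcoef_three_one (u : ℝ → ℝ) (r : ℝ) :
    jcoef 3 p 1 u r = (p - 1) / (p + 1) * (r ^ 2 * |u r| ^ (p - 1)) := by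
  unfold jcoef; ring

theorem jcoef_three_one_nonneg (hp : 1 < p) (u : ℝ → ℝ) (r : ℝ) : 0 ≤ jcoef 3 p 1 u r := by
  rw [jcoef_three_one]
  exact mul_nonneg (div_nonneg (by linarith) (by linarith))
    (mul_nonneg (sq_nonneg _) (Real.rpow_nonneg (abs_nonneg _) _))

theorem criticalParam_three (hp3 : 3 < p) (hp5 : p < 5) : CriticalParam 3 p (4 / (p + 3)) where
  hn := le_rfl
  hp := by linarith
  sub := by linarith
  eq := by
    have : p + 3 ≠ 0 := by linarith
    field_simp; norm_num

theorem Admissible.of_decaying (hp3 : 3 < p) (hp5 : p < 5) (hσ : σ = 1 ∨ σ = -1)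
    (T : DecayingTail 3 p (fun r => σ * u r) (fun r => σ * u' r))
    (H : RadialSol 3 (fun r => f p (u r)) u u') (h0 : u 0 ≠ 0) {r : ℝ} (hr : 0 < r) :
    Admissible p u u' r where
  hp3 := hp3
  hp5 := hp5
  one := jfun_pos_of_decaying hσ T H h0 (by norm_num) (by norm_num) (ρ := 0)
    (fun _ a b => absurd a b.not_gt) (fun t _ _ => jcoef_three_one_nonneg T.hp u t)
    (fun t ht _ hu => by
      rw [jcoef_three_one]
      have := T.hp
      have : 0 < |u t| ^ (p - 1) := Real.rpow_pos_of_pos (abs_pos.2 hu) _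
      have : 0 < (p - 1) / (p + 1) := div_pos (by linarith) (by linarith)
      positivity) hr
  crit := (criticalParam_three hp3 hp5).jfun_pos_of_decaying hσ T H h0 hr

theorem Admissible.of_zero (hp3 : 3 < p) (hp5 : p < 5)
    (H : RadialSol 3 (fun r => f p (u r)) u u') (h0 : u 0 ≠ 0) {R : ℝ} (hR : 0 < R)
    (hz : u R = 0) {r : ℝ} (hr : 0 < r) (hrR : r ≤ R) : Admissible p u u' r where
  hp3 := hp3
  hp5 := hp5
  one := jfun_pos_of_pos (by linarith) H h0 (by norm_num) (by norm_num) (ρ := 0)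
    (fun _ a b => absurd a b.not_gt) (fun t _ _ => jcoef_three_one_nonneg (by linarith) u t)
    (jfun_pos_at_zero hR hz (H.deriv_ne_zero_of_zero (by norm_num) (by linarith) h0 hR hz)) hr hrR
  crit := (criticalParam_three hp3 hp5).jfun_pos_of_zero H h0 hR hz hr hrR

end JPosBound

/-- A decaying tail together with a solution of the linearized equation and a positive Wronskian. -/
structure TailPair (n p : ℝ) (w w' y y' : ℝ → ℝ) : Prop where
  tail : DecayingTail n p w w'
  var : RadialSol n (fun r => fder p (w r) * y r) y y'
  wron : ∀ r, 0 < r → 0 < wfun w w' y y' r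

namespace DecayingTail

variable {n p : ℝ} {w w' z z' : ℝ → ℝ}

open Asymptotics in
theorem isBigO_one_of_antitone (T : DecayingTail n p w w')
    (V : RadialSol n (fun r => fder p (w r) * z r) z z')
    (h : ∀ᶠ r in atTop, 0 < z r ∧ z' r ≤ 0) :
    (z =O[atTop] fun _ => (1:ℝ)) ∧ z' =O[atTop] fun _ => (1:ℝ) := by
  have hp := T.hp
  obtain ⟨R, hR⟩ := eventually_atTop.1
    (h.and (T.eventually_small (ε := 1 / (2 * p)) (by positivity)))
  have hanti : ∀ b, AntitoneOn z (Icc R b) := fun b => antitoneOn_Icc_of_hasDerivAt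
    (fun t ht => (V.hasDeriv t (hR t ht.1).2.1).continuousAt.continuousWithinAt)
    (fun t ht => V.hasDeriv t (hR t ht.1.le).2.1) (fun t ht => (hR t ht.1.le).1.2)
  have hmono : ∀ b, MonotoneOn z' (Icc R b) := fun b => monotoneOn_Icc_of_hasDerivAt
    (fun t ht => (V.hasDeriv' t (hR t ht.1).2.1).continuousAt.continuousWithinAt)
    (fun t ht => V.hasDeriv' t (hR t ht.1.le).2.1) (fun t ht => by
      obtain ⟨⟨h1, h2⟩, h3, h4, h5, h6⟩ := hR t ht.1.le
      have h7 : 0 ≤ (n - 1) / t := div_nonneg (by linarith [T.hn]) h3.le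
      have h8 : p * |w t| ^ (p - 1) ≤ 1 := by
        rw [lt_div_iff₀ (by positivity)] at h6
        nlinarith [Real.rpow_nonneg (abs_nonneg (w t)) (p - 1)]
      have h9 : fder p (w t) * z t ≤ 0 :=
        mul_nonpos_of_nonpos_of_nonneg (by unfold fder; linarith) h1.le
      have := mul_nonpos_of_nonneg_of_nonpos h7 h2
      linarith)
  constructor
  · refine IsBigO.of_bound (z R) (eventually_atTop.2 ⟨R, fun r hr => ?_⟩)
    rw [Real.norm_eq_abs, abs_of_pos (hR r hr).1.1, norm_one, mul_one]
    exact hanti r (left_mem_Icc.2 hr) (right_mem_Icc.2 hr) hr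
  · refine IsBigO.of_bound (-z' R) (eventually_atTop.2 ⟨R, fun r hr => ?_⟩)
    rw [Real.norm_eq_abs, abs_of_nonpos (hR r hr).1.2, norm_one, mul_one]
    exact neg_le_neg (hmono r (left_mem_Icc.2 hr) (right_mem_Icc.2 hr) hr)

end DecayingTail

namespace TailPair

variable {n p m : ℝ} {w w' y y' : ℝ → ℝ}

theorem hasDerivAt_wron (P : TailPair n p w w' y y') {r : ℝ} (hr : 0 < r) :
    HasDerivAt (fun r => r ^ (n - 2) * wfun w w' y y' r)
      ((p - 1) * (r ^ (n - 1) * (|w r| ^ (p - 1) * w r * y r))) r := by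
  have h1 := ((P.tail.sol.hasDeriv' r hr).mul (P.var.hasDeriv r hr)).sub
    ((P.tail.sol.hasDeriv r hr).mul (P.var.hasDeriv' r hr))
  refine ((Real.hasDerivAt_rpow_const (p := n - 2) (Or.inl hr.ne')).mul
    ((hasDerivAt_id r).mul h1)).congr_deriv ?_
  have e : r ^ (n - 1) = r ^ (n - 2) * r := by
    rw [← Real.rpow_add_one hr.ne']; congr 1; ring
  rw [e, Real.rpow_sub_one hr.ne']
  simp only [id, Pi.mul_apply, Pi.sub_apply]
  unfold f fder
  field_simp
  ring

theorem mul_lt (P : TailPair n p w w' y y') {r : ℝ} (hr : 0 < r) : w r * y' r < w' r * y r := by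
  have := P.wron r hr
  unfold wfun at this
  have := pos_of_mul_pos_right this hr.le
  linarith

theorem eventually_sign (P : TailPair n p w w' y y') :
    (∀ᶠ r in atTop, 0 < y r) ∨ ∀ᶠ r in atTop, y r < 0 := by
  obtain ⟨R, hR⟩ := eventually_atTop.1 (P.tail.pos.and (eventually_gt_atTop 0))
  by_cases h : ∃ a, R ≤ a ∧ y a ≤ 0
  · right
    obtain ⟨a, ha, hya⟩ := h
    filter_upwards [eventually_gt_atTop a] with r hr
    have hd : ∀ t, R ≤ t → HasDerivAt (fun t => y t / w t)
        ((y' t * w t - y t * w' t) / w t ^ 2) t := fun t ht =>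
      (P.var.hasDeriv t (hR t ht).2).div (P.tail.sol.hasDeriv t (hR t ht).2) (hR t ht).1.ne'
    have := strictAntiOn_Icc_of_hasDerivAt (a := a) (b := r)
      (fun t ht => (hd t (ha.trans ht.1)).continuousAt.continuousWithinAt)
      (fun t ht => hd t (ha.trans ht.1.le)) (fun t ht => by
        have h1 := hR t (ha.trans ht.1.le)
        have h2 := P.mul_lt h1.2
        exact div_neg_of_neg_of_pos (by linarith) (pow_pos h1.1 2))
      (left_mem_Icc.2 hr.le) (right_mem_Icc.2 hr.le) hr
    have h3 : y a / w a ≤ 0 := div_nonpos_of_nonpos_of_nonneg hya (hR a ha).1.le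
    have h4 : y r / w r < 0 := this.trans_le h3
    rcases div_neg_iff.1 h4 with h5 | h5
    · linarith [(hR r (ha.trans hr.le)).1, h5.2]
    · exact h5.1
  · left
    push Not at h
    exact eventually_atTop.2 ⟨R, h⟩

open Asymptotics in
theorem expSmall_wfun (P : TailPair n p w w' y y') (hy : y =O[atTop] fun _ => (1:ℝ))
    (hy' : y' =O[atTop] fun _ => (1:ℝ)) : ExpSmall (wfun w w' y y') :=
  ((P.tail.expSmall'.mul_isBigO_one hy).sub (P.tail.expSmall.mul_isBigO_one hy')).id_mul

open Asymptotics in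
theorem expSmall_kfun (P : TailPair n p w w' y y') (hy : y =O[atTop] fun _ => (1:ℝ))
    (hy' : y' =O[atTop] fun _ => (1:ℝ)) : ExpSmall (kfun n p m w w' y y') := by
  have hY := P.tail.expSmall_yfun (m := m)
  have hwy := P.tail.expSmall.mul_isBigO_one hy
  refine (((hY.mul_isBigO_one hy').id_mul.add ((hY.mul_isBigO_one hy).const_mul m)).sub
    ((hwy.pow_mul 2).add (hwy.const_mul (m * (n - 2 - m))))).add
      ((P.tail.expSmall_abs_rpow.mul hwy).pow_mul 2) |>.congr fun r => ?_
  unfold kfun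
  simp only [yfun]
  ring

theorem eventually_neg (P : TailPair n p w w' y y') : ∀ᶠ r in atTop, y r < 0 := by
  refine P.eventually_sign.resolve_left fun hpos => ?_
  have hdec : ∀ᶠ r in atTop, 0 < y r ∧ y' r ≤ 0 := by
    filter_upwards [hpos, P.tail.pos, P.tail.deriv_le, eventually_gt_atTop 0] with r h1 h2 h3 h4
    refine ⟨h1, ?_⟩
    have := P.mul_lt h4
    by_contra! hc
    nlinarith
  obtain ⟨hy, hy'⟩ := P.tail.isBigO_one_of_antitone P.var hdec
  have hlim := ((P.expSmall_wfun hy hy').rpow_mul (n - 2)).tendsto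
  obtain ⟨R, hR⟩ := eventually_atTop.1 ((hpos.and P.tail.pos).and (eventually_gt_atTop 0))
  have hR0 := (hR R le_rfl).2
  have hge : ∀ b, R ≤ b → R ^ (n - 2) * wfun w w' y y' R ≤ b ^ (n - 2) * wfun w w' y y' b := by
    intro b hb
    have h1 : ∀ t ∈ Icc R b, 0 < t := fun t ht => hR0.trans_le ht.1
    refine monotoneOn_Icc_of_hasDerivAt (g := fun r => r ^ (n - 2) * wfun w w' y y' r)
      (a := R) (b := b)
      (fun t ht => (P.hasDerivAt_wron (h1 t ht)).continuousAt.continuousWithinAt)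
      (fun t ht => P.hasDerivAt_wron (h1 t (Ioo_subset_Icc_self ht))) (fun t ht => ?_)
      (left_mem_Icc.2 hb) (right_mem_Icc.2 hb) hb
    obtain ⟨⟨h2, h3⟩, h4⟩ := hR t ht.1.le
    have := P.tail.hp
    have : 0 ≤ p - 1 := by linarith
    have := Real.rpow_nonneg (abs_nonneg (w t)) (p - 1)
    have := Real.rpow_nonneg h4.le (n - 1)
    positivity
  have h0 := ge_of_tendsto hlim (eventually_atTop.2 ⟨R, hge⟩)
  have := mul_pos (Real.rpow_pos_of_pos hR0 (n - 2)) (P.wron R hR0)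
  linarith

open Asymptotics in
/-- If the linearized solution does not move away from zero, it is bounded. -/
theorem bounded_of_not_escaping (P : TailPair n p w w' y y')
    (h : ¬ ∃ᶠ r in atTop, y r < 0 ∧ y' r < 0) :
    (∀ᶠ r in atTop, y r < 0 ∧ 0 ≤ y' r) ∧ (y =O[atTop] fun _ => (1:ℝ)) ∧
      y' =O[atTop] fun _ => (1:ℝ) := by
  rw [not_frequently] at h
  have h1 : ∀ᶠ r in atTop, y r < 0 ∧ 0 ≤ y' r := by
    filter_upwards [h, P.eventually_neg] with r h2 h3
    exact ⟨h3, not_lt.1 fun h4 => h2 ⟨h3, h4⟩⟩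
  have V : RadialSol n (fun r => fder p (w r) * (-1 * y r)) (fun r => -1 * y r)
      (fun r => -1 * y' r) := (P.var.const_mul (-1)).congr fun r hr => by ring
  obtain ⟨h2, h3⟩ := P.tail.isBigO_one_of_antitone V (by
    filter_upwards [h1] with r h2
    exact ⟨by linarith [h2.1], by linarith [h2.2]⟩)
  refine ⟨h1, ?_, ?_⟩
  · simpa using h2.const_mul_left (-1)
  · simpa using h3.const_mul_left (-1)

end TailPair

namespace TailPair

variable {n p m : ℝ} {w w' y y' : ℝ → ℝ}

open Asymptotics in
theorem eventually_wfun_le (P : TailPair n p w w' y y') (h : ∀ᶠ r in atTop, y r < 0 ∧ 0 ≤ y' r)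
    (hy : y =O[atTop] fun _ => (1:ℝ)) (hy' : y' =O[atTop] fun _ => (1:ℝ)) :
    ∀ᶠ r in atTop, wfun w w' y y' r ≤ r ^ 2 * (|w r| ^ (p - 1) * w r * -y r) := by
  have hp := P.tail.hp
  obtain ⟨R, hR⟩ := eventually_atTop.1 ((h.and P.tail.pos).and
    (P.tail.deriv_le.and ((eventually_gt_atTop 0).and
      (eventually_ge_atTop (2 * (n + p - 1) / p)))))
  filter_upwards [eventually_gt_atTop R] with r hr
  have key := nonpos_of_tendsto_zero (R := R)
    (g := fun r => r ^ (n - 2) * wfun w w' y y' r + r ^ n * (|w r| ^ (p - 1) * w r * y r))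
    (g' := fun r => r ^ (n - 1) * |w r| ^ (p - 1) *
      (y r * ((n + p - 1) * w r + r * p * w' r) + r * w r * y' r)) ?_ ?_ ?_ hr
  · have hr0 := (hR r hr.le).2.2.1
    have e : r ^ n = r ^ (n - 2) * r ^ 2 := by
      rw [← Real.rpow_natCast r 2, ← Real.rpow_add hr0]; norm_num
    have h1 := Real.rpow_pos_of_pos hr0 (n - 2)
    simp only [e] at key
    have h2 : r ^ (n - 2) * (wfun w w' y y' r + r ^ 2 * (|w r| ^ (p - 1) * w r * y r)) ≤ 0 := by
      linarith
    have h3 := nonpos_of_mul_nonpos_right h2 h1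
    linarith
  · intro t ht
    have ht0 := (hR t ht.le).2.2.1
    refine ((P.hasDerivAt_wron ht0).add ((Real.hasDerivAt_rpow_const (p := n) (Or.inl ht0.ne')).mul
      (((hasDerivAt_abs_rpow_mul hp (w t)).comp t (P.tail.sol.hasDeriv t ht0)).mul
        (P.var.hasDeriv t ht0)))).congr_deriv ?_
    have e : t ^ n = t ^ (n - 1) * t := by
      rw [← Real.rpow_add_one ht0.ne']; congr 1; ring
    rw [e]
    simp only [Function.comp, Pi.mul_apply]
    ring
  · intro t ht _
    obtain ⟨⟨⟨h1, h2⟩, h3⟩, h4, h5, h6⟩ := hR t ht.le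
    rw [div_le_iff₀ (by linarith)] at h6
    have h7 : 0 ≤ t ^ (n - 1) * |w t| ^ (p - 1) :=
      mul_nonneg (Real.rpow_nonneg h5.le _) (Real.rpow_nonneg (abs_nonneg _) _)
    have h8 : (n + p - 1) * w t + t * p * w' t ≤ 0 := by
      have : t * p * w' t ≤ t * p * -(w t / 2) := mul_le_mul_of_nonneg_left h4 (by positivity)
      nlinarith
    exact mul_nonneg h7 (add_nonneg (mul_nonneg_of_nonpos_of_nonpos h1.le h8)
      (mul_nonneg (mul_nonneg h5.le h3.le) h2))
  · exact (((P.expSmall_wfun hy hy').rpow_mul (n - 2)).add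
      (((P.tail.expSmall_abs_rpow.mul P.tail.expSmall).mul_isBigO_one hy).rpow_mul n)).tendsto

theorem _root_.DecayingTail.eventually_sq_le_jfun (T : DecayingTail n p w w')
    (hC : CriticalParam n p m) : ∀ᶠ r in atTop, w r ^ 2 ≤ jfun n p m w w' r := by
  have ha : 0 < 1 - (2 * m - n + 2) := by linarith [hC.exc_lt_one]
  obtain ⟨R, hR⟩ := eventually_atTop.1 ((T.pos.and T.le_deriv).and ((eventually_ge_atTop 1).and
    (eventually_ge_atTop ((4 + (2 * m - n + 2) * (m * (n - 2 - m))) / (1 - (2 * m - n + 2))))))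
  filter_upwards [eventually_gt_atTop R] with r hr
  have key := nonpos_of_tendsto_zero (R := R)
    (g := fun r => r ^ (2 * (n - 2 - m)) * w r ^ 2 - r ^ (2 * (n - 2 - m)) * jfun n p m w w' r)
    (g' := fun r => r ^ (2 * (n - 2 - m)) / r *
      ((2 * (n - 2 - m) + jcoef n p m w r) * w r ^ 2 + 2 * r * (w r * w' r))) ?_ ?_ ?_ hr
  · have h1 := Real.rpow_pos_of_pos (show 0 < r by linarith [(hR r hr.le).2.1]) (2 * (n - 2 - m))
    rw [← mul_sub] at key
    linarith [nonpos_of_mul_nonpos_right key h1]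
  · intro t ht
    have ht0 : 0 < t := by linarith [(hR t ht.le).2.1]
    refine (((Real.hasDerivAt_rpow_const (Or.inl ht0.ne')).mul
      ((T.sol.hasDeriv t ht0).pow 2)).sub (hasDerivAt_rpow_mul_jfun T.hp T.sol ht0)).congr_deriv ?_
    rw [Real.rpow_sub_one ht0.ne']
    simp only [Pi.pow_apply]
    field_simp
    ring
  · intro t ht _
    obtain ⟨⟨h1, h2⟩, h3, h4⟩ := hR t ht.le
    have ht0 : 0 < t := by linarith
    refine mul_nonneg (div_nonneg (Real.rpow_nonneg ht0.le _) ht0.le) ?_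
    rw [hC.jcoef_eq]
    rw [div_le_iff₀ ha] at h4
    have h5 := hC.prod_nonneg
    have h6 := hC.le
    have h7 : -(2 * w t ^ 2) ≤ w t * w' t := by nlinarith
    have h8 : 4 * t + (2 * m - n + 2) * (m * (n - 2 - m)) ≤ (1 - (2 * m - n + 2)) * t ^ 2 := by
      nlinarith
    have h9 : 0 ≤ (2 * (n - 2 - m) + ((1 - (2 * m - n + 2)) * t ^ 2 -
        (2 * m - n + 2) * (m * (n - 2 - m))) - 4 * t) * w t ^ 2 :=
      mul_nonneg (by linarith) (sq_nonneg _)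
    nlinarith
  · exact (((T.expSmall.mul T.expSmall).rpow_mul _).sub (T.expSmall_jfun.rpow_mul _)).congr
      (fun r => by ring) |>.tendsto

open Asymptotics in
theorem exists_kfun_le (P : TailPair n p w w' y y')
    (hy : y =O[atTop] fun _ => (1:ℝ)) (hy' : y' =O[atTop] fun _ => (1:ℝ)) :
    ∃ C, 0 ≤ C ∧ ∀ᶠ r in atTop, |y r| ≤ C ∧ |kfun n p m w w' y y' r| ≤ C * (r ^ 2 * w r) := by
  obtain ⟨C₁, h1⟩ := hy.bound
  obtain ⟨C₂, h2⟩ := hy'.bound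
  set C := max (max C₁ C₂) 0 with hC
  have hC0 : 0 ≤ C := le_max_right _ _
  refine ⟨C * ((2 + |m|) * (1 + |m|) + 1 + |m * (n - 2 - m)| + 1),
    mul_nonneg hC0 (by positivity), ?_⟩
  filter_upwards [h1, h2, P.tail.pos, P.tail.abs_deriv_le, eventually_ge_atTop 1,
    P.tail.tendsto_abs_rpow.eventually_lt_const one_pos] with r h1 h2 h3 h4 h5 h6
  have hr0 : 0 ≤ r := by linarith
  rw [Real.norm_eq_abs, norm_one, mul_one] at h1 h2
  have hyC : |y r| ≤ C := h1.trans ((le_max_left _ _).trans (le_max_left _ _))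
  have hyC' : |y' r| ≤ C := h2.trans ((le_max_right _ _).trans (le_max_left _ _))
  have hr2 : r ≤ r ^ 2 := by nlinarith
  have hq := Real.rpow_nonneg (abs_nonneg (w r)) (p - 1)
  refine ⟨hyC.trans (le_mul_of_one_le_right hC0 ?_), ?_⟩
  · have : 0 ≤ (2 + |m|) * (1 + |m|) + |m * (n - 2 - m)| + 1 := by positivity
    linarith
  have hY : |yfun m w w' r| ≤ (2 + |m|) * (r * w r) := by
    unfold yfun
    refine (abs_add_le _ _).trans ?_
    rw [abs_mul, abs_mul, abs_of_nonneg hr0, abs_of_pos h3]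
    have e1 : r * |w' r| ≤ r * (2 * w r) := mul_le_mul_of_nonneg_left h4 hr0
    have e2 : |m| * w r ≤ |m| * (r * w r) := by
      refine mul_le_mul_of_nonneg_left ?_ (abs_nonneg m); nlinarith
    linarith
  have hZ : |yfun m y y' r| ≤ (1 + |m|) * (r * C) := by
    unfold yfun
    refine (abs_add_le _ _).trans ?_
    rw [abs_mul, abs_mul, abs_of_nonneg hr0]
    have e1 : r * |y' r| ≤ r * C := mul_le_mul_of_nonneg_left hyC' hr0
    have e2 : |m| * |y r| ≤ |m| * (r * C) := by
      refine mul_le_mul_of_nonneg_left ?_ (abs_nonneg m); nlinarith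
    linarith
  have k1 : |yfun m w w' r * yfun m y y' r| ≤ (2 + |m|) * (r * w r) * ((1 + |m|) * (r * C)) := by
    rw [abs_mul]; gcongr
  have hwy : |w r * y r| ≤ w r * C := by rw [abs_mul, abs_of_pos h3]; gcongr
  have k2 : |(r ^ 2 + m * (n - 2 - m)) * (w r * y r)| ≤
      (r ^ 2 * (1 + |m * (n - 2 - m)|)) * (w r * C) := by
    rw [abs_mul]
    refine mul_le_mul ?_ hwy (abs_nonneg _) (by positivity)
    refine (abs_add_le _ _).trans ?_
    rw [abs_of_nonneg (sq_nonneg r)]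
    have : |m * (n - 2 - m)| ≤ r ^ 2 * |m * (n - 2 - m)| :=
      le_mul_of_one_le_left (abs_nonneg _) (by linarith)
    linarith
  have k3 : |r ^ 2 * (|w r| ^ (p - 1) * w r * y r)| ≤ r ^ 2 * (w r * C) := by
    rw [abs_mul, abs_of_nonneg (sq_nonneg r), mul_assoc, abs_mul, abs_of_nonneg hq]
    refine mul_le_mul_of_nonneg_left ?_ (sq_nonneg r)
    exact (mul_le_of_le_one_left (abs_nonneg _) h6.le).trans hwy
  have tri : ∀ a b c : ℝ, |a - b + c| ≤ |a| + |b| + |c| := fun a b c =>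
    (abs_add_le _ _).trans (by gcongr; exact abs_sub _ _)
  unfold kfun
  refine (tri _ _ _).trans ?_
  linarith

open Asymptotics in
theorem escape_of_critical (P : TailPair n p w w' y y') (hC : CriticalParam n p m)
    (hJ : ∀ r, 0 < r → 0 < jfun n p m w w' r) (hL : ∀ r, 0 < r → 0 < lamfun n p m w w' y y' r)
    (hM : MonotoneOn (fun r => r ^ (n - 2) *
      (lamfun n p m w w' y y' r * wfun w w' y y' r / dfun n p m w w' r ^ 2)) (Ioi 0)) :
    ∃ᶠ r in atTop, y r < 0 ∧ y' r < 0 := by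
  by_contra hcon
  obtain ⟨h, hy, hy'⟩ := P.bounded_of_not_escaping hcon
  obtain ⟨C, hC0, hK⟩ := P.exists_kfun_le (m := m) hy hy'
  have hq := P.tail.expSmall_abs_rpow
  have hsmall : ExpSmall fun r => r ^ (n - 2) * (C * C * (r ^ 4 * |w r| ^ (p - 1)) +
      C ^ 2 * (r ^ 6 * (|w r| ^ (p - 1) * |w r| ^ (p - 1)))) :=
    (((hq.pow_mul 4).const_mul (C * C)).add (((hq.mul hq).pow_mul 6).const_mul (C ^ 2))).rpow_mul _
  have hD : ∀ r, 0 < r → 0 < dfun n p m w w' r := fun r hr => dfun_pos hC.hp (hJ r hr)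
  have hle : ∀ᶠ r in atTop, 1 ^ (n - 2) * (lamfun n p m w w' y y' 1 * wfun w w' y y' 1 /
      dfun n p m w w' 1 ^ 2) ≤ r ^ (n - 2) * (C * C * (r ^ 4 * |w r| ^ (p - 1)) +
      C ^ 2 * (r ^ 6 * (|w r| ^ (p - 1) * |w r| ^ (p - 1)))) := by
    filter_upwards [h, hK, P.tail.pos, P.eventually_wfun_le h hy hy',
      P.tail.eventually_sq_le_jfun hC, eventually_ge_atTop 1] with r h1 h2 h3 h4 h5 h6
    have hr0 : 0 < r := by linarith
    refine (hM (mem_Ioi.2 one_pos) (mem_Ioi.2 hr0) h6).trans ?_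
    refine mul_le_mul_of_nonneg_left ?_ (Real.rpow_nonneg hr0.le _)
    have hDr := hD r hr0
    rw [div_le_iff₀ (pow_pos hDr 2)]
    set q := |w r| ^ (p - 1) with hqdef
    have hq0 : 0 ≤ q := Real.rpow_nonneg (abs_nonneg _) _
    have hW0 := P.wron r hr0
    have hW : wfun w w' y y' r ≤ C * (r ^ 2 * q * w r) := by
      refine h4.trans ?_
      have : -y r ≤ C := (neg_le_abs _).trans h2.1
      calc r ^ 2 * (q * w r * -y r) = r ^ 2 * q * w r * -y r := by ring
        _ ≤ r ^ 2 * q * w r * C := by gcongr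
        _ = _ := by ring
    have hwD : w r ^ 2 ≤ dfun n p m w w' r := by
      have hdd := dfun_eq (n := n) (m := m) hC.hp w w' r
      have : 0 ≤ (p - 1) / (p + 1) * (r ^ 2 * (|w r| ^ (p - 1) * w r ^ 2)) := by
        have := hC.hp
        exact mul_nonneg (div_nonneg (by linarith) (by linarith)) (by positivity)
      nlinarith [sq_nonneg (w r)]
    have heta : -etafun n p m w w' r ≤ r ^ 2 * w r ^ 2 := by
      unfold etafun
      have e1 := hC.prod_nonneg
      have e2 := mul_pos hC.exc_pos (hJ r hr0)
      have e3 := hC.exc_pos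
      have e4 : ((1 - (2 * m - n + 2)) * r ^ 2 - (2 * m - n + 2) * (m * (n - 2 - m))) * w r ^ 2 ≤
          r ^ 2 * w r ^ 2 := by
        refine mul_le_mul_of_nonneg_right ?_ (sq_nonneg _)
        nlinarith [sq_nonneg r]
      linarith
    have hlam : lamfun n p m w w' y y' r ≤ dfun n p m w w' r * (C * (r ^ 2 * w r)) +
        r ^ 2 * w r ^ 2 * (C * (r ^ 2 * q * w r)) := by
      unfold lamfun
      have e1 := mul_le_mul_of_nonneg_left ((le_abs_self _).trans h2.2) hDr.le
      have e2 : -etafun n p m w w' r * wfun w w' y y' r ≤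
          r ^ 2 * w r ^ 2 * (C * (r ^ 2 * q * w r)) :=
        mul_le_mul heta hW hW0.le (by positivity)
      linarith
    calc lamfun n p m w w' y y' r * wfun w w' y y' r ≤
        (dfun n p m w w' r * (C * (r ^ 2 * w r)) + r ^ 2 * w r ^ 2 * (C * (r ^ 2 * q * w r))) *
          (C * (r ^ 2 * q * w r)) := mul_le_mul hlam hW hW0.le (by positivity)
      _ = w r ^ 2 * (C * C * (r ^ 4 * q)) * dfun n p m w w' r +
          C ^ 2 * (r ^ 6 * (q * q)) * (w r ^ 2 * w r ^ 2) := by ring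
      _ ≤ dfun n p m w w' r * (C * C * (r ^ 4 * q)) * dfun n p m w w' r +
          C ^ 2 * (r ^ 6 * (q * q)) * (dfun n p m w w' r * dfun n p m w w' r) := by gcongr
      _ = _ := by ring
  have := ge_of_tendsto hsmall.tendsto hle
  have hpos : 0 < 1 ^ (n - 2) * (lamfun n p m w w' y y' 1 * wfun w w' y y' 1 /
      dfun n p m w w' 1 ^ 2) := by
    have := hL 1 one_pos
    have := P.wron 1 one_pos
    have := hD 1 one_pos
    rw [Real.one_rpow]
    positivity
  linarith

end TailPair

section Sign

variable {n p m σ : ℝ} {u u' v v' : ℝ → ℝ}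

theorem lamfun_sign (hσ : σ = 1 ∨ σ = -1) :
    lamfun n p m (fun r => σ * u r) (fun r => σ * u' r) (fun r => σ * v r) (fun r => σ * v' r) =
      lamfun n p m u u' v v' := by
  funext r
  have h2 : (σ * u r) ^ 2 = u r ^ 2 := by rcases hσ with rfl | rfl <;> simp
  unfold lamfun etafun
  rw [dfun_sign hσ, kfun_sign hσ, wfun_sign hσ, jfun_sign hσ, h2]

theorem SolPair.tailPair (P : SolPair n p u u' v v') (hσ : σ = 1 ∨ σ = -1)
    (T : DecayingTail n p (fun r => σ * u r) (fun r => σ * u' r))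
    (hW : ∀ r, 0 < r → 0 < wfun u u' v v' r) :
    TailPair n p (fun r => σ * u r) (fun r => σ * u' r) (fun r => σ * v r) (fun r => σ * v' r) where
  tail := T
  var := (P.var.const_mul σ).congr fun r _ => by
    rcases hσ with rfl | rfl <;> simp [fder]
  wron := by rwa [wfun_sign hσ]

theorem SolPair.escape_of_critical (P : SolPair n p u u' v v') (hC : CriticalParam n p m)
    (hp3 : p ≤ 3) (hσ : σ = 1 ∨ σ = -1)
    (T : DecayingTail n p (fun r => σ * u r) (fun r => σ * u' r)) :
    ∃ᶠ r in atTop, σ * v r < 0 ∧ σ * v' r < 0 := by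
  have hJ : ∀ r, 0 < r → 0 < jfun n p m u u' r := fun r hr =>
    hC.jfun_pos_of_decaying hσ T P.sol P.init.ne' hr
  have hLW := fun r hr => P.lam_wfun_pos_of_critical hC hp3 (R := r)
    (fun t ht _ => hJ t ht) hr le_rfl
  refine (P.tailPair hσ T fun r hr => (hLW r hr).2).escape_of_critical hC ?_ ?_ ?_
  · rwa [jfun_sign hσ]
  · rw [lamfun_sign hσ]; exact fun r hr => (hLW r hr).1
  · rw [lamfun_sign hσ, wfun_sign hσ, dfun_sign hσ]
    exact P.monotoneOn_lam_mul_wfun hC hp3 hJ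

open Asymptotics in
theorem SolPair.escape_of_admissible (P : SolPair 3 p u u' v v') (hp3 : 3 < p) (hp5 : p < 5)
    (hσ : σ = 1 ∨ σ = -1) (T : DecayingTail 3 p (fun r => σ * u r) (fun r => σ * u' r)) :
    ∃ᶠ r in atTop, σ * v r < 0 ∧ σ * v' r < 0 := by
  have H : ∀ r, 0 < r → Admissible p u u' r := fun r hr =>
    .of_decaying hp3 hp5 hσ T P.sol P.init.ne' hr
  have hL := fun r hr => P.wfun_pos_of_admissible (R := r) (fun t ht _ => H t ht) hr le_rfl
  have Q := P.tailPair hσ T fun r hr => (hL r hr).1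
  by_contra hcon
  obtain ⟨-, hy, hy'⟩ := Q.bounded_of_not_escaping hcon
  have hM : ExpSmall (mfun p u u' v v') := by
    have := ((Q.expSmall_kfun (m := 1) hy hy').add (Q.expSmall_wfun hy hy')).id_mul
    rwa [kfun_sign hσ, wfun_sign hσ] at this
  set N := (1 + 2 / (p - 1)) * (p + 1) with hN
  have hlim := (hM.rpow_mul N).tendsto
  have hev : ∀ᶠ r in atTop, 0 < r ∧ u r ≠ 0 ∧ bfun p u u' r < 0 := by
    filter_upwards [T.pos, T.deriv_le, eventually_gt_atTop 2] with r h1 h2 h3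
    have hr0 : 0 < r := by linarith
    refine ⟨hr0, fun h => by simp [h] at h1, div_neg_of_neg_of_pos ?_ (H r hr0).dpos⟩
    have e : u r * yfun 1 u u' r = σ * u r * (r * (σ * u' r) + σ * u r) := by
      unfold yfun; rcases hσ with rfl | rfl <;> ring
    rw [e]
    exact mul_neg_of_pos_of_neg h1 (by nlinarith)
  obtain ⟨R, hR⟩ := eventually_atTop.1 hev
  have hβ : ∀ r, R ≤ r → gfun p u u' r * bfun p u u' r < 0 := fun r hr =>
    mul_neg_of_pos_of_neg (H r (hR r hr).1).gfun_pos (hR r hr).2.2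
  have hgap : ∀ r, R ≤ r → 0 < gapfun p u u' r / (1 - gfun p u u' r * bfun p u u' r) ∧
      gapfun p u u' r / (1 - gfun p u u' r * bfun p u u' r) ≤ 1 + 2 / (p - 1) := by
    intro r hr
    have h1 := hβ r hr
    have h2 := H r (hR r hr).1
    have hd : 0 < 2 / (p - 1) := by linarith [h2.half_lt]
    refine ⟨div_pos h2.gap_pos (by linarith), ?_⟩
    rw [div_le_iff₀ (by linarith)]
    unfold gapfun
    have := h2.theta_le_one
    nlinarith
  have hT0 : ∀ r, R ≤ r → 0 ≤ tailfun p u u' v v' r := by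
    intro r hr
    have h1 := hβ r hr
    have h2 := (hL r (hR r hr).1).2.2
    have h3 := (H r (hR r hr).1).gap_pos
    have h4 : 1 - gfun p u u' r * bfun p u u' r ≠ 0 := by linarith
    have e : tailfun p u u' v v' r =
        gapfun p u u' r / (1 - gfun p u u' r * bfun p u u' r) * lfun p u u' v v' r := by
      unfold tailfun lfun nufun; field_simp
    rw [e]
    exact mul_nonneg (hgap r hr).1.le h2
  have hTM : ∀ r, R ≤ r → tailfun p u u' v v' r ≤ mfun p u u' v v' r := by
    intro r hr
    have h0 := (hR r hr).1
    have := mul_pos (hgap r hr).1 (mul_pos h0 (hL r h0).1)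
    unfold tailfun; linarith
  have hder : ∀ r, R ≤ r → HasDerivAt (fun r => r ^ N * tailfun p u u' v v' r)
      (r ^ N / r *
        ((N + 1 - gapfun p u u' r / (1 - gfun p u u' r * bfun p u u' r) * xfun p u u' r) *
          tailfun p u u' v v' r +
        sourcefun p u u' r / (1 - gfun p u u' r * bfun p u u' r) ^ 2 *
          (r * wfun u u' v v' r))) r := by
    intro r hr
    have h0 := (hR r hr).1
    refine ((Real.hasDerivAt_rpow_const (Or.inl h0.ne')).mul
      (P.hasDerivAt_tailfun (H r h0) h0 (by linarith [hβ r hr]))).congr_deriv ?_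
    rw [Real.rpow_sub_one h0.ne']
    ring
  have hmono : ∀ b, StrictMonoOn (fun r => r ^ N * tailfun p u u' v v' r) (Icc R b) := fun b =>
    strictMonoOn_Icc_of_hasDerivAt
      (fun t ht => (hder t ht.1).continuousAt.continuousWithinAt) (fun t ht => hder t ht.1.le)
      (fun t ht => by
        have h0 := (hR t ht.1.le).1
        have h1 := hβ t ht.1.le
        obtain ⟨h2, h3⟩ := hgap t ht.1.le
        have hH := H t h0
        have h4 := (hL t h0).1
        have h5 := Real.rpow_pos_of_pos h0 N
        have h6 := hH.source_pos h0 (hR t ht.1.le).2.1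
        have h7 : 0 < (1 - gfun p u u' t * bfun p u u' t) ^ 2 := pow_pos (by linarith) 2
        have h8 : gapfun p u u' t / (1 - gfun p u u' t * bfun p u u' t) * xfun p u u' t ≤ N :=
          mul_le_mul h3 hH.xfun_le hH.xfun_nonneg (h2.le.trans h3)
        have h9 := mul_nonneg (by linarith : 0 ≤ N + 1 - gapfun p u u' t /
          (1 - gfun p u u' t * bfun p u u' t) * xfun p u u' t) (hT0 t ht.1.le)
        have h10 : 0 < sourcefun p u u' t / (1 - gfun p u u' t * bfun p u u' t) ^ 2 *
          (t * wfun u u' v v' t) := by positivity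
        exact mul_pos (by positivity) (by linarith))
  have hR1 : 0 < (R + 1) ^ N * tailfun p u u' v v' (R + 1) := by
    have h1 : R ^ N * tailfun p u u' v v' R < (R + 1) ^ N * tailfun p u u' v v' (R + 1) :=
      hmono (R + 1) (left_mem_Icc.2 (by linarith)) (right_mem_Icc.2 (by linarith)) (by linarith)
    have h2 := mul_nonneg (Real.rpow_nonneg (hR R le_rfl).1.le N) (hT0 R le_rfl)
    linarith
  have hge : ∀ b, R + 1 ≤ b →
      (R + 1) ^ N * tailfun p u u' v v' (R + 1) ≤ b ^ N * mfun p u u' v v' b := by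
    intro b hb
    have h1 : (R + 1) ^ N * tailfun p u u' v v' (R + 1) ≤ b ^ N * tailfun p u u' v v' b :=
      (hmono b).monotoneOn ⟨by linarith, hb⟩ (right_mem_Icc.2 (by linarith)) hb
    exact h1.trans (mul_le_mul_of_nonneg_left (hTM b (by linarith))
      (Real.rpow_nonneg (hR b (by linarith)).1.le _))
  exact hR1.not_ge (ge_of_tendsto hlim (eventually_atTop.2 ⟨R + 1, hge⟩))

/-- The subcritical range of exponents. -/
structure Subcritical (n p : ℝ) : Prop where
  hn : 3 ≤ n
  hp : 1 < p
  sub : p * (n - 2) < n + 2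
  dim : p ≤ 3 ∨ n = 3

theorem Subcritical.criticalParam (h : Subcritical n p) :
    CriticalParam n p (2 * (n - 1) / (p + 3)) where
  hn := h.hn
  hp := h.hp
  sub := h.sub
  eq := by have := h.hp; field_simp

theorem SolPair.wfun_pos_of_zero (P : SolPair n p u u' v v') (h : Subcritical n p) {R : ℝ}
    (hR : 0 < R) (hz : u R = 0) : 0 < wfun u u' v v' R := by
  rcases le_or_gt p 3 with hp3 | hp3
  · exact (P.lam_wfun_pos_of_critical h.criticalParam hp3
      (fun t ht htR => h.criticalParam.jfun_pos_of_zero P.sol P.init.ne' hR hz ht htR) hR le_rfl).2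
  · obtain rfl := h.dim.resolve_left hp3.not_ge
    have hp5 : p < 5 := by linarith [h.sub]
    exact (P.wfun_pos_of_admissible
      (fun t ht htR => .of_zero hp3 hp5 P.sol P.init.ne' hR hz ht htR) hR le_rfl).1

theorem SolPair.escape (P : SolPair n p u u' v v') (h : Subcritical n p) (hσ : σ = 1 ∨ σ = -1)
    (T : DecayingTail n p (fun r => σ * u r) (fun r => σ * u' r)) :
    ∃ᶠ r in atTop, σ * v r < 0 ∧ σ * v' r < 0 := by
  rcases le_or_gt p 3 with hp3 | hp3
  · exact P.escape_of_critical h.criticalParam hp3 hσ T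
  · obtain rfl := h.dim.resolve_left hp3.not_ge
    exact P.escape_of_admissible hp3 (by linarith [h.sub]) hσ T

end Sign

/-- `u` has at least `N` zeros in `(0, R]`. -/
def HasZeros (u : ℝ → ℝ) (N : ℕ) (R : ℝ) : Prop :=
  ∃ z : Fin N → ℝ, Function.Injective z ∧ ∀ i, 0 < z i ∧ z i ≤ R ∧ u (z i) = 0

theorem ExactZeros.not_hasZeros {u : ℝ → ℝ} {k : ℕ} {z : Fin k → ℝ} (h : ExactZeros u k z)
    {R : ℝ} : ¬ HasZeros u (k + 1) R := by
  rintro ⟨y, hy, hy'⟩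
  choose i hi using fun j => h.2.2 (y j) (hy' j).1 (hy' j).2.2
  have hinj : Function.Injective i := fun a b hab => hy (by rw [hi a, hi b, hab])
  have := Fintype.card_le_of_injective i hinj
  simp at this

theorem HasZeros.cons {u : ℝ → ℝ} {N : ℕ} {R t : ℝ} (h : HasZeros u N R) (hR : 0 ≤ R) (ht : R < t)
    (hu : u t = 0) : HasZeros u (N + 1) t := by
  obtain ⟨z, hz, hz'⟩ := h
  refine ⟨Fin.cons t z, Fin.cons_injective_iff.2 ⟨?_, hz⟩, fun i => ?_⟩
  · rintro ⟨i, rfl⟩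
    linarith [(hz' i).2.1]
  · refine Fin.cases ?_ (fun i => ?_) i
    · exact ⟨hR.trans_lt ht, le_rfl, hu⟩
    · exact ⟨(hz' i).1, by simpa using (hz' i).2.1.trans ht.le, (hz' i).2.2⟩

theorem zero_of_sign_change {g : ℝ → ℝ} {a b s : ℝ} (hab : a ≤ b) (hg : ContinuousOn g (Icc a b))
    (ha : s * g a < 0) (hb : 0 < s * g b) : ∃ c ∈ Ioo a b, g c = 0 := by
  have h := intermediate_value_Ioo hab (continuousOn_const (c := s) |>.mul hg)
    (show (0:ℝ) ∈ Ioo _ _ from ⟨ha, hb⟩)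
  obtain ⟨c, hc, hc'⟩ := h
  refine ⟨c, hc, (mul_eq_zero.1 hc').resolve_left fun h => ?_⟩
  simp [h] at ha

namespace SolFamily

variable {n : ℕ} {p A M : ℝ} {U U' : ℝ → ℝ → ℝ}

theorem tendsto_apply {ι : Type*} {l : Filter ι} {b ρ : ι → ℝ} {α r R : ℝ}
    (S : SolFamily n p A M U U') (hn : 1 ≤ n) (hp : 1 < p) (hα : α ∈ Ioc 0 A)
    (hb : ∀ i, b i ∈ Ioc 0 A) (hρ : ∀ i, ρ i ∈ Icc 0 R) (hr : r ∈ Icc 0 R)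
    (hbt : Tendsto b l (nhds α)) (hρt : Tendsto ρ l (nhds r)) :
    Tendsto (fun i => U (b i) (ρ i)) l (nhds (U α r)) ∧
      Tendsto (fun i => U' (b i) (ρ i)) l (nhds (U' α r)) := by
  have hρ' : Tendsto ρ l (nhdsWithin r (Ici 0)) :=
    tendsto_nhdsWithin_iff.2 ⟨hρt, Eventually.of_forall fun i => (hρ i).1⟩
  have h1 := ((S.sol α hα).cont r hr.1).tendsto.comp hρ'
  have h2 := ((S.sol α hα).cont' r hr.1).tendsto.comp hρ'
  have hz : Tendsto (fun i => |b i - α| * exp ((1 + p * M ^ (p - 1) + 2) * R)) l (nhds 0) := by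
    have h3 := ((hbt.sub_const α).abs).mul_const (exp ((1 + p * M ^ (p - 1) + 2) * R))
    simpa using h3
  constructor
  · have h3 : Tendsto (fun i => U (b i) (ρ i) - U α (ρ i)) l (nhds 0) :=
      squeeze_zero_norm (fun i => (S.abs_sub_le hn hp hα (hb i) (hρ i).1 (hρ i).2).1) hz
    simpa [Function.comp_def] using h3.add h1
  · have h3 : Tendsto (fun i => U' (b i) (ρ i) - U' α (ρ i)) l (nhds 0) :=
      squeeze_zero_norm (fun i => (S.abs_sub_le hn hp hα (hb i) (hρ i).1 (hρ i).2).2) hz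
    simpa [Function.comp_def] using h3.add h2

theorem exists_solPair (S : SolFamily n p A M U U') (hn : 3 ≤ n) (hp : 1 < p) {α : ℝ}
    (hα : α ∈ Ioc 0 A) : ∃ v v', SolPair n p (U α) (U' α) v v' := by
  obtain ⟨v, v', h0, hv⟩ := S.exists_variation (by omega) hp hα
  exact ⟨v, v', by exact_mod_cast hn, hp, S.sol α hα, by rw [S.init α hα]; exact hα.1, hv, h0⟩

theorem eventually_mem {α : ℝ} (hα : α ∈ Ioo 0 A) :
    ∀ᶠ β in nhdsWithin α (Ioi α), β ∈ Ioc 0 A ∧ α < β := by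
  filter_upwards [Ioo_mem_nhdsGT hα.2] with β hβ
  exact ⟨⟨hα.1.trans hβ.1, hβ.2.le⟩, hβ.1⟩

theorem tendsto_nhdsGT (S : SolFamily n p A M U U') (hn : 1 ≤ n) (hp : 1 < p) {α r : ℝ}
    (hα : α ∈ Ioo 0 A) (hr : 0 ≤ r) :
    Tendsto (fun β => U β r) (nhdsWithin α (Ioi α)) (nhds (U α r)) := by
  have hα' : α ∈ Ioc 0 A := Ioo_subset_Ioc_self hα
  have hz : Tendsto (fun β => |β - α| * exp ((1 + p * M ^ (p - 1) + 2) * r))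
      (nhdsWithin α (Ioi α)) (nhds 0) := by
    have h : Tendsto (fun β : ℝ => β) (nhdsWithin α (Ioi α)) (nhds α) := nhdsWithin_le_nhds
    simpa using ((h.sub_const α).abs).mul_const (exp ((1 + p * M ^ (p - 1) + 2) * r))
  have h3 : Tendsto (fun β => U β r - U α r) (nhdsWithin α (Ioi α)) (nhds 0) :=
    squeeze_zero_norm' ((eventually_mem hα).mono fun β hβ =>
      (S.abs_sub_le hn hp hα' hβ.1 hr le_rfl).1) hz
  simpa using h3.add_const (U α r)

/-- A zero with positive Wronskian moves to the left as the initial value increases. -/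
theorem eventually_zero_mem (S : SolFamily n p A M U U') (hn : 1 ≤ n) (hp : 1 < p) {α : ℝ}
    (hα : α ∈ Ioo 0 A) {v v' : ℝ → ℝ} (P : SolPair n p (U α) (U' α) v v') {z l : ℝ} (hl0 : 0 ≤ l)
    (hl : l < z) (hz : U α z = 0) (hW : 0 < wfun (U α) (U' α) v v' z) :
    ∀ᶠ β in nhdsWithin α (Ioi α), ∃ c ∈ Ioo l z, U β c = 0 := by
  have hz0 : 0 < z := hl0.trans_lt hl
  set s := U' α z with hs
  have hsv : 0 < s * v z := by
    unfold wfun at hW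
    rw [hz, zero_mul, sub_zero] at hW
    exact pos_of_mul_pos_right hW hz0.le
  have hs0 : s ≠ 0 := fun h => by simp [h] at hsv
  have h1 : ∀ᶠ t in nhdsWithin z (Iio z), s * U α t < 0 := by
    have hd := ((P.sol.hasDeriv z hz0).hasDerivWithinAt (s := Iio z))
    rw [hasDerivWithinAt_iff_tendsto_slope' (by simp)] at hd
    have h2 : ∀ᶠ t in nhdsWithin z (Iio z), 0 < s * slope (U α) z t :=
      (hd.const_mul s).eventually_const_lt ((mul_self_pos.2 hs0))
    filter_upwards [h2, self_mem_nhdsWithin] with t ht htz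
    rw [slope_def_field, hz, sub_zero, ← mul_div_assoc] at ht
    have h3 : t - z < 0 := sub_neg.2 htz
    rcases div_pos_iff.1 ht with h4 | h4
    · linarith [h4.2]
    · exact h4.1
  obtain ⟨t, ht, htl⟩ := (h1.and (Ioo_mem_nhdsLT hl)).exists
  have ht0 : 0 ≤ t := hl0.trans htl.1.le
  have h2 : ∀ᶠ β in nhdsWithin α (Ioi α), s * U β t < 0 :=
    ((S.tendsto_nhdsGT hn hp hα ht0).const_mul s).eventually_lt_const ht
  have h3 : ∀ᶠ β in nhdsWithin α (Ioi α), 0 < s * ((U β z - U α z) / (β - α)) :=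
    ((S.tendsto_slope hn hp (Ioo_subset_Ioc_self hα) hα.2 P.var_init P.var hz0.le).1.const_mul
      s).eventually_const_lt hsv
  filter_upwards [h2, h3, eventually_mem hα] with β h4 h5 h6
  rw [hz, sub_zero, ← mul_div_assoc, div_pos_iff_of_pos_right (sub_pos.2 h6.2)] at h5
  obtain ⟨c, hc, hc'⟩ := zero_of_sign_change htl.2.le
    ((S.sol β h6.1).cont.mono fun x hx => ht0.trans hx.1) h4 h5
  exact ⟨c, ⟨htl.1.trans hc.1, hc.2⟩, hc'⟩

theorem eventually_hasZeros (S : SolFamily n p A M U U') (hn : 3 ≤ n) (h : Subcritical n p) {α : ℝ}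
    (hα : α ∈ Ioo 0 A) {N : ℕ} {R : ℝ} (hZ : HasZeros (U α) N R) :
    ∀ᶠ β in nhdsWithin α (Ioi α), HasZeros (U β) N R := by
  obtain ⟨v, v', P⟩ := S.exists_solPair hn h.hp (Ioo_subset_Ioc_self hα)
  obtain ⟨z, hz, hz'⟩ := hZ
  have hε : ∀ᶠ ε in nhdsWithin (0:ℝ) (Ioi 0), ∀ i, ε < z i ∧ ∀ j, i ≠ j → ε < |z i - z j| := by
    refine eventually_all.2 fun i => Eventually.and
      (nhdsWithin_le_nhds (eventually_lt_nhds (hz' i).1)) (eventually_all.2 fun j => ?_)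
    by_cases hij : i = j
    · exact Eventually.of_forall fun ε hc => absurd hij hc
    · filter_upwards [nhdsWithin_le_nhds (eventually_lt_nhds
        (abs_pos.2 (sub_ne_zero.2 (hz.ne hij))))] with ε hε _ using hε
  obtain ⟨ε, hε, hε0⟩ := (hε.and self_mem_nhdsWithin).exists
  have hall : ∀ᶠ β in nhdsWithin α (Ioi α), ∀ i, ∃ c ∈ Ioo (z i - ε) (z i), U β c = 0 :=
    eventually_all.2 fun i => S.eventually_zero_mem (by omega) h.hp hα P
      (by linarith [(hε i).1]) (by linarith) (hz' i).2.2
      (P.wfun_pos_of_zero h (hz' i).1 (hz' i).2.2)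
  filter_upwards [hall] with β hβ
  choose c hc hc' using hβ
  refine ⟨c, fun i j hij => ?_, fun i => ⟨?_, (hc i).2.le.trans (hz' i).2.1, hc' i⟩⟩
  · by_contra hne
    have h1 := (hε i).2 j hne
    have h2 := hc i
    have h3 := hc j
    rw [← hij] at h3
    have : |z i - z j| < ε := abs_lt.2 ⟨by linarith [h2.1, h2.2, h3.1, h3.2],
      by linarith [h2.1, h2.2, h3.1, h3.2]⟩
    linarith
  · linarith [(hc i).1, (hε i).1]

theorem isClosed_hasZeros (S : SolFamily n p A M U U') (hn : 1 ≤ n) (hp : 1 < p) {a b : ℝ}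
    (ha : 0 < a) (hb : b ≤ A) {N : ℕ} {R : ℝ} :
    IsClosed ({α | HasZeros (U α) N R} ∩ Icc a b) := by
  have hsub : Icc a b ⊆ Ioc 0 A := fun x hx => ⟨ha.trans_le hx.1, hx.2.trans hb⟩
  refine IsSeqClosed.isClosed fun x α hx hxα => ?_
  have hα : α ∈ Icc a b := isClosed_Icc.mem_of_tendsto hxα (Eventually.of_forall fun i => (hx i).2)
  refine ⟨?_, hα⟩
  choose z hz hz' using fun i => (hx i).1
  have hzc : ∀ i, z i ∈ Set.pi univ fun _ : Fin N => Icc (0:ℝ) R :=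
    fun i j _ => ⟨(hz' i j).1.le, (hz' i j).2.1⟩
  obtain ⟨y, hy, φ, hφ, hyt⟩ :=
    (isCompact_univ_pi fun _ : Fin N => isCompact_Icc (a := (0:ℝ)) (b := R)).tendsto_subseq hzc
  have hyt' : ∀ j, Tendsto (fun i => z (φ i) j) atTop (nhds (y j)) := fun j =>
    (tendsto_pi_nhds.1 hyt) j
  have hxt := hxα.comp hφ.tendsto_atTop
  have hy' : ∀ j, y j ∈ Icc 0 R := fun j => hy j (mem_univ j)
  have hU : ∀ j, U α (y j) = 0 := fun j => by
    have h1 := (S.tendsto_apply hn hp (hsub hα) (fun i => hsub (hx (φ i)).2)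
      (fun i => hzc (φ i) j (mem_univ j)) (hy' j) hxt (hyt' j)).1
    refine tendsto_nhds_unique h1 (tendsto_const_nhds.congr fun i => ((hz' (φ i) j).2.2).symm)
  have hα0 := (hsub hα).1
  have hy0 : ∀ j, 0 < y j := fun j => (hy' j).1.lt_of_ne fun h0 => by
    have := hU j
    rw [← h0, S.init α (hsub hα)] at this
    linarith
  refine ⟨y, fun j₁ j₂ hj => ?_, fun j => ⟨hy0 j, (hy' j).2, hU j⟩⟩
  by_contra hne
  have hrolle : ∀ i, ∃ c ∈ uIcc (z (φ i) j₁) (z (φ i) j₂), U' (x (φ i)) c = 0 := by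
    intro i
    have key : ∀ s t, 0 < s → s < t → U (x (φ i)) s = 0 → U (x (φ i)) t = 0 →
        ∃ c ∈ Ioo s t, U' (x (φ i)) c = 0 := fun s t hs hst h1 h2 =>
      exists_hasDerivAt_eq_zero hst
        ((S.sol _ (hsub (hx (φ i)).2)).cont.mono fun q hq => hs.le.trans hq.1) (by rw [h1, h2])
        (fun q hq => (S.sol _ (hsub (hx (φ i)).2)).hasDeriv q (hs.trans hq.1))
    rcases lt_or_gt_of_ne ((hz (φ i)).ne hne) with hlt | hlt
    · obtain ⟨c, hc, hc'⟩ := key _ _ (hz' _ j₁).1 hlt (hz' _ j₁).2.2 (hz' _ j₂).2.2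
      exact ⟨c, Icc_subset_uIcc (Ioo_subset_Icc_self hc), hc'⟩
    · obtain ⟨c, hc, hc'⟩ := key _ _ (hz' _ j₂).1 hlt (hz' _ j₂).2.2 (hz' _ j₁).2.2
      exact ⟨c, Icc_subset_uIcc' (Ioo_subset_Icc_self hc), hc'⟩
  choose c hc hc' using hrolle
  have hct : Tendsto c atTop (nhds (y j₁)) := by
    have h1 := (hyt' j₁).min (hyt' j₂)
    have h2 := (hyt' j₁).max (hyt' j₂)
    rw [← hj, min_self] at h1
    rw [← hj, max_self] at h2
    exact tendsto_of_tendsto_of_tendsto_of_le_of_le h1 h2 (fun i => (hc i).1) (fun i => (hc i).2)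
  have hcR : ∀ i, c i ∈ Icc 0 R := fun i =>
    ⟨(le_min (hz' (φ i) j₁).1.le (hz' (φ i) j₂).1.le).trans (hc i).1,
    (hc i).2.trans (max_le (hz' (φ i) j₁).2.1 (hz' (φ i) j₂).2.1)⟩
  have h1 := (S.tendsto_apply hn hp (hsub hα) (fun i => hsub (hx (φ i)).2) hcR (hy' j₁) hxt hct).2
  have h2 : U' α (y j₁) = 0 :=
    tendsto_nhds_unique h1 (tendsto_const_nhds.congr fun i => (hc' i).symm)
  exact (S.sol α (hsub hα)).deriv_ne_zero_of_zero (by exact_mod_cast hn) hp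
    (by rw [S.init α (hsub hα)]; exact hα0.ne') (hy0 j₁) (hU j₁) h2

/-- Having many zeros persists as the initial value increases. -/
theorem hasZeros_of_le (S : SolFamily n p A M U U') (hn : 3 ≤ n) (h : Subcritical n p) {a b : ℝ}
    (ha : 0 < a) (hab : a ≤ b) (hb : b ≤ A) {N : ℕ} {R : ℝ} (hZ : HasZeros (U a) N R) :
    HasZeros (U b) N R := by
  have hs := (S.isClosed_hasZeros (by omega) h.hp ha hb (N := N)
    (R := R)).Icc_subset_of_forall_exists_gt hZ (fun x hx y hy => by
      have h1 := S.eventually_hasZeros hn h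
        (show x ∈ Ioo 0 A from ⟨ha.trans_le hx.2.1, hx.2.2.trans_le hb⟩) hx.1
      exact (h1.and (Ioc_mem_nhdsGT hy)).exists)
  exact hs (right_mem_Icc.2 hab)

end SolFamily

theorem f_const_mul {p σ : ℝ} (hσ : σ = 1 ∨ σ = -1) (s : ℝ) : f p (σ * s) = σ * f p s := by
  rcases hσ with rfl | rfl
  · simp
  · simp only [f, neg_one_mul, abs_neg]; ring

theorem RadialSol.sign_mul {n p σ : ℝ} {u u' : ℝ → ℝ} (hσ : σ = 1 ∨ σ = -1)
    (H : RadialSol n (fun r => f p (u r)) u u') :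
    RadialSol n (fun r => f p (σ * u r)) (fun r => σ * u r) (fun r => σ * u' r) :=
  (H.const_mul σ).congr fun r _ => (f_const_mul hσ (u r)).symm

theorem exists_sign_of_ne_zero {u : ℝ → ℝ} {R : ℝ} (hu : ContinuousOn u (Ici R))
    (h : ∀ r, R ≤ r → u r ≠ 0) :
    ∃ σ : ℝ, (σ = 1 ∨ σ = -1) ∧ ∀ r, R ≤ r → 0 < σ * u r := by
  have hno : ∀ r, R ≤ r → (0 : ℝ) ∉ uIcc (u R) (u r) := fun r hr h0 => by
    obtain ⟨c, hc, hc'⟩ := intermediate_value_uIcc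
      (hu.mono ((uIcc_of_le hr).subset.trans Icc_subset_Ici_self)) h0
    rw [uIcc_of_le hr] at hc
    exact h c hc.1 hc'
  rcases lt_or_gt_of_ne (h R le_rfl) with h0 | h0
  · refine ⟨-1, .inr rfl, fun r hr => ?_⟩
    by_contra hc
    exact hno r hr (mem_uIcc.2 (.inl ⟨h0.le, by linarith⟩))
  · refine ⟨1, .inl rfl, fun r hr => ?_⟩
    by_contra hc
    exact hno r hr (mem_uIcc.2 (.inr ⟨by linarith, h0.le⟩))

/-- A solution that leaves a positive decaying tail downwards must vanish later on. -/
theorem RadialSol.exists_zero_of_lt {n p R : ℝ} {w w' y y' : ℝ → ℝ} (hp : 1 < p)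
    (hw : RadialSol n (fun r => f p (w r)) w w') (hy : RadialSol n (fun r => f p (y r)) y y')
    (hR : 0 < R) (hw0 : Tendsto w atTop (nhds 0))
    (hsmall : ∀ r, R ≤ r → p * |w r| ^ (p - 1) ≤ 1)
    (hyR : 0 < y R) (h : y R < w R) (h' : y' R < w' R) : ∃ t, R < t ∧ y t = 0 := by
  by_contra! hne
  have hsub : Ici R ⊆ Ici 0 := Ici_subset_Ici.2 hR.le
  have hpos : ∀ t, R ≤ t → 0 < y t := fun t ht => by
    by_contra hc
    obtain ⟨c, hc, hc'⟩ := intermediate_value_Icc' ht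
      (hy.cont.mono (Icc_subset_Ici_self.trans hsub)) ⟨not_lt.1 hc, hyR.le⟩
    rcases hc.1.eq_or_lt with rfl | h1
    · exact hyR.ne' hc'
    · exact hne c h1 hc'
  have hd := hw.sub hy
  have hcoop : ∀ b, R ≤ b → ∀ t ∈ Icc R b, 0 < w t - y t ∧ 0 < w' t - y' t := fun b hb => by
    have hsub' : Icc R b ⊆ Ici 0 := Icc_subset_Ici_self.trans hsub
    refine pos_of_cooperative (A := fun _ => 0) (B := fun t => -((n - 1) / t))
      (hd.cont.mono hsub') (hd.cont'.mono hsub')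
      (fun t ht => hd.hasDeriv t (hR.trans ht.1)) (fun t ht => hd.hasDeriv' t (hR.trans ht.1))
      continuousOn_const
      (continuousOn_const.div continuousOn_id fun t ht => (hR.trans_le ht.1).ne').neg
      (fun t _ ht => by simpa using ht.le) (fun t ht hlt => ?_) (by linarith) (by linarith)
    have hyt := hpos t ht.1.le
    have hanti : AntitoneOn (f p) (Icc (y t) (w t)) :=
      antitoneOn_Icc_of_hasDerivAt (g' := fder p)
        (fun s _ => (hasDerivAt_f hp s).continuousAt.continuousWithinAt)
        (fun s _ => hasDerivAt_f hp s) fun s hs => by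
          have h1 : |s| ^ (p - 1) ≤ |w t| ^ (p - 1) :=
            Real.rpow_le_rpow (abs_nonneg s)
              (abs_le_abs_of_nonneg (hyt.trans hs.1).le hs.2.le) (by linarith)
          have h2 := hsmall t ht.1.le
          unfold fder
          nlinarith
    have := hanti (left_mem_Icc.2 (by linarith)) (right_mem_Icc.2 (by linarith)) (by linarith)
    linarith
  have hle : ∀ t, R ≤ t → w R - y R ≤ w t := fun t ht => by
    have h1 := (strictMonoOn_Icc_of_hasDerivAt
      (hd.cont.mono (Icc_subset_Ici_self.trans hsub)) (fun s hs => hd.hasDeriv s (hR.trans hs.1))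
      (fun s hs => (hcoop t ht s (Ioo_subset_Icc_self hs)).2)).monotoneOn
      (left_mem_Icc.2 ht) (right_mem_Icc.2 ht) ht
    have h2 := hpos t ht
    linarith
  have := ge_of_tendsto hw0 (eventually_atTop.2 ⟨R, hle⟩)
  linarith

namespace SolFamily

variable {n : ℕ} {p A M : ℝ} {U U' : ℝ → ℝ → ℝ}

/-- Just above the initial value of a bound state, solutions gain a zero. -/
theorem eventually_exists_hasZeros_succ (S : SolFamily n p A M U U') (hn : 3 ≤ n)
    (h : Subcritical n p) {α : ℝ} (hα : α ∈ Ioo 0 A) (hd : Decaying (U α) (U' α)) {k : ℕ}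
    {z : Fin k → ℝ} (hz : ExactZeros (U α) k z) :
    ∀ᶠ β in nhdsWithin α (Ioi α), ∃ R, HasZeros (U β) (k + 1) R := by
  have hα' : α ∈ Ioc 0 A := Ioo_subset_Ioc_self hα
  have hn1 : 1 ≤ n := by omega
  have hp := h.hp
  obtain ⟨v, v', P⟩ := S.exists_solPair hn hp hα'
  obtain ⟨R₁, hR₁⟩ : ∃ R₁, ∀ i, z i < R₁ :=
    (eventually_all.2 fun i => eventually_gt_atTop (z i)).exists
  obtain ⟨σ, hσ, hpos⟩ := exists_sign_of_ne_zero (u := U α) (R := max R₁ 1)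
    (P.sol.cont.mono (Ici_subset_Ici.2 (zero_le_one.trans (le_max_right _ _)))) fun r hr h0 => by
      obtain ⟨i, rfl⟩ := hz.2.2 r (zero_lt_one.trans_le ((le_max_right _ _).trans hr)) h0
      linarith [hR₁ i, le_max_left R₁ 1]
  have T : DecayingTail n p (fun r => σ * U α r) (fun r => σ * U' α r) :=
    { hn := h.hn
      hp := hp
      sol := P.sol.sign_mul hσ
      pos := eventually_atTop.2 ⟨_, hpos⟩
      tendsto := by simpa using hd.1.const_mul σ
      tendsto' := by simpa using hd.2.const_mul σ }
  obtain ⟨R₂, hR₂⟩ := eventually_atTop.1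
    (T.eventually_small (ε := 1 / p) (one_div_pos.2 (by linarith)))
  obtain ⟨R, ⟨hv, hv'⟩, hR1, hR2⟩ :=
    ((P.escape h hσ T).and_eventually
      ((eventually_ge_atTop R₁).and (eventually_ge_atTop R₂))).exists
  obtain ⟨hR0, -, hwR, -⟩ := hR₂ R hR2
  have hsmall : ∀ r, R ≤ r → p * |σ * U α r| ^ (p - 1) ≤ 1 := fun r hr => by
    have h1 := (hR₂ r (hR2.trans hr)).2.2.2
    rw [lt_div_iff₀ (by linarith)] at h1
    linarith
  have hZ : HasZeros (U α) k R :=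
    ⟨z, hz.1.injective, fun i => ⟨(hz.2.1 i).1, (hR₁ i).le.trans hR1, (hz.2.1 i).2⟩⟩
  have hs := S.tendsto_slope hn1 hp hα' hα.2 P.var_init P.var hR0.le
  filter_upwards [S.eventually_hasZeros hn h hα hZ, eventually_mem hα,
    ((S.tendsto_nhdsGT hn1 hp hα hR0.le).const_mul σ).eventually_const_lt hwR,
    (hs.1.const_mul σ).eventually_lt_const hv, (hs.2.const_mul σ).eventually_lt_const hv']
    with β h1 h2 h3 h4 h5
  have hβ : 0 < β - α := sub_pos.2 h2.2
  rw [← mul_div_assoc, div_lt_iff₀ hβ, zero_mul, mul_sub] at h4 h5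
  obtain ⟨t, ht, ht'⟩ := T.sol.exists_zero_of_lt hp ((S.sol β h2.1).sign_mul hσ) hR0 T.tendsto
    hsmall h3 (by linarith) (by linarith)
  have hσ0 : σ ≠ 0 := by rcases hσ with rfl | rfl <;> norm_num
  exact ⟨t, h1.cons hR0.le ht ((mul_eq_zero.1 ht').resolve_left hσ0)⟩

end SolFamily

theorem not_lt_of_exactZeros {n : ℕ} {p : ℝ} (hn : 3 ≤ n) (h : Subcritical n p) {k : ℕ}
    {α₁ α₂ : ℝ} (hα₁ : 0 < α₁) {u₁ u₁' u₁'' u₂ u₂' u₂'' : ℝ → ℝ}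
    (h₁ : IsSolution n p α₁ u₁ u₁' u₁'') (h₂ : IsSolution n p α₂ u₂ u₂' u₂'')
    (hd₁ : Decaying u₁ u₁') {z₁ z₂ : Fin k → ℝ} (hz₁ : ExactZeros u₁ k z₁)
    (hz₂ : ExactZeros u₂ k z₂) : ¬ α₁ < α₂ := by
  intro hlt
  have hn1 : 1 ≤ n := by omega
  have hα₂ := hα₁.trans hlt
  obtain ⟨M, U, U', S⟩ := exists_solFamily hn1 h.hp hα₂
  have hα : α₁ ∈ Ioo 0 α₂ := ⟨hα₁, hlt⟩
  have he₁ := fun r (hr : 0 ≤ r) =>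
    S.eq_of_init hn1 h.hp (Ioo_subset_Ioc_self hα) h₁.radialSol h₁.init hr
  have he₂ := fun r (hr : 0 ≤ r) =>
    S.eq_of_init hn1 h.hp (right_mem_Ioc.2 hα₂) h₂.radialSol h₂.init hr
  have hd : Decaying (U α₁) (U' α₁) :=
    ⟨hd₁.1.congr' ((eventually_ge_atTop 0).mono fun r hr => (he₁ r hr).1),
      hd₁.2.congr' ((eventually_ge_atTop 0).mono fun r hr => (he₁ r hr).2)⟩
  have hz : ExactZeros (U α₁) k z₁ :=
    ⟨hz₁.1, fun i => ⟨(hz₁.2.1 i).1, (he₁ _ (hz₁.2.1 i).1.le).1 ▸ (hz₁.2.1 i).2⟩,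
      fun r hr h0 => hz₁.2.2 r hr ((he₁ r hr.le).1.trans h0)⟩
  obtain ⟨β, ⟨R, hβ⟩, hβ₂⟩ := ((S.eventually_exists_hasZeros_succ hn h hα hd hz).and
    (Ioo_mem_nhdsGT hlt)).exists
  obtain ⟨y, hy, hy'⟩ := S.hasZeros_of_le hn h (hα₁.trans hβ₂.1) hβ₂.2.le le_rfl hβ
  exact hz₂.not_hasZeros ⟨y, hy, fun i =>
    ⟨(hy' i).1, (hy' i).2.1, (he₂ _ (hy' i).1.le).1.trans (hy' i).2.2⟩⟩

theorem subcritical_of_lt_div {n : ℕ} (hn : 3 ≤ n) {p : ℝ} (hp1 : 1 < p)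
    (hp2 : p < ((n : ℝ) + 2) / ((n : ℝ) - 2)) : Subcritical n p := by
  have hn' : (3:ℝ) ≤ n := by exact_mod_cast hn
  have hsub : p * ((n : ℝ) - 2) < n + 2 := (lt_div_iff₀ (by linarith)).1 hp2
  refine ⟨hn', hp1, hsub, ?_⟩
  rcases le_or_gt p 3 with h | h
  · exact .inl h
  · right
    have h4 : (n : ℝ) < 4 := by nlinarith
    have h5 : n < 4 := by exact_mod_cast h4
    have h6 : n = 3 := by omega
    exact_mod_cast h6

/-- uniqueness of the `k`-node bound state at the level of initial data. -/
theorem statement0 (n : ℕ) (hn : 3 ≤ n) (p : ℝ) (hp1 : 1 < p)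
    (hp2 : p < ((n : ℝ) + 2) / ((n : ℝ) - 2))
    (k : ℕ) (hk : 0 < k)
    (α₁ α₂ : ℝ) (hα₁ : 0 < α₁) (hα₂ : 0 < α₂)
    (u₁ u₁' u₁'' u₂ u₂' u₂'' : ℝ → ℝ)
    (h₁ : IsSolution n p α₁ u₁ u₁' u₁'')
    (h₂ : IsSolution n p α₂ u₂ u₂' u₂'')
    (hd₁ : Decaying u₁ u₁') (hd₂ : Decaying u₂ u₂')
    (z₁ z₂ : Fin k → ℝ)
    (hz₁ : ExactZeros u₁ k z₁) (hz₂ : ExactZeros u₂ k z₂) :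
    α₁ = α₂ := by
  have h := subcritical_of_lt_div hn hp1 hp2
  exact le_antisymm (not_lt.1 (not_lt_of_exactZeros hn h hα₂ h₂ h₁ hd₂ hz₂ hz₁))
    (not_lt.1 (not_lt_of_exactZeros hn h hα₁ h₁ h₂ hd₁ hz₁ hz₂))
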